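/- Let G be an affine Nash group and let H be the smallest normal Nash subgroup of G such that some quotient of G by H is almost linear. Then H lies in the center of the identity connected component G⁰ of G; in particular, H is commutative. -/

import Mathlib

open Set

/-- A basic semialgebraic subset of `ℝⁿ`, given by one polynomial equation
`p = 0` and finitely many polynomial inequalities `g > 0`. -/
def BasicSemialgebraic {n : ℕ} (p : MvPolynomial (Fin n) ℝ)
    (gs : List (MvPolynomial (Fin n) ℝ)) : Set (Fin n → ℝ) :=
  {x | MvPolynomial.eval x p = 0 ∧ ∀ g ∈ gs, 0 < MvPolynomial.eval x g}

/-- A subset of `ℝⁿ` is semialgebraic if it is a finite union of finite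
intersections of basic semialgebraic sets. -/
def IsSemialgebraic {n : ℕ} (S : Set (Fin n → ℝ)) : Prop :=
  ∃ L : List (List (MvPolynomial (Fin n) ℝ × List (MvPolynomial (Fin n) ℝ))),
    S = ⋃ c ∈ L, ⋂ b ∈ c, BasicSemialgebraic b.1 b.2

/-- `S` is a `d`-dimensional real analytic submanifold of `ℝⁿ`: around each of
its points there is an analytic chart of `ℝⁿ` flattening `S` onto the first `d`
coordinates. -/
def IsAnalyticSubmanifold {n : ℕ} (d : ℕ) (S : Set (Fin n → ℝ)) : Prop :=
  ∀ x ∈ S, ∃ (U V : Set (Fin n → ℝ)) (φ ψ : (Fin n → ℝ) → (Fin n → ℝ)),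
    IsOpen U ∧ IsOpen V ∧ x ∈ U ∧
    AnalyticOnNhd ℝ φ U ∧ AnalyticOnNhd ℝ ψ V ∧
    (∀ y ∈ U, φ y ∈ V) ∧ (∀ y ∈ V, ψ y ∈ U) ∧
    (∀ y ∈ U, ψ (φ y) = y) ∧ (∀ y ∈ V, φ (ψ y) = y) ∧
    φ '' (U ∩ S) = V ∩ {y | ∀ i : Fin n, d ≤ (i : ℕ) → y i = 0}

/-- `f` is real analytic on `S`: near each point of `S` it is the restriction
of a real analytic map defined on an open set. -/
def LocAnalyticOn {n m : ℕ} (S : Set (Fin n → ℝ)) (f : (Fin n → ℝ) → (Fin m → ℝ)) : Prop :=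
  ∀ x ∈ S, ∃ U : Set (Fin n → ℝ), IsOpen U ∧ x ∈ U ∧
    ∃ g : (Fin n → ℝ) → (Fin m → ℝ), AnalyticOnNhd ℝ g U ∧ ∀ y ∈ U ∩ S, g y = f y

/-- The graph of `f` restricted to `S`, as a subset of `ℝ^(n+m)`. -/
def NashGraph {n m : ℕ} (S : Set (Fin n → ℝ)) (f : (Fin n → ℝ) → (Fin m → ℝ)) :
    Set (Fin (n + m) → ℝ) :=
  {z | ∃ x ∈ S, z = Fin.append x (f x)}

/-- A Nash mapping on `S`: real analytic with semialgebraic graph. -/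
def IsNashMapOn {n m : ℕ} (S : Set (Fin n → ℝ)) (f : (Fin n → ℝ) → (Fin m → ℝ)) : Prop :=
  LocAnalyticOn S f ∧ IsSemialgebraic (NashGraph S f)

/-- First `n` coordinates of a point of `ℝ^(n+m)`. -/
def frontHalf {n m : ℕ} (z : Fin (n + m) → ℝ) : Fin n → ℝ := fun i => z (Fin.castAdd m i)

/-- Last `m` coordinates of a point of `ℝ^(n+m)`. -/
def backHalf {n m : ℕ} (z : Fin (n + m) → ℝ) : Fin m → ℝ := fun i => z (Fin.natAdd n i)

/-- An affine Nash group: a semialgebraic analytic submanifold of some `ℝⁿ`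
together with a group structure whose multiplication and inversion are Nash
mappings. -/
structure NashGroup where
  n : ℕ
  dim : ℕ
  carrier : Set (Fin n → ℝ)
  semialg : IsSemialgebraic carrier
  submanifold : IsAnalyticSubmanifold dim carrier
  one : Fin n → ℝ
  mul : (Fin n → ℝ) → (Fin n → ℝ) → (Fin n → ℝ)
  inv : (Fin n → ℝ) → (Fin n → ℝ)
  one_mem : one ∈ carrier
  mul_mem : ∀ x ∈ carrier, ∀ y ∈ carrier, mul x y ∈ carrier
  inv_mem : ∀ x ∈ carrier, inv x ∈ carrier
  mul_assoc : ∀ x ∈ carrier, ∀ y ∈ carrier, ∀ z ∈ carrier,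
    mul (mul x y) z = mul x (mul y z)
  one_mul : ∀ x ∈ carrier, mul one x = x
  mul_one : ∀ x ∈ carrier, mul x one = x
  inv_mul_cancel : ∀ x ∈ carrier, mul (inv x) x = one
  mul_nash : IsNashMapOn {z : Fin (n + n) → ℝ | frontHalf z ∈ carrier ∧ backHalf z ∈ carrier}
      (fun z => mul (frontHalf z) (backHalf z))
  inv_nash : IsNashMapOn carrier inv

/-- A Nash subgroup of an affine Nash group: a subgroup which is a
semialgebraic subset. -/
structure IsNashSubgroup (G : NashGroup) (H : Set (Fin G.n → ℝ)) : Prop where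
  subset : H ⊆ G.carrier
  one_mem : G.one ∈ H
  mul_mem : ∀ x ∈ H, ∀ y ∈ H, G.mul x y ∈ H
  inv_mem : ∀ x ∈ H, G.inv x ∈ H
  semialg : IsSemialgebraic H

/-- `N` is a normal subset of the subgroup `K` of `G`. -/
def IsNormalIn (G : NashGroup) (K N : Set (Fin G.n → ℝ)) : Prop :=
  ∀ g ∈ K, ∀ x ∈ N, G.mul (G.mul g x) (G.inv g) ∈ N

/-- A Nash homomorphism defined on the subgroup `H` of `G`, with values in the
affine Nash group `Q`. -/
structure IsNashHomOn (G : NashGroup) (H : Set (Fin G.n → ℝ)) (Q : NashGroup)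
    (f : (Fin G.n → ℝ) → (Fin Q.n → ℝ)) : Prop where
  mapsTo : ∀ x ∈ H, f x ∈ Q.carrier
  map_mul : ∀ x ∈ H, ∀ y ∈ H, f (G.mul x y) = Q.mul (f x) (f y)
  nash : IsNashMapOn H f

/-- Flattening of a square matrix to a point of `ℝ^(m*m)`. -/
def matFlatten {m : ℕ} (A : Matrix (Fin m) (Fin m) ℝ) : Fin (m * m) → ℝ :=
  fun k => A (finProdFinEquiv.symm k).1 (finProdFinEquiv.symm k).2

/-- The subgroup `H` of `G` is almost linear: it admits a Nash homomorphism
with finite kernel into `GL(m, ℝ)` for some `m`. -/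
def AlmostLinearOn (G : NashGroup) (H : Set (Fin G.n → ℝ)) : Prop :=
  ∃ (m : ℕ) (f : (Fin G.n → ℝ) → Matrix (Fin m) (Fin m) ℝ),
    IsNashMapOn H (fun x => matFlatten (f x)) ∧
    (∀ x ∈ H, IsUnit (f x)) ∧
    (∀ x ∈ H, ∀ y ∈ H, f (G.mul x y) = f x * f y) ∧
    Set.Finite {x ∈ H | f x = 1}

/-- An affine Nash group is almost linear if it admits a Nash homomorphism
with finite kernel into some `GL(m, ℝ)`. -/
def NashGroup.AlmostLinear (G : NashGroup) : Prop := AlmostLinearOn G G.carrier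

/-- `Q` is a quotient of the subgroup `H` of `G` by a normal Nash subgroup:
there are a normal Nash subgroup `N` of `H` and a surjective Nash homomorphism
`H → Q` with kernel `N`. -/
def IsQuotientOf (G : NashGroup) (H : Set (Fin G.n → ℝ)) (Q : NashGroup) : Prop :=
  ∃ (N : Set (Fin G.n → ℝ)) (π : (Fin G.n → ℝ) → (Fin Q.n → ℝ)),
    IsNashSubgroup G N ∧ N ⊆ H ∧ IsNormalIn G H N ∧
    IsNashHomOn G H Q π ∧ π '' H = Q.carrier ∧ {x ∈ H | π x = Q.one} = N

/-- The subgroup `H` of `G` is anti-linear: it has no quotient which is an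
almost linear affine Nash group of positive dimension. -/
def AntiLinearOn (G : NashGroup) (H : Set (Fin G.n → ℝ)) : Prop :=
  ∀ Q : NashGroup, IsQuotientOf G H Q → Q.AlmostLinear → Q.dim = 0

/-- The subgroup `H` of `G` is toroidal: connected and anti-linear. -/
def ToroidalOn (G : NashGroup) (H : Set (Fin G.n → ℝ)) : Prop :=
  IsConnected H ∧ AntiLinearOn G H

/-- A toroidal affine Nash group: connected and anti-linear. -/
def NashGroup.Toroidal (G : NashGroup) : Prop := ToroidalOn G G.carrier

/-- An affine Nash group is complete if it has no nontrivial connected almost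
linear Nash subgroup. -/
def NashGroup.Complete (G : NashGroup) : Prop :=
  ∀ H, IsNashSubgroup G H → IsConnected H → AlmostLinearOn G H → H = {G.one}

/-- An abelian Nash manifold: a connected complete affine Nash group. -/
def AbelianNashManifold (G : NashGroup) : Prop := IsConnected G.carrier ∧ G.Complete

/-- Some quotient of `G` by `N` is an almost linear affine Nash group. -/
def HasAlmostLinearQuotientBy (G : NashGroup) (N : Set (Fin G.n → ℝ)) : Prop :=
  ∃ (Q : NashGroup) (π : (Fin G.n → ℝ) → (Fin Q.n → ℝ)),
    IsNashHomOn G G.carrier Q π ∧ π '' G.carrier = Q.carrier ∧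
    {x ∈ G.carrier | π x = Q.one} = N ∧ Q.AlmostLinear
section Semialgebraic

open Polynomial

/-- Two reals occupy the same position relative to a set of pairs of reals. -/
def SamePos (M : Set (ℝ × ℝ)) (t t' : ℝ) : Prop :=
  ∀ m ∈ M, (t < m.1 ↔ t' < m.2) ∧ (m.1 < t ↔ m.2 < t')

/-- A set of pairs of reals is the graph of a strictly monotone partial map. -/
def Compat (M : Set (ℝ × ℝ)) : Prop := ∀ m ∈ M, SamePos M m.1 m.2

lemma SamePos.mono {M N : Set (ℝ × ℝ)} (h : M ⊆ N) {t t' : ℝ} (hN : SamePos N t t') :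
    SamePos M t t' := fun m hm => hN m (h hm)

lemma samePos_swap {M : Set (ℝ × ℝ)} {t t' : ℝ} :
    SamePos (Prod.swap ⁻¹' M) t' t ↔ SamePos M t t' := by
  constructor
  · intro h m hm
    have := h (m.2, m.1) hm
    exact ⟨this.1.symm, this.2.symm⟩
  · intro h m hm
    have := h (m.2, m.1) hm
    exact ⟨this.1.symm, this.2.symm⟩

lemma Compat.swap {M : Set (ℝ × ℝ)} (h : Compat M) : Compat (Prod.swap ⁻¹' M) :=
  fun _ hm => samePos_swap.2 (h _ hm)

lemma SamePos.eq_iff {M : Set (ℝ × ℝ)} {t t' : ℝ} (h : SamePos M t t') {m : ℝ × ℝ}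
    (hm : m ∈ M) : m.1 = t ↔ m.2 = t' := by
  have := h m hm
  constructor
  · intro e
    exact le_antisymm (not_lt.1 fun h' => absurd (this.1.2 h') (by simp [e]))
      (not_lt.1 fun h' => absurd (this.2.2 h') (by simp [e]))
  · intro e
    exact le_antisymm (not_lt.1 fun h' => absurd (this.1.1 h') (by simp [e]))
      (not_lt.1 fun h' => absurd (this.2.1 h') (by simp [e]))

lemma exists_samePos {M : Set (ℝ × ℝ)} (hf : M.Finite) (hc : Compat M) (t : ℝ) :
    ∃ t', SamePos M t t' := by
  classical
  by_cases ht : ∃ m ∈ M, m.1 = t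
  · obtain ⟨m, hm, rfl⟩ := ht
    exact ⟨m.2, hc m hm⟩
  push Not at ht
  obtain ⟨t', h1, h2⟩ := Order.exists_between_finsets
    (lo := (hf.toFinset.filter (fun m => m.1 < t)).image Prod.snd)
    (hi := (hf.toFinset.filter (fun m => t < m.1)).image Prod.snd) (by
      intro a ha b hb
      simp only [Finset.mem_image, Finset.mem_filter, Set.Finite.mem_toFinset] at ha hb
      obtain ⟨m, ⟨hm, hmt⟩, rfl⟩ := ha
      obtain ⟨k, ⟨hk, hkt⟩, rfl⟩ := hb
      exact ((hc m hm) k hk).1.1 (hmt.trans hkt))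
  simp only [Finset.mem_image, Finset.mem_filter, Set.Finite.mem_toFinset] at h1 h2
  refine ⟨t', fun m hm => ?_⟩
  rcases lt_or_gt_of_ne (ht m hm) with h | h
  · have := h1 _ ⟨m, ⟨hm, h⟩, rfl⟩
    simp [h, this, h.not_gt, this.not_gt]
  · have := h2 _ ⟨m, ⟨hm, h⟩, rfl⟩
    simp [h, this, h.not_gt, this.not_gt]

lemma Polynomial.exists_root_of_mul_neg (p : ℝ[X]) {a b : ℝ} (hab : a < b)
    (h : p.eval a * p.eval b < 0) : ∃ c ∈ Set.Ioo a b, p.eval c = 0 := by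
  rcases mul_neg_iff.1 h with ⟨h1, h2⟩ | ⟨h1, h2⟩
  · exact intermediate_value_Ioo' hab.le p.continuous.continuousOn ⟨h2, h1⟩
  · exact intermediate_value_Ioo hab.le p.continuous.continuousOn ⟨h1, h2⟩

lemma Polynomial.sign_eval_eq_of_ne_zero (p : ℝ[X]) {s t : ℝ}
    (h : ∀ r ∈ Set.uIcc s t, p.eval r ≠ 0) :
    SignType.sign (p.eval s) = SignType.sign (p.eval t) := by
  have hs := h s Set.left_mem_uIcc
  have ht := h t Set.right_mem_uIcc
  have key : ∀ a b, a < b → (∀ r ∈ Set.Icc a b, p.eval r ≠ 0) →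
      SignType.sign (p.eval a) = SignType.sign (p.eval b) := by
    intro a b hab hr
    have h1 := hr a (by simp [hab.le])
    have h2 := hr b (by simp [hab.le])
    by_cases hn : p.eval a * p.eval b < 0
    · obtain ⟨c, hc, h0⟩ := p.exists_root_of_mul_neg hab hn
      exact absurd h0 (hr c ⟨hc.1.le, hc.2.le⟩)
    · rcases lt_or_gt_of_ne h1 with h1 | h1 <;> rcases lt_or_gt_of_ne h2 with h2 | h2
      · simp [sign_neg h1, sign_neg h2]
      · exact absurd (mul_neg_of_neg_of_pos h1 h2) hn
      · exact absurd (mul_neg_of_pos_of_neg h1 h2) hn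
      · simp [sign_pos h1, sign_pos h2]
  rcases lt_trichotomy s t with hst | hst | hst
  · exact key s t hst (by rwa [Set.uIcc_of_lt hst] at h)
  · rw [hst]
  · exact (key t s hst (by rwa [Set.uIcc_of_gt hst] at h)).symm

lemma Polynomial.exists_derivative_eq_zero (p : ℝ[X]) {a b : ℝ} (hab : a < b)
    (h : p.eval a = p.eval b) : ∃ c ∈ Set.Ioo a b, p.derivative.eval c = 0 := by
  obtain ⟨c, hc, h'⟩ := exists_deriv_eq_zero (f := fun x => p.eval x) hab
    p.continuous.continuousOn h
  exact ⟨c, hc, by simpa using h'⟩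

lemma Polynomial.eq_zero_of_eventually_eval_eq_zero (p : ℝ[X]) {t : ℝ}
    (h : ∀ᶠ s in nhds t, p.eval s = 0) : p = 0 :=
  p.eq_zero_of_infinite_isRoot (infinite_of_mem_nhds t h)

lemma exists_mem_of_root {M : Set (ℝ × ℝ)} (hf : M.Finite) (hc : Compat M) {p p' : ℝ[X]}
    (h : ∀ t t', SamePos M t t' → SignType.sign (p.eval t) = SignType.sign (p'.eval t'))
    (hp : p ≠ 0) {t : ℝ} (ht : p.eval t = 0) : ∃ m ∈ M, m.1 = t := by
  by_contra hcon
  push Not at hcon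
  obtain ⟨t', ht'⟩ := exists_samePos hf hc t
  apply hp
  apply p.eq_zero_of_eventually_eval_eq_zero (t := t)
  have : ∀ᶠ s in nhds t, ∀ m ∈ M, (s < m.1 ↔ t < m.1) ∧ (m.1 < s ↔ m.1 < t) := by
    rw [Filter.eventually_all_finite hf]
    intro m hm
    rcases lt_or_gt_of_ne (hcon m hm) with h | h
    · filter_upwards [lt_mem_nhds h] with s hs
      simp [h, hs, h.not_gt, hs.not_gt]
    · filter_upwards [gt_mem_nhds h] with s hs
      simp [h, hs, h.not_gt, hs.not_gt]
  filter_upwards [this] with s hs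
  have h1 : SamePos M s t' := fun m hm =>
    ⟨(hs m hm).1.trans (ht' m hm).1, (hs m hm).2.trans (ht' m hm).2⟩
  have h2 := h s t' h1
  rw [← h t t' ht', ht, sign_zero, sign_eq_zero_iff] at h2
  exact h2

/-- Roots of `f` correspond to roots of `f'` in the same position, once all critical points
are matched. -/
lemma exists_root_samePos {M : Set (ℝ × ℝ)} (hf : M.Finite) (hc : Compat M) {f f' : ℝ[X]}
    (h1 : ∀ m ∈ M, SignType.sign (f.eval m.1) = SignType.sign (f'.eval m.2))
    (h2 : ∀ r, f.derivative.eval r = 0 → ∃ m ∈ M, m.1 = r)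
    (hlo : ∃ m ∈ M, ∀ t ≤ m.1, f.eval t ≠ 0) (hhi : ∃ m ∈ M, ∀ t, m.1 ≤ t → f.eval t ≠ 0)
    {t : ℝ} (ht : f.eval t = 0) : ∃ t', f'.eval t' = 0 ∧ SamePos M t t' := by
  by_cases htM : ∃ m ∈ M, m.1 = t
  · obtain ⟨m, hm, rfl⟩ := htM
    refine ⟨m.2, ?_, hc m hm⟩
    have := h1 m hm
    rw [ht, sign_zero] at this
    exact sign_eq_zero_iff.1 this.symm
  push Not at htM
  obtain ⟨l, hl, hl'⟩ := hlo
  obtain ⟨u, hu, hu'⟩ := hhi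
  have hlt : l.1 < t := not_le.1 fun h => hl' t h ht
  have hut : t < u.1 := not_le.1 fun h => hu' t h ht
  obtain ⟨a, ⟨ha, hat⟩, hamax⟩ := Set.exists_max_image {m ∈ M | m.1 < t} Prod.fst
    (hf.subset (Set.sep_subset _ _)) ⟨l, hl, hlt⟩
  obtain ⟨b, ⟨hb, htb⟩, hbmin⟩ := Set.exists_min_image {m ∈ M | t < m.1} Prod.fst
    (hf.subset (Set.sep_subset _ _)) ⟨u, hu, hut⟩
  simp only [Set.mem_ofPred_eq] at hat htb hamax hbmin
  have hab : a.1 < b.1 := hat.trans htb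
  have hno : ∀ m ∈ M, m.1 ≤ a.1 ∨ b.1 ≤ m.1 := by
    intro m hm
    rcases lt_or_gt_of_ne (htM m hm) with h | h
    · exact Or.inl (hamax m ⟨hm, h⟩)
    · exact Or.inr (hbmin m ⟨hm, h⟩)
  have hinj : Set.InjOn (fun x => f.eval x) (Set.Icc a.1 b.1) := by
    have key : ∀ x y, x ∈ Set.Icc a.1 b.1 → y ∈ Set.Icc a.1 b.1 → f.eval x = f.eval y →
        ¬ x < y := by
      intro x y hx hy hxy hlt
      obtain ⟨c, hcc, hc0⟩ := f.exists_derivative_eq_zero hlt hxy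
      obtain ⟨m, hm, rfl⟩ := h2 c hc0
      rcases hno m hm with h | h
      · exact absurd (h.trans hx.1) (not_le.2 hcc.1)
      · exact absurd (hy.2.trans h) (not_le.2 hcc.2)
    intro x hx y hy hxy
    exact le_antisymm (not_lt.1 (key y x hy hx hxy.symm)) (not_lt.1 (key x y hx hy hxy))
  have hmul : f.eval a.1 * f.eval b.1 < 0 := by
    rcases ContinuousOn.strictMonoOn_of_injOn_Icc' hab.le f.continuous.continuousOn hinj with h | h
    · have e1 := h ⟨le_rfl, hab.le⟩ ⟨hat.le, htb.le⟩ hat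
      have e2 := h ⟨hat.le, htb.le⟩ ⟨hab.le, le_rfl⟩ htb
      simp only [ht] at e1 e2
      exact mul_neg_of_neg_of_pos e1 e2
    · have e1 := h ⟨le_rfl, hab.le⟩ ⟨hat.le, htb.le⟩ hat
      have e2 := h ⟨hat.le, htb.le⟩ ⟨hab.le, le_rfl⟩ htb
      simp only [ht] at e1 e2
      exact mul_neg_of_pos_of_neg e1 e2
  have hmul' : f'.eval a.2 * f'.eval b.2 < 0 := by
    rw [← sign_eq_neg_one_iff, sign_mul, ← h1 a ha, ← h1 b hb, ← sign_mul,
      sign_eq_neg_one_iff]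
    exact hmul
  obtain ⟨t', ht', h0⟩ := f'.exists_root_of_mul_neg (((hc a ha) b hb).1.1 hab) hmul'
  refine ⟨t', h0, fun m hm => ?_⟩
  rcases hno m hm with h | h
  · have h3 : m.2 ≤ a.2 := not_lt.1 fun h4 => absurd (((hc a ha) m hm).1.2 h4) (not_lt.2 h)
    have h5 : m.2 < t' := h3.trans_lt ht'.1
    have h6 : m.1 < t := h.trans_lt hat
    simp [h5, h6, h5.not_gt, h6.not_gt]
  · have h3 : b.2 ≤ m.2 := not_lt.1 fun h4 => absurd (((hc b hb) m hm).2.2 h4) (not_lt.2 h)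
    have h5 : t' < m.2 := ht'.2.trans_le h3
    have h6 : t < m.1 := htb.trans_le h
    simp [h5, h6, h5.not_gt, h6.not_gt]

/-- Adding to a matching the matched roots of one more pair of polynomials. -/
lemma exists_extend_matching {M : Set (ℝ × ℝ)} (hf : M.Finite) (hc : Compat M) {f f' : ℝ[X]}
    (hf0 : f ≠ 0) (hf0' : f' ≠ 0)
    (h1 : ∀ m ∈ M, SignType.sign (f.eval m.1) = SignType.sign (f'.eval m.2))
    (h2 : ∀ r, f.derivative.eval r = 0 → ∃ m ∈ M, m.1 = r)
    (h2' : ∀ r, f'.derivative.eval r = 0 → ∃ m ∈ M, m.2 = r)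
    (hlo : ∃ m ∈ M, (∀ t ≤ m.1, f.eval t ≠ 0) ∧ ∀ t ≤ m.2, f'.eval t ≠ 0)
    (hhi : ∃ m ∈ M, (∀ t, m.1 ≤ t → f.eval t ≠ 0) ∧ ∀ t, m.2 ≤ t → f'.eval t ≠ 0) :
    ∃ N, M ⊆ N ∧ N.Finite ∧ Compat N ∧
      ∀ t t', SamePos N t t' → SignType.sign (f.eval t) = SignType.sign (f'.eval t') := by
  have hlo1 : ∃ m ∈ M, ∀ t ≤ m.1, f.eval t ≠ 0 := let ⟨m, hm, h⟩ := hlo; ⟨m, hm, h.1⟩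
  have hhi1 : ∃ m ∈ M, ∀ t, m.1 ≤ t → f.eval t ≠ 0 := let ⟨m, hm, h⟩ := hhi; ⟨m, hm, h.1⟩
  have fwd : ∀ {t}, f.eval t = 0 → ∃ t', f'.eval t' = 0 ∧ SamePos M t t' :=
    fun ht => exists_root_samePos hf hc h1 h2 hlo1 hhi1 ht
  have bwd : ∀ {t'}, f'.eval t' = 0 → ∃ t, f.eval t = 0 ∧ SamePos M t t' := by
    intro t' ht'
    obtain ⟨t, h0, ht⟩ := exists_root_samePos (M := Prod.swap ⁻¹' M) (f := f') (f' := f)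
      (hf.preimage Prod.swap_injective.injOn) hc.swap
      (fun m hm => (h1 _ hm).symm)
      (fun r hr => let ⟨m, hm, h⟩ := h2' r hr; ⟨m.swap, by simpa using hm, h⟩)
      (let ⟨m, hm, h⟩ := hlo; ⟨m.swap, by simpa using hm, h.2⟩)
      (let ⟨m, hm, h⟩ := hhi; ⟨m.swap, by simpa using hm, h.2⟩) ht'
    exact ⟨t, h0, samePos_swap.1 ht⟩
  set N : Set (ℝ × ℝ) := M ∪ {q | f.eval q.1 = 0 ∧ f'.eval q.2 = 0 ∧ SamePos M q.1 q.2} with hN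
  have hMN : M ⊆ N := Set.subset_union_left
  have hNc : Compat N := by
    have key : ∀ q r : ℝ × ℝ, f.eval q.1 = 0 → f'.eval q.2 = 0 → SamePos M q.1 q.2 →
        f.eval r.1 = 0 → f'.eval r.2 = 0 → SamePos M r.1 r.2 → (q.1 < r.1 ↔ q.2 < r.2) := by
      intro q r q1 q2 q3 r1 r2 r3
      constructor
      · intro h
        obtain ⟨c, hcI, hc0⟩ := f.exists_derivative_eq_zero h (q1.trans r1.symm)
        obtain ⟨m, hm, rfl⟩ := h2 c hc0
        exact ((q3 m hm).1.1 hcI.1).trans ((r3 m hm).2.1 hcI.2)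
      · intro h
        obtain ⟨c, hcI, hc0⟩ := f'.exists_derivative_eq_zero h (q2.trans r2.symm)
        obtain ⟨m, hm, rfl⟩ := h2' c hc0
        exact ((q3 m hm).1.2 hcI.1).trans ((r3 m hm).2.2 hcI.2)
    rintro q (hq | ⟨q1, q2, q3⟩) r (hr | ⟨r1, r2, r3⟩)
    · exact hc q hq r hr
    · exact ⟨(r3 q hq).2, (r3 q hq).1⟩
    · exact q3 r hr
    · exact ⟨key q r q1 q2 q3 r1 r2 r3, key r q r1 r2 r3 q1 q2 q3⟩
  refine ⟨N, hMN, ?_, hNc, ?_⟩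
  · refine hf.union (((f.roots.toFinset.finite_toSet).prod
      (f'.roots.toFinset.finite_toSet)).subset ?_)
    rintro q ⟨h1, h2, -⟩
    simp [hf0, hf0', h1, h2]
  intro t t' htt
  have hiff : f.eval t = 0 ↔ f'.eval t' = 0 := by
    constructor
    · intro h0
      obtain ⟨s, hs, hs'⟩ := fwd h0
      have := (htt.eq_iff (m := (t, s)) (Or.inr ⟨h0, hs, hs'⟩)).1 rfl
      simp only at this
      exact this ▸ hs
    · intro h0
      obtain ⟨s, hs, hs'⟩ := bwd h0
      have := (htt.eq_iff (m := (s, t')) (Or.inr ⟨hs, h0, hs'⟩)).2 rfl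
      simp only at this
      exact this ▸ hs
  by_cases h0 : f.eval t = 0
  · simp [h0, hiff.1 h0]
  have hex : ∃ m ∈ M, ∀ s ∈ Set.uIcc m.1 t, f.eval s ≠ 0 := by
    have hrf : {s | f.eval s = 0}.Finite := by
      refine f.roots.toFinset.finite_toSet.subset fun s hs => ?_
      simpa [hf0] using hs
    obtain ⟨l, hl, hl', -⟩ := hlo
    obtain ⟨u, hu, hu', -⟩ := hhi
    by_cases hA : ∃ s, f.eval s = 0 ∧ s < t
    · by_cases hB : ∃ s, f.eval s = 0 ∧ t < s
      · obtain ⟨a, ⟨ha, hat⟩, hamax⟩ := Set.exists_max_image {s | f.eval s = 0 ∧ s < t} id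
          (hrf.subset fun s hs => hs.1) hA
        obtain ⟨b, ⟨hb, htb⟩, hbmin⟩ := Set.exists_min_image {s | f.eval s = 0 ∧ t < s} id
          (hrf.subset fun s hs => hs.1) hB
        simp only [id] at hamax hbmin
        obtain ⟨c, hcI, hc0⟩ := f.exists_derivative_eq_zero (hat.trans htb) (ha.trans hb.symm)
        obtain ⟨m, hm, rfl⟩ := h2 c hc0
        refine ⟨m, hm, fun s hs hs0 => ?_⟩
        have hs1 : a < s := (lt_min hcI.1 hat).trans_le hs.1
        have hs2 : s < b := hs.2.trans_lt (max_lt hcI.2 htb)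
        rcases lt_trichotomy s t with h | h | h
        · exact absurd (hamax s ⟨hs0, h⟩) (not_le.2 hs1)
        · exact h0 (h ▸ hs0)
        · exact absurd (hbmin s ⟨hs0, h⟩) (not_le.2 hs2)
      · push Not at hB
        refine ⟨u, hu, fun s hs hs0 => ?_⟩
        have h3 := hB s hs0
        have h4 : s < u.1 := not_le.1 fun h => hu' s h hs0
        have h5 : s ≠ t := fun h => h0 (h ▸ hs0)
        have h6 : min u.1 t ≤ s := hs.1
        rcases min_le_iff.1 h6 with h | h
        · exact absurd h (not_le.2 h4)
        · exact h5 (le_antisymm h3 h)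
    · push Not at hA
      refine ⟨l, hl, fun s hs hs0 => ?_⟩
      have h3 := hA s hs0
      have h4 : l.1 < s := not_le.1 fun h => hl' s h hs0
      have h5 : s ≠ t := fun h => h0 (h ▸ hs0)
      have h6 : s ≤ max l.1 t := hs.2
      rcases le_max_iff.1 h6 with h | h
      · exact absurd h (not_le.2 h4)
      · exact h5 (le_antisymm h h3)
  obtain ⟨m, hm, hmt⟩ := hex
  rw [← f.sign_eval_eq_of_ne_zero hmt, h1 m hm]
  apply f'.sign_eval_eq_of_ne_zero
  intro r hr hr0
  obtain ⟨s, hs0, hs⟩ := bwd hr0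
  have hsN : (s, r) ∈ N := Or.inr ⟨hs0, hr0, hs⟩
  refine hmt s ?_ hs0
  have e1 := hs m hm
  have e2 := htt (s, r) hsN
  simp only at e2
  rw [Set.mem_uIcc] at hr ⊢
  simp only [← not_lt] at hr ⊢
  tauto

lemma Polynomial.exists_forall_sign_eval_eq (p : ℝ[X]) : ∃ B : ℝ, ∀ t, B ≤ t →
    SignType.sign (p.eval t) = SignType.sign p.leadingCoeff := by
  rcases Nat.eq_zero_or_pos p.natDegree with h | h
  · refine ⟨0, fun t _ => ?_⟩
    rw [Polynomial.eq_C_of_natDegree_eq_zero h]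
    simp
  have key : ∀ q : ℝ[X], 0 < q.natDegree → 0 < q.leadingCoeff → ∃ B : ℝ, ∀ t, B ≤ t →
    0 < q.eval t := by
    intro q hq hl
    have := q.tendsto_atTop_of_leadingCoeff_nonneg (natDegree_pos_iff_degree_pos.1 hq) hl.le
    exact Filter.eventually_atTop.1 (this.eventually_gt_atTop 0)
  rcases lt_trichotomy p.leadingCoeff 0 with hl | hl | hl
  · obtain ⟨B, hB⟩ := key (-p) (by simpa using h) (by simpa using hl)
    refine ⟨B, fun t ht => ?_⟩
    have := hB t ht
    rw [eval_neg] at this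
    rw [sign_neg (by linarith), sign_neg hl]
  · rw [leadingCoeff_eq_zero] at hl
    simp [hl] at h
  · obtain ⟨B, hB⟩ := key p h hl
    refine ⟨B, fun t ht => ?_⟩
    rw [sign_pos (hB t ht), sign_pos hl]

lemma Polynomial.exists_forall_sign_eval_eq' (p : ℝ[X]) : ∃ B : ℝ, ∀ t, B ≤ t →
    SignType.sign (p.eval t) = SignType.sign p.leadingCoeff ∧
    SignType.sign (p.eval (-t)) = SignType.sign ((-1) ^ p.natDegree * p.leadingCoeff) := by
  obtain ⟨B, hB⟩ := p.exists_forall_sign_eval_eq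
  obtain ⟨C, hC⟩ := (p.comp (-X)).exists_forall_sign_eval_eq
  refine ⟨max B C, fun t ht => ⟨hB t (le_trans (le_max_left _ _) ht), ?_⟩⟩
  have := hC t (le_trans (le_max_right _ _) ht)
  simpa [mul_comm] using this

/-- The analytic core of the elimination step: a matching of a family together with sign
information for `f` at the roots of the family extends to a matching including `f`. -/
lemma exists_matching_step {I : Type*} {M : Set (ℝ × ℝ)} (hf : M.Finite) (hc : Compat M)
    (J : Set I) (P P' : I → ℝ[X])
    (hs : ∀ t t', SamePos M t t' → ∀ i ∈ J,
      SignType.sign ((P i).eval t) = SignType.sign ((P' i).eval t'))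
    (f f' : ℝ[X]) (hd : f.natDegree = f'.natDegree) (hd0 : 0 < f.natDegree)
    (hlc : SignType.sign f.leadingCoeff = SignType.sign f'.leadingCoeff)
    (hder : ∃ i ∈ J, P i = f.derivative ∧ P' i = f'.derivative)
    (hred : ∀ i ∈ J, P i ≠ 0 → P' i ≠ 0 → ∀ t t', (P i).eval t = 0 → (P' i).eval t' = 0 →
      SamePos M t t' → SignType.sign (f.eval t) = SignType.sign (f'.eval t')) :
    ∃ N : Set (ℝ × ℝ), N.Finite ∧ Compat N ∧ ∀ t t', SamePos N t t' →
      SignType.sign (f.eval t) = SignType.sign (f'.eval t') ∧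
      ∀ i ∈ J, SignType.sign ((P i).eval t) = SignType.sign ((P' i).eval t') := by
  have hf0 : f ≠ 0 := by rintro rfl; simp at hd0
  have hf0' : f' ≠ 0 := by rintro rfl; simp [hd] at hd0
  have hsw : ∀ t t', SamePos (Prod.swap ⁻¹' M) t t' → ∀ i ∈ J,
      SignType.sign ((P' i).eval t) = SignType.sign ((P i).eval t') :=
    fun t t' h i hi => (hs t' t (samePos_swap.1 h) i hi).symm
  have hfsw : (Prod.swap ⁻¹' M).Finite := hf.preimage Prod.swap_injective.injOn
  have hzero : ∀ i ∈ J, P i = 0 → P' i = 0 := by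
    intro i hi h0
    refine Polynomial.funext fun r => ?_
    obtain ⟨t, ht⟩ := exists_samePos hfsw hc.swap r
    have := hsw r t ht i hi
    simpa [h0] using this
  have hzero' : ∀ i ∈ J, P' i = 0 → P i = 0 := by
    intro i hi h0
    refine Polynomial.funext fun r => ?_
    obtain ⟨t, ht⟩ := exists_samePos hf hc r
    have := hs r t ht i hi
    simpa [h0] using this
  set M0 : Set (ℝ × ℝ) := {m ∈ M | ∃ i ∈ J, P i ≠ 0 ∧ (P i).eval m.1 = 0} with hM0
  have hM0M : M0 ⊆ M := Set.sep_subset _ _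
  have root1 : ∀ i ∈ J, P i ≠ 0 → ∀ t, (P i).eval t = 0 → ∃ m ∈ M0, m.1 = t := by
    intro i hi hne t ht
    obtain ⟨m, hm, rfl⟩ := exists_mem_of_root hf hc (fun t t' h => hs t t' h i hi) hne ht
    exact ⟨m, ⟨hm, i, hi, hne, ht⟩, rfl⟩
  have root2 : ∀ i ∈ J, P i ≠ 0 → ∀ t, (P' i).eval t = 0 → ∃ m ∈ M0, m.2 = t := by
    intro i hi hne t ht
    obtain ⟨m, hm, rfl⟩ := exists_mem_of_root hfsw hc.swap (fun t t' h => hsw t t' h i hi)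
      (fun h => hne (hzero' i hi h)) ht
    have hm' : m.swap ∈ M := hm
    refine ⟨m.swap, ⟨hm', i, hi, hne, ?_⟩, rfl⟩
    have := hs _ _ (hc _ hm') i hi
    simp only [Prod.fst_swap, Prod.snd_swap, ht, sign_zero, sign_eq_zero_iff] at this
    exact this
  have hsign0 : ∀ t t', SamePos M0 t t' → ∀ i ∈ J,
      SignType.sign ((P i).eval t) = SignType.sign ((P' i).eval t') := by
    intro t t' htt i hi
    by_cases hP : P i = 0
    · simp [hP, hzero i hi hP]
    obtain ⟨s', hs'⟩ := exists_samePos hf hc t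
    rw [hs t s' hs' i hi]
    by_cases hst : s' = t'
    · rw [hst]
    apply Polynomial.sign_eval_eq_of_ne_zero
    intro r hr hr0
    obtain ⟨m, hm, rfl⟩ := root2 i hi hP r hr0
    have e1 := htt m hm
    have e2 := hs' m (hM0M hm)
    rw [e1.1, e1.2] at e2
    rw [Set.mem_uIcc] at hr
    apply hst
    rcases hr with ⟨h, h'⟩ | ⟨h, h'⟩
    · have a1 : ¬ t' < m.2 := not_lt.2 h'
      have a2 : ¬ m.2 < s' := not_lt.2 h
      have a3 : ¬ s' < m.2 := fun h => a1 (e2.1.2 h)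
      have a4 : ¬ m.2 < t' := fun h => a2 (e2.2.1 h)
      exact (le_antisymm (not_lt.1 a2) (not_lt.1 a3)).trans
        (le_antisymm (not_lt.1 a1) (not_lt.1 a4))
    · have a1 : ¬ m.2 < t' := not_lt.2 h
      have a2 : ¬ s' < m.2 := not_lt.2 h'
      have a3 : ¬ m.2 < s' := fun h => a1 (e2.2.2 h)
      have a4 : ¬ t' < m.2 := fun h => a2 (e2.1.1 h)
      exact (le_antisymm (not_lt.1 a3) (not_lt.1 a2)).trans
        (le_antisymm (not_lt.1 a4) (not_lt.1 a1))
  have hf00 : M0.Finite := hf.subset hM0M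
  obtain ⟨b, hb⟩ := f.exists_forall_sign_eval_eq'
  obtain ⟨b', hb'⟩ := f'.exists_forall_sign_eval_eq'
  obtain ⟨c, hcb⟩ := (hf00.image (fun m => |m.1|)).bddAbove
  obtain ⟨c', hcb'⟩ := (hf00.image (fun m => |m.2|)).bddAbove
  set B := max b (max 0 c) + 1
  set B' := max b' (max 0 c') + 1
  have hB : b ≤ B ∧ 0 < B ∧ ∀ m ∈ M0, |m.1| < B := by
    have h1 := le_max_left b (max 0 c)
    have h2 := le_max_right b (max 0 c)
    have h3 := le_max_left 0 c
    have h4 := le_max_right 0 c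
    refine ⟨by linarith, by linarith, fun m hm => ?_⟩
    have := hcb (Set.mem_image_of_mem _ hm)
    linarith
  have hB' : b' ≤ B' ∧ 0 < B' ∧ ∀ m ∈ M0, |m.2| < B' := by
    have h1 := le_max_left b' (max 0 c')
    have h2 := le_max_right b' (max 0 c')
    have h3 := le_max_left 0 c'
    have h4 := le_max_right 0 c'
    refine ⟨by linarith, by linarith, fun m hm => ?_⟩
    have := hcb' (Set.mem_image_of_mem _ hm)
    linarith
  clear_value B B'
  have hlne : f.leadingCoeff ≠ 0 := leadingCoeff_ne_zero.2 hf0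
  have hlne' : f'.leadingCoeff ≠ 0 := leadingCoeff_ne_zero.2 hf0'
  set M1 : Set (ℝ × ℝ) := insert (B, B') (insert (-B, -B') M0) with hM1
  have hM1f : M1.Finite := (hf00.insert _).insert _
  have hM01 : M0 ⊆ M1 := (Set.subset_insert _ _).trans (Set.subset_insert _ _)
  have hM1c : Compat M1 := by
    have k0 : ∀ m ∈ M0, -B < m.1 ∧ m.1 < B ∧ -B' < m.2 ∧ m.2 < B' := fun m hm =>
      ⟨(abs_lt.1 (hB.2.2 m hm)).1, (abs_lt.1 (hB.2.2 m hm)).2,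
        (abs_lt.1 (hB'.2.2 m hm)).1, (abs_lt.1 (hB'.2.2 m hm)).2⟩
    have hBB := hB.2.1
    have hBB' := hB'.2.1
    have e1 : -B < B := by linarith
    have e1' : -B' < B' := by linarith
    rintro m (rfl | rfl | hm) n (rfl | rfl | hn)
    · simp
    · simp [e1, e1', e1.not_gt, e1'.not_gt]
    · obtain ⟨h1, h2, h3, h4⟩ := k0 n hn
      simp [h2, h4, h2.not_gt, h4.not_gt]
    · simp [e1, e1', e1.not_gt, e1'.not_gt]
    · simp
    · obtain ⟨h1, h2, h3, h4⟩ := k0 n hn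
      simp [h1, h3, h1.not_gt, h3.not_gt]
    · obtain ⟨h1, h2, h3, h4⟩ := k0 m hm
      simp [h2, h4, h2.not_gt, h4.not_gt]
    · obtain ⟨h1, h2, h3, h4⟩ := k0 m hm
      simp [h1, h3, h1.not_gt, h3.not_gt]
    · exact hc m (hM0M hm) n (hM0M hn)
  have hne : ∀ (g : ℝ[X]) (a : ℝ) (s : ℝ), s ≠ 0 →
      SignType.sign (g.eval a) = SignType.sign s → g.eval a ≠ 0 := by
    intro g a s hs h h0
    rw [h0, sign_zero, eq_comm, sign_eq_zero_iff] at h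
    exact hs h
  have hpow : ∀ k : ℕ, ((-1 : ℝ)) ^ k ≠ 0 := fun k => pow_ne_zero _ (by norm_num)
  obtain ⟨N, hMN, hNf, hNc, hNs⟩ := exists_extend_matching hM1f hM1c hf0 hf0' (by
      rintro m (rfl | rfl | hm)
      · simp only; rw [(hb B hB.1).1, (hb' B' hB'.1).1, hlc]
      · simp only; rw [(hb B hB.1).2, (hb' B' hB'.1).2, sign_mul, sign_mul, hlc, hd]
      · obtain ⟨hmM, i, hi, hne, h0⟩ := hm
        refine hred i hi hne (fun h => hne (hzero' i hi h)) _ _ h0 ?_ (hc m hmM)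
        have := hs _ _ (hc m hmM) i hi
        rw [h0, sign_zero, eq_comm, sign_eq_zero_iff] at this
        exact this)
    (by
      obtain ⟨i, hi, h, h'⟩ := hder
      intro r hr
      have hne : P i ≠ 0 := by
        rw [h]; intro h0
        have := derivative_eq_zero.1 h0
        omega
      obtain ⟨m, hm, e⟩ := root1 i hi hne r (by rw [h]; exact hr)
      exact ⟨m, hM01 hm, e⟩)
    (by
      obtain ⟨i, hi, h, h'⟩ := hder
      intro r hr
      have hne : P i ≠ 0 := by
        rw [h]; intro h0
        have := derivative_eq_zero.1 h0
        omega
      obtain ⟨m, hm, e⟩ := root2 i hi hne r (by rw [h']; exact hr)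
      exact ⟨m, hM01 hm, e⟩)
    ⟨(-B, -B'), by simp [hM1], by
      refine ⟨fun t ht => ?_, fun t ht => ?_⟩
      · refine hne _ _ _ (mul_ne_zero (hpow f.natDegree) hlne) ?_
        have := (hb (-t) (by simp only at ht; linarith [hB.1])).2
        rwa [neg_neg] at this
      · refine hne _ _ _ (mul_ne_zero (hpow f'.natDegree) hlne') ?_
        have := (hb' (-t) (by simp only at ht; linarith [hB'.1])).2
        rwa [neg_neg] at this⟩
    ⟨(B, B'), by simp [hM1], by
      refine ⟨fun t ht => ?_, fun t ht => ?_⟩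
      · exact hne _ _ _ hlne (hb t (hB.1.trans ht)).1
      · exact hne _ _ _ hlne' (hb' t (hB'.1.trans ht)).1⟩
  exact ⟨N, hNf, hNc, fun t t' h => ⟨hNs t t' h, hsign0 t t' (h.mono (hM01.trans hMN))⟩⟩

/-- The families of real polynomials obtained from `F` by specializing the coefficients along
`x` and `x'` have the same sign table. -/
def Matched {R : Type*} [CommRing R] (x x' : R →+* ℝ) (F : Multiset R[X]) : Prop :=
  ∃ M : Set (ℝ × ℝ), M.Finite ∧ Compat M ∧ ∀ t t', SamePos M t t' → ∀ p ∈ F,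
    SignType.sign ((p.map x).eval t) = SignType.sign ((p.map x').eval t')

/-- One step of pseudo-division of `f` by `h`, with a square multiplier. -/
noncomputable def pseudoRed {R : Type*} [CommRing R] (f h : R[X]) : R[X] :=
  C (h.leadingCoeff ^ 2) * f -
    C (h.leadingCoeff * f.leadingCoeff) * (X ^ (f.natDegree - h.natDegree) * h)

lemma natDegree_pseudoRed_lt {R : Type*} [CommRing R] {f h : R[X]} (hf : 0 < f.natDegree)
    (hh : h.natDegree ≤ f.natDegree) : (pseudoRed f h).natDegree < f.natDegree := by
  have h1 : (pseudoRed f h).natDegree ≤ f.natDegree := by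
    refine (natDegree_sub_le _ _).trans (max_le (natDegree_C_mul_le _ _) ?_)
    refine (natDegree_C_mul_le _ _).trans (natDegree_mul_le.trans ?_)
    have := natDegree_X_pow_le (R := R) (f.natDegree - h.natDegree)
    omega
  have h2 : (pseudoRed f h).coeff f.natDegree = 0 := by
    have e : (X ^ (f.natDegree - h.natDegree) * h).coeff f.natDegree = h.leadingCoeff := by
      conv_lhs => rw [show f.natDegree = h.natDegree + (f.natDegree - h.natDegree) by omega]
      rw [show h.natDegree + (f.natDegree - h.natDegree) - h.natDegree
        = f.natDegree - h.natDegree by omega, coeff_X_pow_mul]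
      rfl
    rw [pseudoRed, coeff_sub, coeff_C_mul, coeff_C_mul, e]
    change _ * f.leadingCoeff - _ = 0
    ring
  rcases h1.lt_or_eq with h | h
  · exact h
  · exfalso
    rw [← h] at h2
    rw [coeff_natDegree, leadingCoeff_eq_zero] at h2
    rw [h2] at h
    simp at h
    omega

lemma sign_eval_pseudoRed {R : Type*} [CommRing R] (x : R →+* ℝ) {f h : R[X]}
    (hl : x h.leadingCoeff ≠ 0) {t : ℝ} (ht : (h.map x).eval t = 0) :
    SignType.sign (((pseudoRed f h).map x).eval t) = SignType.sign ((f.map x).eval t) := by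
  have : ((pseudoRed f h).map x).eval t = x h.leadingCoeff ^ 2 * (f.map x).eval t := by
    simp [pseudoRed, ht]
  rw [this, sign_mul, sign_pos (by positivity), one_mul]

lemma map_eraseLead_eq {R : Type*} [CommRing R] (x : R →+* ℝ) {p : R[X]}
    (h : x p.leadingCoeff = 0) : p.eraseLead.map x = p.map x := by
  have := congrArg (Polynomial.map x) p.eraseLead_add_C_mul_X_pow
  rwa [Polynomial.map_add, Polynomial.map_mul, Polynomial.map_C, h, C_0, zero_mul, add_zero] at this

/-- The sign table of a family of polynomials in one variable is determined by the signs of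
finitely many expressions in the coefficients. -/
theorem exists_finite_matched {R : Type*} [CommRing R] (F : Multiset R[X]) :
    ∃ Φ : Set R, Φ.Finite ∧ ∀ x x' : R →+* ℝ,
      (∀ φ ∈ Φ, SignType.sign (x φ) = SignType.sign (x' φ)) → Matched x x' F := by
  classical
  induction hd : F.map natDegree using
    (Multiset.wellFounded_isDershowitzMannaLT (α := ℕ)).induction generalizing F with
  | _ D ih =>
  subst hd
  by_cases hF : ∀ p ∈ F, p.natDegree = 0
  · refine ⟨{a | a ∈ F.map (fun p => p.coeff 0)}, ?_, fun x x' h => ?_⟩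
    · exact (F.map (fun p => p.coeff 0)).toFinset.finite_toSet.subset fun a ha => by simpa using ha
    · refine ⟨∅, Set.finite_empty, fun m hm => hm.elim, fun t t' _ p hp => ?_⟩
      have := h (p.coeff 0) (by
        rw [Set.mem_ofPred_eq]; exact Multiset.mem_map_of_mem (fun p : R[X] => p.coeff 0) hp)
      rw [eq_C_of_natDegree_eq_zero (hF p hp)]
      simpa using this
  push Not at hF
  obtain ⟨f, hfF, hfmax⟩ := F.toFinset.exists_max_image natDegree
    (let ⟨p, hp, _⟩ := hF; ⟨p, by simpa using hp⟩)
  simp only [Multiset.mem_toFinset] at hfF hfmax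
  have hf0 : 0 < f.natDegree := by
    obtain ⟨p, hp, h⟩ := hF
    exact (Nat.pos_of_ne_zero h).trans_le (hfmax p hp)
  have hErase : ∀ p : {p // p ∈ F ∧ p.natDegree ≠ 0}, ∃ Φ : Set R, Φ.Finite ∧
      ∀ x x' : R →+* ℝ, (∀ φ ∈ Φ, SignType.sign (x φ) = SignType.sign (x' φ)) →
        Matched x x' (p.1.eraseLead ::ₘ F.erase p.1) := by
    rintro ⟨p, hp, hp0⟩
    refine ih _ ?_ _ rfl
    refine ⟨(F.erase p).map natDegree, {p.eraseLead.natDegree}, {p.natDegree}, by simp, ?_, ?_, ?_⟩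
    · rw [Multiset.map_cons, add_comm]; rfl
    · conv_lhs => rw [← Multiset.cons_erase hp, Multiset.map_cons]
      rw [add_comm]; rfl
    · intro y hy
      rw [Multiset.mem_singleton] at hy
      refine ⟨p.natDegree, by simp, ?_⟩
      have := p.eraseLead_natDegree_le
      omega
  choose Ψ hΨf hΨ using hErase
  set F0 : Multiset R[X] := derivative f ::ₘ F.erase f with hF0
  have hF0deg : ∀ p ∈ F0, p.natDegree ≤ f.natDegree := by
    intro p hp
    rcases Multiset.mem_cons.1 hp with rfl | hp
    · exact (natDegree_derivative_le f).trans (Nat.sub_le _ _)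
    · exact hfmax p (Multiset.mem_of_mem_erase hp)
  obtain ⟨Φ, hΦf, hΦ⟩ := ih ((F0 + F0.map (pseudoRed f)).map natDegree) (by
    refine ⟨(F.erase f).map natDegree,
      (derivative f).natDegree ::ₘ (F0.map (pseudoRed f)).map natDegree, {f.natDegree},
      by simp, ?_, ?_, ?_⟩
    · rw [hF0]
      simp only [Multiset.map_add, Multiset.map_cons, Multiset.cons_add, Multiset.add_cons]
      rw [Multiset.cons_swap]
    · conv_lhs => rw [← Multiset.cons_erase hfF, Multiset.map_cons]
      rw [add_comm]; rfl
    · intro y hy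
      refine ⟨f.natDegree, by simp, ?_⟩
      rcases Multiset.mem_cons.1 hy with rfl | hy
      · exact natDegree_derivative_lt hf0.ne'
      · rw [Multiset.map_map, Multiset.mem_map] at hy
        obtain ⟨p, hp, rfl⟩ := hy
        exact natDegree_pseudoRed_lt hf0 (hF0deg p hp)) _ rfl
  refine ⟨{a | a ∈ F.map leadingCoeff} ∪ Φ ∪ ⋃ p, Ψ p, ?_, fun x x' hxx => ?_⟩
  · have : Finite {p // p ∈ F ∧ p.natDegree ≠ 0} :=
      Set.Finite.to_subtype (F.toFinset.finite_toSet.subset fun a ha => by simpa using ha.1)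
    refine ((Set.Finite.subset (F.map leadingCoeff).toFinset.finite_toSet
      fun a ha => by simpa using ha).union hΦf).union (Set.finite_iUnion hΨf)
  have hlc : ∀ p ∈ F, SignType.sign (x p.leadingCoeff) = SignType.sign (x' p.leadingCoeff) :=
    fun p hp => hxx _ (Or.inl (Or.inl (by
      rw [Set.mem_ofPred_eq]; exact Multiset.mem_map_of_mem leadingCoeff hp)))
  have hlc0 : ∀ p ∈ F, (x p.leadingCoeff = 0 ↔ x' p.leadingCoeff = 0) := by
    intro p hp
    rw [← sign_eq_zero_iff, hlc p hp, sign_eq_zero_iff]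
  by_cases hv : ∃ p ∈ F, p.natDegree ≠ 0 ∧ x p.leadingCoeff = 0
  · obtain ⟨p, hp, hp0, hpx⟩ := hv
    obtain ⟨M, hMf, hMc, hM⟩ := hΨ ⟨p, hp, hp0⟩ x x'
      (fun φ hφ => hxx φ (Or.inr (Set.mem_iUnion.2 ⟨_, hφ⟩)))
    refine ⟨M, hMf, hMc, fun t t' htt q hq => ?_⟩
    rw [← Multiset.cons_erase hp] at hq
    rcases Multiset.mem_cons.1 hq with rfl | hq
    · have := hM t t' htt q.eraseLead (Multiset.mem_cons_self _ _)
      rwa [map_eraseLead_eq x hpx, map_eraseLead_eq x' ((hlc0 q hp).1 hpx)] at this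
    · exact hM t t' htt q (Multiset.mem_cons_of_mem hq)
  push Not at hv
  obtain ⟨M, hMf, hMc, hM⟩ := hΦ x x' (fun φ hφ => hxx φ (Or.inl (Or.inr hφ)))
  have hfx := hv f hfF hf0.ne'
  have hfx' : x' f.leadingCoeff ≠ 0 := fun h => hfx ((hlc0 f hfF).2 h)
  have hderlc : ∀ y : R →+* ℝ, y f.leadingCoeff ≠ 0 → y (derivative f).leadingCoeff ≠ 0 := by
    intro y hy
    have hc : (derivative f).coeff (f.natDegree - 1) = f.leadingCoeff * f.natDegree := by
      rw [coeff_derivative, ← Nat.cast_add_one, Nat.sub_add_cancel hf0, coeff_natDegree]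
    have hy2 : y ((derivative f).coeff (f.natDegree - 1)) ≠ 0 := by
      rw [hc, map_mul, map_natCast]
      exact mul_ne_zero hy (by exact_mod_cast hf0.ne')
    have : (derivative f).natDegree = f.natDegree - 1 := by
      refine le_antisymm (natDegree_derivative_le f) (le_natDegree_of_ne_zero fun h => hy2 ?_)
      rw [h, map_zero]
    rwa [leadingCoeff, this]
  have hF0lc : ∀ p ∈ F0, p.map x ≠ 0 → (∃ t, (p.map x).eval t = 0) →
      x p.leadingCoeff ≠ 0 ∧ x' p.leadingCoeff ≠ 0 := by
    intro p hp hpx ⟨t, ht⟩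
    rcases Multiset.mem_cons.1 hp with rfl | hp
    · exact ⟨hderlc x hfx, hderlc x' hfx'⟩
    · have hpF := Multiset.mem_of_mem_erase hp
      have hp0 : p.natDegree ≠ 0 := by
        intro h0
        rw [eq_C_of_natDegree_eq_zero h0] at ht hpx
        simp only [Polynomial.map_C, eval_C] at ht
        simp [ht] at hpx
      exact ⟨hv p hpF hp0, fun h => hv p hpF hp0 ((hlc0 p hpF).2 h)⟩
  obtain ⟨N, hNf, hNc, hN⟩ := exists_matching_step hMf hMc {p | p ∈ F0} (fun p => p.map x)
    (fun p => p.map x') (fun t t' h p hp => hM t t' h p (Multiset.mem_add.2 (Or.inl hp)))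
    (f.map x) (f.map x')
    (by rw [natDegree_map_of_leadingCoeff_ne_zero _ hfx,
      natDegree_map_of_leadingCoeff_ne_zero _ hfx'])
    (by rwa [natDegree_map_of_leadingCoeff_ne_zero _ hfx])
    (by rw [leadingCoeff_map_of_leadingCoeff_ne_zero _ hfx,
      leadingCoeff_map_of_leadingCoeff_ne_zero _ hfx', hlc f hfF])
    ⟨derivative f, Multiset.mem_cons_self _ _, (derivative_map _ _).symm, (derivative_map _ _).symm⟩
    (by
      intro p hp h1 h2 t t' ht ht' htt
      obtain ⟨a, a'⟩ := hF0lc p hp h1 ⟨t, ht⟩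
      rw [← sign_eval_pseudoRed x a ht, ← sign_eval_pseudoRed x' a' ht']
      exact hM t t' htt _ (Multiset.mem_add.2 (Or.inr (Multiset.mem_map_of_mem _ hp))))
  refine ⟨N, hNf, hNc, fun t t' htt q hq => ?_⟩
  rw [← Multiset.cons_erase hfF] at hq
  rcases Multiset.mem_cons.1 hq with rfl | hq
  · exact (hN t t' htt).1
  · exact (hN t t' htt).2 q (Multiset.mem_cons_of_mem hq)

/-- The algebra of polynomial functions on a real vector space. -/
noncomputable def Pol (V : Type*) [AddCommGroup V] [Module ℝ V] : Subalgebra ℝ (V → ℝ) :=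
  Algebra.adjoin ℝ (Set.range fun l : V →ₗ[ℝ] ℝ => (l : V → ℝ))

/-- Polynomial maps between real vector spaces. -/
def PolMap {V W : Type*} [AddCommGroup V] [Module ℝ V] [AddCommGroup W] [Module ℝ W]
    (g : V → W) : Prop := ∀ l : W →ₗ[ℝ] ℝ, (fun x => l (g x)) ∈ Pol V

/-- Coordinate-free semialgebraic sets: membership is determined by the signs of finitely many
polynomial functions. -/
def SA {V : Type*} [AddCommGroup V] [Module ℝ V] (S : Set V) : Prop :=
  ∃ Φ : Set (V → ℝ), Φ.Finite ∧ (∀ f ∈ Φ, f ∈ Pol V) ∧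
    ∀ x y, (∀ f ∈ Φ, SignType.sign (f x) = SignType.sign (f y)) → x ∈ S → y ∈ S

section SACalculus

variable {U V W : Type*} [AddCommGroup U] [Module ℝ U] [AddCommGroup V] [Module ℝ V]
  [AddCommGroup W] [Module ℝ W]

lemma Pol.linear (l : V →ₗ[ℝ] ℝ) : (fun x => l x) ∈ Pol V := Algebra.subset_adjoin ⟨l, rfl⟩

lemma Pol.const (c : ℝ) : (fun _ => c) ∈ Pol V := (Pol V).algebraMap_mem c

lemma Pol.comp {g : V → W} (hg : PolMap g) {f : W → ℝ} (hf : f ∈ Pol W) :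
    (fun x => f (g x)) ∈ Pol V := by
  induction hf using Algebra.adjoin_induction with
  | mem f hf => obtain ⟨l, rfl⟩ := hf; exact hg l
  | algebraMap r => exact Pol.const r
  | add f₁ f₂ _ _ h₁ h₂ => exact add_mem h₁ h₂
  | mul f₁ f₂ _ _ h₁ h₂ => exact mul_mem h₁ h₂

lemma PolMap.linear (g : V →ₗ[ℝ] W) : PolMap g := fun l => Pol.linear (l.comp g)

lemma PolMap.id : PolMap (fun x : V => x) := PolMap.linear LinearMap.id

lemma PolMap.const (w : W) : PolMap (fun _ : V => w) := fun l => Pol.const (l w)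

lemma PolMap.comp {g : V → W} {f : W → U} (hf : PolMap f) (hg : PolMap g) :
    PolMap (fun x => f (g x)) := fun l => Pol.comp hg (hf l)

lemma PolMap.sub {f g : V → W} (hf : PolMap f) (hg : PolMap g) : PolMap (fun x => f x - g x) := by
  intro l
  simp only [map_sub]
  exact sub_mem (hf l) (hg l)

lemma PolMap.real {f : V → ℝ} : PolMap f ↔ f ∈ Pol V := by
  constructor
  · intro h; exact h LinearMap.id
  · intro h l
    have : (fun x => l (f x)) = fun x => l 1 * f x := by
      ext x
      have := l.map_smul (f x) 1
      rw [smul_eq_mul, mul_one, smul_eq_mul] at this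
      rw [this, mul_comm]
    rw [this]
    exact mul_mem (Pol.const _) h

lemma PolMap.prodMk {f : U → V} {g : U → W} (hf : PolMap f) (hg : PolMap g) :
    PolMap (fun x => (f x, g x)) := by
  intro l
  have : (fun x => l (f x, g x)) =
      fun x => l.comp (LinearMap.inl ℝ V W) (f x) + l.comp (LinearMap.inr ℝ V W) (g x) := by
    ext x
    simp [← map_add]
  rw [this]
  exact add_mem (hf _) (hg _)

lemma PolMap.fst {f : U → V × W} (hf : PolMap f) : PolMap (fun x => (f x).1) :=
  (PolMap.linear (LinearMap.fst ℝ V W)).comp hf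

lemma PolMap.snd {f : U → V × W} (hf : PolMap f) : PolMap (fun x => (f x).2) :=
  (PolMap.linear (LinearMap.snd ℝ V W)).comp hf

lemma PolMap.sum_smul {ι : Type*} (s : Finset ι) {c : ι → V → ℝ} {f : ι → V → W}
    (hc : ∀ i ∈ s, c i ∈ Pol V) (hf : ∀ i ∈ s, PolMap (f i)) :
    PolMap (fun x => ∑ i ∈ s, c i x • f i x) := by
  intro l
  have : (fun x => l (∑ i ∈ s, c i x • f i x)) = ∑ i ∈ s, c i * (fun x => l (f i x)) := by
    ext x
    simp
  rw [this]
  exact sum_mem fun i hi => mul_mem (hc i hi) (hf i hi l)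

lemma PolMap.pi {ι : Type*} [Finite ι] {f : V → ι → ℝ} (hf : ∀ i, (fun x => f x i) ∈ Pol V) :
    PolMap f := by
  classical
  have := Fintype.ofFinite ι
  have h : f = fun x => ∑ i, f x i • (Pi.single i (1 : ℝ) : ι → ℝ) := by
    ext x j
    simp [Finset.sum_apply, Pi.single_apply]
  rw [h]
  exact PolMap.sum_smul _ (fun i _ => hf i) fun i _ => PolMap.const _

lemma PolMap.apply {ι : Type*} {f : V → ι → ℝ} (hf : PolMap f) (i : ι) :
    (fun x => f x i) ∈ Pol V := hf (LinearMap.proj i)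

lemma PolMap.bilin {X : Type*} [AddCommGroup X] [Module ℝ X] [FiniteDimensional ℝ W]
    (B : V →ₗ[ℝ] W →ₗ[ℝ] U) {f : X → V} {g : X → W} (hf : PolMap f) (hg : PolMap g) :
    PolMap (fun x => B (f x) (g x)) := by
  let b := Module.finBasis ℝ W
  have : (fun x => B (f x) (g x)) = fun x => ∑ i, b.coord i (g x) • B.flip (b i) (f x) := by
    ext x
    conv_lhs => rw [← b.sum_repr (g x), map_sum]
    simp
  rw [this]
  exact PolMap.sum_smul _ (fun i _ => hg _) fun i _ => (PolMap.linear _).comp hf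

lemma SA.preimage {S : Set W} (hS : SA S) {g : V → W} (hg : PolMap g) : SA {x | g x ∈ S} := by
  obtain ⟨Φ, hf, hP, h⟩ := hS
  refine ⟨(fun f x => f (g x)) '' Φ, hf.image _, ?_, fun x y hxy hx => ?_⟩
  · rintro _ ⟨f, hf, rfl⟩
    exact Pol.comp hg (hP f hf)
  · exact h _ _ (fun f hf => hxy _ ⟨f, hf, rfl⟩) hx

lemma SA.compl {S : Set V} (hS : SA S) : SA Sᶜ := by
  obtain ⟨Φ, hf, hP, h⟩ := hS
  exact ⟨Φ, hf, hP, fun x y hxy hx hy => hx (h y x (fun f hf => (hxy f hf).symm) hy)⟩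

lemma SA.not {P : V → Prop} (h : SA {x | P x}) : SA {x | ¬ P x} := h.compl

lemma SA.inter {S T : Set V} (hS : SA S) (hT : SA T) : SA (S ∩ T) := by
  obtain ⟨Φ, hf, hP, h⟩ := hS
  obtain ⟨Ψ, hf', hP', h'⟩ := hT
  refine ⟨Φ ∪ Ψ, hf.union hf', ?_, fun x y hxy hx =>
    ⟨h x y (fun f hf => hxy f (Or.inl hf)) hx.1, h' x y (fun f hf => hxy f (Or.inr hf)) hx.2⟩⟩
  rintro f (hf | hf)
  exacts [hP f hf, hP' f hf]

lemma SA.and {P Q : V → Prop} (h : SA {x | P x}) (h' : SA {x | Q x}) : SA {x | P x ∧ Q x} :=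
  h.inter h'

lemma SA.union {S T : Set V} (hS : SA S) (hT : SA T) : SA (S ∪ T) := by
  have := (hS.compl.inter hT.compl).compl
  rwa [Set.compl_inter, compl_compl, compl_compl] at this

lemma SA.or {P Q : V → Prop} (h : SA {x | P x}) (h' : SA {x | Q x}) : SA {x | P x ∨ Q x} :=
  h.union h'

lemma SA.imp {P Q : V → Prop} (h : SA {x | P x}) (h' : SA {x | Q x}) : SA {x | P x → Q x} := by
  simpa only [imp_iff_not_or] using h.not.or h'

lemma SA.const (p : Prop) : SA {_x : V | p} :=
  ⟨∅, Set.finite_empty, fun _ h => h.elim, fun _ _ _ h => h⟩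

lemma SA.univ : SA (Set.univ : Set V) := SA.const True

lemma SA.empty : SA (∅ : Set V) := SA.const False

lemma SA.exists_mem_finset {ι : Type*} (s : Finset ι) {P : ι → V → Prop}
    (h : ∀ i ∈ s, SA {x | P i x}) : SA {x | ∃ i ∈ s, P i x} := by
  classical
  induction s using Finset.induction_on with
  | empty => simpa using SA.const False
  | insert a s _ ih =>
    simp only [Finset.exists_mem_insert]
    exact (h a (Finset.mem_insert_self _ _)).or (ih fun i hi => h i (Finset.mem_insert_of_mem hi))

lemma SA.exists_finite {ι : Type*} [Finite ι] {P : ι → V → Prop}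
    (h : ∀ i, SA {x | P i x}) : SA {x | ∃ i, P i x} := by
  have := Fintype.ofFinite ι
  simpa using SA.exists_mem_finset Finset.univ fun i _ => h i

lemma SA.forall_finite {ι : Type*} [Finite ι] {P : ι → V → Prop}
    (h : ∀ i, SA {x | P i x}) : SA {x | ∀ i, P i x} := by
  have := (SA.exists_finite fun i => (h i).not).not
  simpa using this

lemma SA.pos {f : V → ℝ} (hf : f ∈ Pol V) : SA {x | 0 < f x} := by
  refine ⟨{f}, Set.finite_singleton _, by simpa using hf, fun x y h hx => ?_⟩
  have := h f rfl
  rw [Set.mem_ofPred_eq] at hx ⊢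
  rw [sign_pos hx] at this
  exact sign_eq_one_iff.1 this.symm

lemma SA.eq_zero {f : V → ℝ} (hf : f ∈ Pol V) : SA {x | f x = 0} := by
  refine ⟨{f}, Set.finite_singleton _, by simpa using hf, fun x y h hx => ?_⟩
  have := h f rfl
  rw [Set.mem_ofPred_eq] at hx ⊢
  rw [hx, sign_zero] at this
  exact sign_eq_zero_iff.1 this.symm

lemma SA.lt {f g : V → ℝ} (hf : f ∈ Pol V) (hg : g ∈ Pol V) : SA {x | f x < g x} := by
  simpa using SA.pos (sub_mem hg hf)

lemma SA.le {f g : V → ℝ} (hf : f ∈ Pol V) (hg : g ∈ Pol V) : SA {x | f x ≤ g x} := by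
  simpa using (SA.lt hg hf).not

lemma SA.eq [FiniteDimensional ℝ W] {f g : V → W} (hf : PolMap f) (hg : PolMap g) :
    SA {x | f x = g x} := by
  let b := Module.finBasis ℝ W
  have : {x | f x = g x} = {x | ∀ i, b.coord i (f x - g x) = 0} := by
    ext x
    rw [Set.mem_ofPred_eq, Set.mem_ofPred_eq, b.forall_coord_eq_zero_iff, sub_eq_zero]
  rw [this]
  exact SA.forall_finite fun i => SA.eq_zero (hf.sub hg _)

/-- Evaluation of polynomial functions at a point. -/
noncomputable def polEval (x : V) : Pol V →+* ℝ :=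
  (Pi.evalRingHom (fun _ : V => ℝ) x).comp (Pol V).val.toRingHom

lemma polEval_apply (x : V) (f : Pol V) : polEval x f = f.1 x := rfl

lemma Pol.exists_polynomial {f : V × ℝ → ℝ} (hf : f ∈ Pol (V × ℝ)) :
    ∃ p : (Pol V)[X], ∀ x y, f (x, y) = (p.map (polEval x)).eval y := by
  induction hf using Algebra.adjoin_induction with
  | mem f hf =>
    obtain ⟨l, rfl⟩ := hf
    refine ⟨C ⟨_, Pol.linear (l.comp (LinearMap.inl ℝ V ℝ))⟩ + C ⟨_, Pol.const (l (0, 1))⟩ * X,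
      fun x y => ?_⟩
    have : ((x, y) : V × ℝ) = (x, 0) + y • (0, 1) := by simp
    simp only [Polynomial.map_add, Polynomial.map_C, Polynomial.map_mul, Polynomial.map_X, eval_add,
      eval_C, eval_mul, eval_X, polEval_apply]
    rw [this, map_add, map_smul, smul_eq_mul, mul_comm]
    rfl
  | algebraMap r => exact ⟨C ⟨_, Pol.const r⟩, fun x y => by simp [polEval_apply]⟩
  | add f₁ f₂ _ _ h₁ h₂ =>
    obtain ⟨p, hp⟩ := h₁
    obtain ⟨q, hq⟩ := h₂
    exact ⟨p + q, fun x y => by simp [hp, hq]⟩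
  | mul f₁ f₂ _ _ h₁ h₂ =>
    obtain ⟨p, hp⟩ := h₁
    obtain ⟨q, hq⟩ := h₂
    exact ⟨p * q, fun x y => by simp [hp, hq]⟩

/-- Tarski–Seidenberg in one variable. -/
lemma SA.exists_real {S : Set (V × ℝ)} (hS : SA S) : SA {x | ∃ y, (x, y) ∈ S} := by
  obtain ⟨Φ, hΦ, hP, h⟩ := hS
  have hp : ∀ f : V × ℝ → ℝ, ∃ p : (Pol V)[X], f ∈ Pol (V × ℝ) →
      ∀ x y, f (x, y) = (p.map (polEval x)).eval y := by
    intro f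
    by_cases hf : f ∈ Pol (V × ℝ)
    · obtain ⟨p, hp⟩ := Pol.exists_polynomial hf
      exact ⟨p, fun _ => hp⟩
    · exact ⟨0, fun h => absurd h hf⟩
  choose P hPP using hp
  obtain ⟨Ψ, hΨ, hM⟩ := exists_finite_matched (hΦ.toFinset.val.map P)
  refine ⟨Subtype.val '' Ψ, hΨ.image _, ?_, ?_⟩
  · rintro _ ⟨f, _, rfl⟩
    exact f.2
  rintro x x' hx ⟨y, hy⟩
  obtain ⟨M, hMf, hMc, hM⟩ := hM (polEval x) (polEval x') fun φ hφ => hx _ ⟨φ, hφ, rfl⟩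
  obtain ⟨y', hy'⟩ := exists_samePos hMf hMc y
  refine ⟨y', h _ _ (fun f hf => ?_) hy⟩
  rw [hPP f (hP f hf), hPP f (hP f hf)]
  exact hM y y' hy' _ (Multiset.mem_map_of_mem P (by simpa using hf))

lemma SA.exists_pi (n : ℕ) : ∀ {S : Set (V × (Fin n → ℝ))}, SA S →
    SA {x | ∃ w, (x, w) ∈ S} := by
  induction n with
  | zero =>
    intro S hS
    have : {x | ∃ w, (x, w) ∈ S} = {x : V | (x, (0 : Fin 0 → ℝ)) ∈ S} := by
      ext x
      exact ⟨fun ⟨w, hw⟩ => by rwa [Subsingleton.elim w 0] at hw, fun h => ⟨_, h⟩⟩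
    rw [this]
    exact hS.preimage (PolMap.id.prodMk (PolMap.const _))
  | succ n ih =>
    intro S hS
    have : {x | ∃ w, (x, w) ∈ S} = {x : V | ∃ w : Fin n → ℝ,
        (x, w) ∈ {z : V × (Fin n → ℝ) | ∃ y : ℝ, (z, y) ∈
          {u : (V × (Fin n → ℝ)) × ℝ | (u.1.1, (Fin.cons u.2 u.1.2 : Fin (n + 1) → ℝ)) ∈ S}}} := by
      ext x
      simp only [Set.mem_ofPred_eq]
      constructor
      · rintro ⟨w, hw⟩
        exact ⟨Fin.tail w, w 0, by rwa [Fin.cons_self_tail]⟩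
      · rintro ⟨w, y, h⟩
        exact ⟨_, h⟩
    rw [this]
    refine ih (SA.exists_real (hS.preimage (PolMap.id.fst.fst.prodMk (PolMap.pi fun i => ?_))))
    refine Fin.cases ?_ (fun i => ?_) i
    · exact PolMap.real.1 PolMap.id.snd
    · exact PolMap.id.fst.snd.apply i

/-- Tarski–Seidenberg: projections along finite-dimensional spaces. -/
lemma SA.exists [FiniteDimensional ℝ W] {P : V → W → Prop} (hS : SA {z : V × W | P z.1 z.2}) :
    SA {x | ∃ w, P x w} := by
  let b := (Module.finBasis ℝ W).equivFun
  have := SA.exists_pi _ (hS.preimage (PolMap.id.fst.prodMk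
    ((PolMap.linear b.symm.toLinearMap).comp PolMap.id.snd)))
  convert this using 1
  ext x
  simp only [Set.mem_ofPred_eq]
  exact ⟨fun ⟨w, hw⟩ => ⟨b w, by simpa using hw⟩, fun ⟨w, hw⟩ => ⟨_, hw⟩⟩

lemma SA.forall [FiniteDimensional ℝ W] {P : V → W → Prop} (hS : SA {z : V × W | P z.1 z.2}) :
    SA {x | ∀ w, P x w} := by
  simpa using (SA.exists (P := fun x w => ¬ P x w) hS.not).not

lemma SA.image [FiniteDimensional ℝ V] [FiniteDimensional ℝ W] {S : Set V} (hS : SA S) {g : V → W}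
    (hg : PolMap g) : SA (g '' S) :=
  SA.exists (P := fun w v => v ∈ S ∧ g v = w)
    ((hS.preimage PolMap.id.snd).and (SA.eq (hg.comp PolMap.id.snd) PolMap.id.fst))

end SACalculus

lemma Pol.eval_mem {n : ℕ} (p : MvPolynomial (Fin n) ℝ) :
    (fun x => MvPolynomial.eval x p) ∈ Pol (Fin n → ℝ) := by
  induction p using MvPolynomial.induction_on with
  | C a => simpa using Pol.const a
  | add p q hp hq => simp only [map_add]; exact add_mem hp hq
  | mul_X p i hp =>
    simp only [map_mul, MvPolynomial.eval_X]
    exact mul_mem hp (PolMap.id.apply i)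

lemma Pol.exists_mvPolynomial {n : ℕ} {f : (Fin n → ℝ) → ℝ} (hf : f ∈ Pol (Fin n → ℝ)) :
    ∃ p : MvPolynomial (Fin n) ℝ, ∀ x, f x = MvPolynomial.eval x p := by
  induction hf using Algebra.adjoin_induction with
  | mem f hf =>
    obtain ⟨l, rfl⟩ := hf
    refine ⟨∑ i, MvPolynomial.C (l (Pi.single i 1)) * MvPolynomial.X i, fun x => ?_⟩
    have : x = ∑ i, x i • (Pi.single i (1 : ℝ) : Fin n → ℝ) := by
      ext j
      simp [Finset.sum_apply, Pi.single_apply]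
    conv_lhs => rw [this]
    simp [mul_comm]
  | algebraMap r => exact ⟨MvPolynomial.C r, fun x => by simp⟩
  | add f₁ f₂ _ _ h₁ h₂ =>
    obtain ⟨p, hp⟩ := h₁
    obtain ⟨q, hq⟩ := h₂
    exact ⟨p + q, fun x => by simp [hp, hq]⟩
  | mul f₁ f₂ _ _ h₁ h₂ =>
    obtain ⟨p, hp⟩ := h₁
    obtain ⟨q, hq⟩ := h₂
    exact ⟨p * q, fun x => by simp [hp, hq]⟩

lemma IsSemialgebraic.sa {n : ℕ} {S : Set (Fin n → ℝ)} (hS : IsSemialgebraic S) : SA S := by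
  obtain ⟨L, rfl⟩ := hS
  have h1 : ∀ (p : MvPolynomial (Fin n) ℝ) (gs), SA (BasicSemialgebraic p gs) := by
    intro p gs
    refine (SA.eq_zero (Pol.eval_mem p)).and ?_
    induction gs with
    | nil => simpa using SA.const True
    | cons g gs ih => simpa using (SA.pos (Pol.eval_mem g)).and ih
  have h2 : ∀ c : List (MvPolynomial (Fin n) ℝ × List (MvPolynomial (Fin n) ℝ)),
      SA (⋂ b ∈ c, BasicSemialgebraic b.1 b.2) := by
    intro c
    induction c with
    | nil => simpa using SA.univ
    | cons b c ih =>
      simp only [List.mem_cons, Set.iInter_iInter_eq_or_left]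
      exact (h1 _ _).inter ih
  induction L with
  | nil => simpa using SA.empty
  | cons c L ih =>
    simp only [List.mem_cons, Set.iUnion_iUnion_eq_or_left]
    exact (h2 c).union ih

lemma SA.isSemialgebraic {n : ℕ} {S : Set (Fin n → ℝ)} (hS : SA S) : IsSemialgebraic S := by
  classical
  obtain ⟨Φ, hf, hP, h⟩ := hS
  have : Fintype Φ := hf.fintype
  have hq : ∀ f : Φ, ∃ p : MvPolynomial (Fin n) ℝ, ∀ x, f.1 x = MvPolynomial.eval x p :=
    fun f => Pol.exists_mvPolynomial (hP f f.2)
  choose q hq using hq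
  have hb : ∀ (f : Φ) (s : SignType), ∃ b : MvPolynomial (Fin n) ℝ × List (MvPolynomial (Fin n) ℝ),
      BasicSemialgebraic b.1 b.2 = {x | SignType.sign (f.1 x) = s} := by
    intro f s
    rcases s with _ | _ | _
    · refine ⟨(q f, []), ?_⟩
      ext x
      simp only [BasicSemialgebraic, Set.mem_ofPred_eq, hq]
      change _ ↔ _ = (0 : SignType)
      rw [sign_eq_zero_iff]
      simp
    · refine ⟨(0, [-q f]), ?_⟩
      ext x
      simp only [BasicSemialgebraic, Set.mem_ofPred_eq, hq]
      change _ ↔ _ = (-1 : SignType)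
      rw [sign_eq_neg_one_iff]
      simp
    · refine ⟨(0, [q f]), ?_⟩
      ext x
      simp only [BasicSemialgebraic, Set.mem_ofPred_eq, hq]
      change _ ↔ _ = (1 : SignType)
      rw [sign_eq_one_iff]
      simp
  choose b hb using hb
  refine ⟨((Finset.univ : Finset (Φ → SignType)).filter
    (fun σ => ∃ x ∈ S, ∀ f : Φ, SignType.sign (f.1 x) = σ f)).toList.map
      (fun σ => (Finset.univ : Finset Φ).toList.map fun f => b f (σ f)), ?_⟩
  ext y
  simp only [List.mem_map, Finset.mem_toList, Finset.mem_filter, Finset.mem_univ, true_and,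
    Set.mem_iUnion, Set.mem_iInter, exists_prop]
  constructor
  · intro hy
    refine ⟨_, ⟨fun f => SignType.sign (f.1 y), ⟨y, hy, fun _ => rfl⟩, rfl⟩, ?_⟩
    intro c hc
    obtain ⟨f, -, rfl⟩ := List.mem_map.1 hc
    rw [hb]
    rfl
  · rintro ⟨_, ⟨σ, ⟨x, hx, hσ⟩, rfl⟩, hy⟩
    refine h x y (fun f hf => ?_) hx
    have := hy _ (List.mem_map.2 ⟨⟨f, hf⟩, Finset.mem_toList.2 (Finset.mem_univ _), rfl⟩)
    rw [hb, Set.mem_ofPred_eq] at this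
    rw [this, ← hσ]

lemma isSemialgebraic_iff_sa {n : ℕ} {S : Set (Fin n → ℝ)} : IsSemialgebraic S ↔ SA S :=
  ⟨IsSemialgebraic.sa, SA.isSemialgebraic⟩

lemma SA.card_eq {U : Type*} [AddCommGroup U] [Module ℝ U] {T : U → Finset ℝ}
    (hT : SA {p : U × ℝ | p.2 ∈ T p.1}) (l : ℕ) : SA {u | (T u).card = l} := by
  have key : ∀ l : ℕ, SA {u | l ≤ (T u).card} := by
    intro l
    have h : {u | l ≤ (T u).card} = {u | ∃ w : Fin l → ℝ,
        (∀ i, w i ∈ T u) ∧ ∀ i j, w i = w j → i = j} := by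
      ext u
      simp only [Set.mem_ofPred_eq]
      constructor
      · intro hl
        obtain ⟨s, hs, hsl⟩ := Finset.exists_subset_card_eq hl
        subst hsl
        refine ⟨fun i => s.equivFin.symm i, fun i => hs (s.equivFin.symm i).2, fun i j hij => ?_⟩
        exact s.equivFin.symm.injective (Subtype.ext hij)
      · rintro ⟨w, hw, hi⟩
        calc l = (Finset.univ.image w).card := by
              rw [Finset.card_image_of_injective _ (fun i j h => hi i j h), Finset.card_univ,
                Fintype.card_fin]
          _ ≤ _ := Finset.card_le_card fun z hz => by
              obtain ⟨i, -, rfl⟩ := Finset.mem_image.1 hz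
              exact hw i
    rw [h]
    refine SA.exists ((SA.forall_finite fun i => ?_).and
      (SA.forall_finite fun i => SA.forall_finite fun j => SA.imp ?_ (SA.const _)))
    · exact hT.preimage (PolMap.id.fst.prodMk (PolMap.real.2 (PolMap.id.snd.apply i)))
    · exact SA.eq (PolMap.real.2 (PolMap.id.snd.apply i)) (PolMap.real.2 (PolMap.id.snd.apply j))
  have : {u | (T u).card = l} = {u | l ≤ (T u).card ∧ ¬ l + 1 ≤ (T u).card} := by
    ext u
    simp only [Set.mem_ofPred_eq]
    omega
  rw [this]
  exact (key l).and (key (l + 1)).not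

lemma Pol.eval_map_mem {V : Type*} [AddCommGroup V] [Module ℝ V] (p : (Pol V)[X]) :
    (fun z : V × ℝ => (p.map (polEval z.1)).eval z.2) ∈ Pol (V × ℝ) := by
  induction p using Polynomial.induction_on with
  | C a =>
    simp only [Polynomial.map_C, eval_C, polEval_apply]
    exact Pol.comp PolMap.id.fst a.2
  | add p q hp hq =>
    simp only [Polynomial.map_add, eval_add]
    exact add_mem hp hq
  | monomial n a h =>
    simp only [Polynomial.map_mul, Polynomial.map_C, Polynomial.map_pow, Polynomial.map_X, eval_mul,
      eval_C, eval_pow, eval_X, polEval_apply]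
    exact mul_mem (Pol.comp PolMap.id.fst a.2) (pow_mem (PolMap.real.1 PolMap.id.snd) _)

lemma Polynomial.exists_mul_neg_of_simple_root (q : ℝ[X]) {t ε : ℝ} (hε : 0 < ε)
    (h0 : q.eval t = 0) (h1 : q.derivative.eval t ≠ 0) :
    ∃ a b, t - ε < a ∧ a < b ∧ b < t + ε ∧ q.eval a * q.eval b < 0 := by
  obtain ⟨s, rfl⟩ := dvd_iff_isRoot.2 h0
  have hs : s.eval t ≠ 0 := by simpa [derivative_mul] using h1
  have hev : ∀ᶠ u in nhds t, 0 < s.eval u * s.eval t :=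
    (s.continuous.mul continuous_const).continuousAt.eventually
      (lt_mem_nhds (mul_self_pos.2 hs))
  obtain ⟨δ, hδ, hd⟩ := Metric.eventually_nhds_iff.1 hev
  set η := min δ ε / 2
  have hη : 0 < η := by positivity
  have hηδ : η < δ := by have := min_le_left δ ε; simp only [η]; linarith
  have hηε : η < ε := by have := min_le_right δ ε; simp only [η]; linarith
  refine ⟨t - η, t + η, by linarith, by linarith, by linarith, ?_⟩
  have ha : 0 < s.eval (t - η) * s.eval t := hd (by rw [Real.dist_eq]; simpa [abs_of_pos hη])
  have hb : 0 < s.eval (t + η) * s.eval t := hd (by rw [Real.dist_eq]; simpa [abs_of_pos hη])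
  have hab : 0 < s.eval (t - η) * s.eval (t + η) := by
    have h3 : 0 < (s.eval (t - η) * s.eval (t + η)) * (s.eval t * s.eval t) := by
      have := mul_pos ha hb
      nlinarith
    exact pos_of_mul_pos_left h3 (mul_self_nonneg _)
  simp only [eval_mul, eval_sub, eval_X, eval_C]
  have : 0 < η * η := by positivity
  nlinarith

lemma Polynomial.exists_simple_root_iterate_derivative (p : ℝ[X]) (hp : p ≠ 0) {t : ℝ}
    (ht : p.eval t = 0) :
    ∃ i, (derivative^[i] p).eval t = 0 ∧ (derivative^[i] p).derivative.eval t ≠ 0 := by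
  have hm : 0 < p.rootMultiplicity t := (rootMultiplicity_pos hp).2 ht
  refine ⟨p.rootMultiplicity t - 1,
    isRoot_iterate_derivative_of_lt_rootMultiplicity (by omega), ?_⟩
  rw [← Function.iterate_succ_apply' derivative, Nat.succ_eq_add_one, Nat.sub_add_cancel hm,
    eval_iterate_derivative_rootMultiplicity, nsmul_eq_mul]
  exact mul_ne_zero (by positivity) (eval_divByMonic_pow_rootMultiplicity_ne_zero t hp)

section Stratification

variable {V : Type*} [NormedAddCommGroup V] [NormedSpace ℝ V] [FiniteDimensional ℝ V]

lemma Pol.continuous {f : V → ℝ} (hf : f ∈ Pol V) : Continuous f := by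
  induction hf using Algebra.adjoin_induction with
  | mem f hf => obtain ⟨l, rfl⟩ := hf; exact l.continuous_of_finiteDimensional
  | algebraMap r => exact continuous_const
  | add f₁ f₂ _ _ h₁ h₂ => exact h₁.add h₂
  | mul f₁ f₂ _ _ h₁ h₂ => exact h₁.mul h₂

/-- The roots over `x` of those members of a family which do not vanish identically over `x`. -/
noncomputable def fiberRoots (F : Finset (Pol V)[X]) (x : V) : Finset ℝ :=
  F.biUnion fun p => (p.map (polEval x)).roots.toFinset

omit [FiniteDimensional ℝ V] in
lemma mem_fiberRoots {F : Finset (Pol V)[X]} {x : V} {y : ℝ} : y ∈ fiberRoots F x ↔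
    ∃ p ∈ F, p.map (polEval x) ≠ 0 ∧ (p.map (polEval x)).eval y = 0 := by
  simp [fiberRoots]

omit [FiniteDimensional ℝ V] in
lemma card_fiberRoots_le (F : Finset (Pol V)[X]) (x : V) :
    (fiberRoots F x).card ≤ ∑ p ∈ F, p.natDegree := by
  refine Finset.card_biUnion_le.trans (Finset.sum_le_sum fun p _ => ?_)
  exact (Multiset.toFinset_card_le _).trans ((card_roots' _).trans natDegree_map_le)

omit [FiniteDimensional ℝ V] in
lemma SA.fiberRoots (F : Finset (Pol V)[X]) : SA {z : V × ℝ | z.2 ∈ fiberRoots F z.1} := by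
  simp only [mem_fiberRoots]
  refine SA.exists_mem_finset F fun p _ => SA.and ?_ (SA.eq_zero (Pol.eval_map_mem p))
  have : {z : V × ℝ | p.map (polEval z.1) ≠ 0} =
      {z : V × ℝ | ∃ y : ℝ, (p.map (polEval z.1)).eval y ≠ 0} := by
    ext z
    simp only [Set.mem_ofPred_eq, ne_eq, ← not_forall]
    rw [not_iff_not]
    exact ⟨fun h y => by simp [h], fun h => Polynomial.funext (by simpa using h)⟩
  rw [this]
  refine SA.exists (SA.not (SA.eq_zero ?_))
  exact Pol.comp (PolMap.id.fst.fst.prodMk PolMap.id.snd) (Pol.eval_map_mem p)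

lemma polEval_continuous (p : (Pol V)[X]) (y : ℝ) :
    Continuous fun x => (p.map (polEval x)).eval y :=
  Pol.continuous (Pol.comp (PolMap.id.prodMk (PolMap.const y)) (Pol.eval_map_mem p))

lemma eventually_exists_fiberRoots {F : Finset (Pol V)[X]}
    (hF : ∀ p ∈ F, ∀ i, derivative^[i] p ≠ 0 → derivative^[i] p ∈ F) {x₀ : V} {y₀ ε : ℝ}
    (hε : 0 < ε) (h : y₀ ∈ fiberRoots F x₀) :
    ∀ᶠ x in nhds x₀, ∃ y ∈ fiberRoots F x, |y - y₀| < ε := by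
  obtain ⟨p, hp, hp0, hpy⟩ := mem_fiberRoots.1 h
  obtain ⟨i, hi0, hi1⟩ := exists_simple_root_iterate_derivative _ hp0 hpy
  have hmap : ∀ x : V, derivative^[i] (p.map (polEval x)) = (derivative^[i] p).map (polEval x) :=
    fun x => iterate_derivative_map p _ i
  rw [hmap] at hi0 hi1
  have hqF : derivative^[i] p ∈ F := hF p hp i (by rintro h0; simp [h0] at hi1)
  obtain ⟨a, b, ha, hab, hb, hmul⟩ := exists_mul_neg_of_simple_root _ hε hi0 hi1
  have := ((polEval_continuous (derivative^[i] p) a).mul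
    (polEval_continuous (derivative^[i] p) b)).continuousAt.eventually (gt_mem_nhds hmul)
  filter_upwards [this] with x hx
  obtain ⟨c, hc, hc0⟩ := exists_root_of_mul_neg _ hab hx
  refine ⟨c, mem_fiberRoots.2 ⟨_, hqF, ?_, hc0⟩, abs_lt.2 ⟨by linarith [hc.1], by linarith [hc.2]⟩⟩
  rintro h0
  simp [h0] at hx

/-- Number of fibre roots below `y`. -/
noncomputable def rankLT (F : Finset (Pol V)[X]) (z : V × ℝ) : ℕ :=
  ((fiberRoots F z.1).filter (· < z.2)).card

/-- Number of fibre roots not above `y`. -/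
noncomputable def rankLE (F : Finset (Pol V)[X]) (z : V × ℝ) : ℕ :=
  ((fiberRoots F z.1).filter (· ≤ z.2)).card

/-- The set of points with prescribed position relative to the fibre roots. -/
def stratum (F : Finset (Pol V)[X]) (c : ℕ × ℕ × ℕ) : Set (V × ℝ) :=
  {z | (fiberRoots F z.1).card = c.1 ∧ rankLT F z = c.2.1 ∧ rankLE F z = c.2.2}

omit [FiniteDimensional ℝ V] in
lemma SA.stratum (F : Finset (Pol V)[X]) (c : ℕ × ℕ × ℕ) : SA (stratum F c) := by
  refine ((SA.card_eq (SA.fiberRoots F) c.1).preimage PolMap.id.fst).and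
    ((SA.card_eq (T := fun z : V × ℝ => (_root_.fiberRoots F z.1).filter (· < z.2)) ?_ _).and
    (SA.card_eq (T := fun z : V × ℝ => (_root_.fiberRoots F z.1).filter (· ≤ z.2)) ?_ _))
  · simp only [Finset.mem_filter]
    exact ((SA.fiberRoots F).preimage (g := fun u : (V × ℝ) × ℝ => (u.1.1, u.2))
      (PolMap.id.fst.fst.prodMk PolMap.id.snd)).and
      (SA.lt (PolMap.real.1 PolMap.id.snd) (PolMap.real.1 PolMap.id.fst.snd))
  · simp only [Finset.mem_filter]
    exact ((SA.fiberRoots F).preimage (g := fun u : (V × ℝ) × ℝ => (u.1.1, u.2))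
      (PolMap.id.fst.fst.prodMk PolMap.id.snd)).and
      (SA.le (PolMap.real.1 PolMap.id.snd) (PolMap.real.1 PolMap.id.fst.snd))

lemma eventually_exists_mem_stratum {F : Finset (Pol V)[X]}
    (hF : ∀ p ∈ F, ∀ i, derivative^[i] p ≠ 0 → derivative^[i] p ∈ F) {c : ℕ × ℕ × ℕ} {x₀ : V}
    {y₀ ε : ℝ} (hε : 0 < ε) (h : (x₀, y₀) ∈ stratum F c) :
    ∀ᶠ x in nhds x₀, (fiberRoots F x).card = c.1 → ∃ y, |y - y₀| < ε ∧ (x, y) ∈ stratum F c := by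
  classical
  set T := insert y₀ (fiberRoots F x₀) with hT
  obtain ⟨δ, hδ, hδε, hsep⟩ : ∃ δ > 0, δ < ε ∧ ∀ u ∈ T, ∀ v ∈ T, u < v → 2 * δ < v - u := by
    have : ∀ᶠ δ in nhdsWithin (0 : ℝ) (Set.Ioi 0), δ < ε ∧
        ∀ u ∈ T, ∀ v ∈ T, u < v → 2 * δ < v - u := by
      refine Filter.Eventually.and (nhdsWithin_le_nhds (gt_mem_nhds hε)) ?_
      rw [Filter.eventually_all_finset]
      intro u _
      rw [Filter.eventually_all_finset]
      intro v _
      by_cases huv : u < v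
      · have : ∀ᶠ δ in nhds (0 : ℝ), δ < (v - u) / 2 := gt_mem_nhds (by linarith)
        filter_upwards [nhdsWithin_le_nhds this] with δ hδ _
        linarith
      · exact Filter.Eventually.of_forall fun _ h => absurd h huv
    obtain ⟨δ, h1, h2⟩ := (this.and self_mem_nhdsWithin).exists
    exact ⟨δ, h2, h1⟩
  have hev : ∀ᶠ x in nhds x₀, ∀ z ∈ fiberRoots F x₀, ∃ y ∈ fiberRoots F x, |y - z| < δ := by
    rw [Filter.eventually_all_finset]
    exact fun z hz => eventually_exists_fiberRoots hF hδ hz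
  filter_upwards [hev] with x hx hcard
  have hx' : ∀ z, ∃ y, z ∈ fiberRoots F x₀ → y ∈ fiberRoots F x ∧ |y - z| < δ := by
    intro z
    by_cases hz : z ∈ fiberRoots F x₀
    · obtain ⟨y, hy⟩ := hx z hz
      exact ⟨y, fun _ => hy⟩
    · exact ⟨0, fun h => absurd h hz⟩
  choose g hg using hx'
  obtain ⟨h1, h2, h3⟩ := h
  have hmono : ∀ u ∈ fiberRoots F x₀, ∀ v ∈ fiberRoots F x₀, u < v → g u < g v := by
    intro u hu v hv huv
    have a := abs_lt.1 (hg u hu).2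
    have b := abs_lt.1 (hg v hv).2
    have := hsep u (Finset.mem_insert_of_mem hu) v (Finset.mem_insert_of_mem hv) huv
    linarith [a.2, b.1]
  have hinj : Set.InjOn g (fiberRoots F x₀) := by
    intro u hu v hv huv
    rcases lt_trichotomy u v with h | h | h
    · exact absurd huv (hmono u hu v hv h).ne
    · exact h
    · exact absurd huv (hmono v hv u hu h).ne'
  have himg : (fiberRoots F x₀).image g = fiberRoots F x := by
    refine Finset.eq_of_subset_of_card_le (fun z hz => ?_) ?_
    · obtain ⟨u, hu, rfl⟩ := Finset.mem_image.1 hz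
      exact (hg u hu).1
    · rw [Finset.card_image_of_injOn hinj, hcard, h1]
  obtain ⟨y, hy, hlt, hle⟩ : ∃ y, |y - y₀| < ε ∧ (∀ z ∈ fiberRoots F x₀, g z < y ↔ z < y₀) ∧
      ∀ z ∈ fiberRoots F x₀, g z ≤ y ↔ z ≤ y₀ := by
    by_cases hy₀ : y₀ ∈ fiberRoots F x₀
    · refine ⟨g y₀, (hg y₀ hy₀).2.trans hδε, fun z hz => ?_, fun z hz => ?_⟩
      · rcases lt_trichotomy z y₀ with h | h | h
        · simp [h, hmono z hz y₀ hy₀ h]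
        · simp [h]
        · simp [h.not_gt, (hmono y₀ hy₀ z hz h).not_gt]
      · rcases lt_trichotomy z y₀ with h | h | h
        · simp [h.le, (hmono z hz y₀ hy₀ h).le]
        · simp [h]
        · simp [h.not_ge, (hmono y₀ hy₀ z hz h).not_ge]
    · have key : ∀ z ∈ fiberRoots F x₀, (g z < y₀ ∧ z < y₀) ∨ (y₀ < g z ∧ y₀ < z) := by
        intro z hz
        have a := abs_lt.1 (hg z hz).2
        rcases lt_trichotomy z y₀ with h | h | h
        · have := hsep z (Finset.mem_insert_of_mem hz) y₀ (Finset.mem_insert_self _ _) h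
          exact Or.inl ⟨by linarith [a.2], h⟩
        · exact absurd (h ▸ hz) hy₀
        · have := hsep y₀ (Finset.mem_insert_self _ _) z (Finset.mem_insert_of_mem hz) h
          exact Or.inr ⟨by linarith [a.1], h⟩
      refine ⟨y₀, by simpa using hε, fun z hz => ?_, fun z hz => ?_⟩
      · rcases key z hz with ⟨a, b⟩ | ⟨a, b⟩
        · simp [a, b]
        · simp [a.not_gt, b.not_gt]
      · rcases key z hz with ⟨a, b⟩ | ⟨a, b⟩
        · simp [a.le, b.le]
        · simp [a.not_ge, b.not_ge]
  refine ⟨y, hy, hcard, ?_, ?_⟩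
  · rw [← h2, rankLT, rankLT]
    simp only
    rw [← himg, Finset.filter_image, Finset.card_image_of_injOn (hinj.mono (Finset.coe_subset.2 (Finset.filter_subset _ _)))]
    exact congrArg _ (Finset.filter_congr hlt)
  · rw [← h3, rankLE, rankLE]
    simp only
    rw [← himg, Finset.filter_image, Finset.card_image_of_injOn (hinj.mono (Finset.coe_subset.2 (Finset.filter_subset _ _)))]
    exact congrArg _ (Finset.filter_congr hle)

omit [FiniteDimensional ℝ V] in
lemma rankLT_mono (F : Finset (Pol V)[X]) (x : V) : Monotone fun y => rankLT F (x, y) :=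
  fun _ _ h => Finset.card_le_card (Finset.monotone_filter_right _ fun _ _ hz => hz.trans_le h)

omit [FiniteDimensional ℝ V] in
lemma rankLE_mono (F : Finset (Pol V)[X]) (x : V) : Monotone fun y => rankLE F (x, y) :=
  fun _ _ h => Finset.card_le_card (Finset.monotone_filter_right _ fun _ _ hz => hz.trans h)

omit [FiniteDimensional ℝ V] in
lemma isPreconnected_fiber_stratum (F : Finset (Pol V)[X]) (c : ℕ × ℕ × ℕ) (x : V) :
    IsPreconnected {y | (x, y) ∈ stratum F c} := by
  refine Set.OrdConnected.isPreconnected ⟨fun a ha b hb y hy => ?_⟩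
  obtain ⟨a1, a2, a3⟩ := ha
  obtain ⟨b1, b2, b3⟩ := hb
  refine ⟨a1, le_antisymm ?_ ?_, le_antisymm ?_ ?_⟩
  · exact (rankLT_mono F x hy.2).trans b2.le
  · exact a2.ge.trans (rankLT_mono F x hy.1)
  · exact (rankLE_mono F x hy.2).trans b3.le
  · exact a3.ge.trans (rankLE_mono F x hy.1)

omit [FiniteDimensional ℝ V] in
lemma sign_eq_of_mem_stratum {F : Finset (Pol V)[X]} {c : ℕ × ℕ × ℕ} {x : V} {y y' : ℝ}
    (h : (x, y) ∈ stratum F c) (h' : (x, y') ∈ stratum F c) {p : (Pol V)[X]} (hp : p ∈ F) :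
    SignType.sign ((p.map (polEval x)).eval y) = SignType.sign ((p.map (polEval x)).eval y') := by
  wlog hyy : y < y' generalizing y y'
  · rcases (not_lt.1 hyy).eq_or_lt with h0 | h0
    · rw [h0]
    · exact (this h' h h0).symm
  by_cases hp0 : p.map (polEval x) = 0
  · simp [hp0]
  apply sign_eval_eq_of_ne_zero
  intro r hr hr0
  rw [Set.uIcc_of_lt hyy] at hr
  have hrF : r ∈ fiberRoots F x := mem_fiberRoots.2 ⟨p, hp, hp0, hr0⟩
  rcases hr.2.eq_or_lt with e | e
  · have : rankLE F (x, y) < rankLE F (x, y') := by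
      refine Finset.card_lt_card ⟨Finset.monotone_filter_right _ fun _ _ hz => hz.trans hyy.le,
        fun hs => ?_⟩
      have : r ∈ (fiberRoots F x).filter (· ≤ y) := hs (Finset.mem_filter.2 ⟨hrF, e.le⟩)
      rw [Finset.mem_filter] at this
      linarith [this.2]
    rw [h.2.2, h'.2.2] at this
    exact lt_irrefl _ this
  · have : rankLT F (x, y) < rankLT F (x, y') := by
      refine Finset.card_lt_card ⟨Finset.monotone_filter_right _ fun _ _ hz => hz.trans hyy,
        fun hs => ?_⟩
      have : r ∈ (fiberRoots F x).filter (· < y) := hs (Finset.mem_filter.2 ⟨hrF, e⟩)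
      rw [Finset.mem_filter] at this
      linarith [this.2, hr.1]
    rw [h.2.1, h'.2.1] at this
    exact lt_irrefl _ this

end Stratification

/-- A set which projects openly, with preconnected fibres, onto a preconnected set is
preconnected. -/
lemma isPreconnected_of_open_projection {X Y : Type*} [TopologicalSpace X] [TopologicalSpace Y]
    {T : Set (X × Y)} (hC : IsPreconnected (Prod.fst '' T))
    (hfib : ∀ x, IsPreconnected {y | (x, y) ∈ T})
    (hopen : ∀ z ∈ T, ∀ W, IsOpen W → z ∈ W →
      ∀ᶠ x in nhds z.1, x ∈ Prod.fst '' T → ∃ y, (x, y) ∈ T ∩ W) : IsPreconnected T := by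
  rintro u v hu hv huv ⟨z, hzT, hzu⟩ ⟨w, hwT, hwv⟩
  let A : Set (X × Y) → Set X := fun u =>
    interior {x | x ∈ Prod.fst '' T → ∃ y, (x, y) ∈ T ∩ u}
  have hA : ∀ u, IsOpen u → ∀ z ∈ T, z ∈ u → z.1 ∈ A u := fun u hu z hz hzu =>
    mem_interior_iff_mem_nhds.2 (hopen z hz u hu hzu)
  obtain ⟨x, hxC, hxu, hxv⟩ := hC (A u) (A v) isOpen_interior isOpen_interior (by
    rintro _ ⟨z, hz, rfl⟩
    exact (huv hz).imp (hA u hu z hz) (hA v hv z hz)) ⟨z.1, ⟨z, hzT, rfl⟩, hA u hu z hzT hzu⟩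
    ⟨w.1, ⟨w, hwT, rfl⟩, hA v hv w hwT hwv⟩
  obtain ⟨y, hy, hyu⟩ := interior_subset hxu hxC
  obtain ⟨y', hy', hyv⟩ := interior_subset hxv hxC
  have hcont : Continuous fun y : Y => (x, y) := by fun_prop
  obtain ⟨y'', h1, h2⟩ := hfib x _ _ (hu.preimage hcont) (hv.preimage hcont)
    (fun a ha => huv ha) ⟨y, hy, hyu⟩ ⟨y', hy', hyv⟩
  exact ⟨_, h1, h2⟩

/-- `S` is a finite union of preconnected semialgebraic sets. -/
def HasSAPieces {V : Type*} [NormedAddCommGroup V] [NormedSpace ℝ V] (S : Set V) : Prop :=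
  ∃ 𝒞 : Set (Set V), 𝒞.Finite ∧ (∀ C ∈ 𝒞, SA C ∧ IsPreconnected C) ∧ ⋃₀ 𝒞 = S

lemma HasSAPieces.iUnion {V : Type*} [NormedAddCommGroup V] [NormedSpace ℝ V] {ι : Type*}
    [Finite ι] {S : ι → Set V} (h : ∀ i, HasSAPieces (S i)) : HasSAPieces (⋃ i, S i) := by
  choose 𝒞 h1 h2 h3 using h
  refine ⟨⋃ i, 𝒞 i, Set.finite_iUnion h1, ?_, ?_⟩
  · intro C hC
    obtain ⟨i, hi⟩ := Set.mem_iUnion.1 hC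
    exact h2 i C hi
  · rw [Set.sUnion_iUnion]
    exact Set.iUnion_congr h3

lemma HasSAPieces.prod_real {V : Type*} [NormedAddCommGroup V] [NormedSpace ℝ V]
    [FiniteDimensional ℝ V] (ih : ∀ S : Set V, SA S → HasSAPieces S) {S : Set (V × ℝ)}
    (hS : SA S) : HasSAPieces S := by
  classical
  obtain ⟨Φ, hΦ, hP, hΦS⟩ := id hS
  have hp : ∀ f : V × ℝ → ℝ, ∃ p : (Pol V)[X], f ∈ Pol (V × ℝ) →
      ∀ x y, f (x, y) = (p.map (polEval x)).eval y := by
    intro f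
    by_cases hf : f ∈ Pol (V × ℝ)
    · obtain ⟨p, hp⟩ := Pol.exists_polynomial hf
      exact ⟨p, fun _ => hp⟩
    · exact ⟨0, fun h => absurd h hf⟩
  choose P hPP using hp
  set F : Finset (Pol V)[X] := (hΦ.toFinset.image P).biUnion fun p =>
    (Finset.range (p.natDegree + 1)).image fun i => derivative^[i] p with hFdef
  have hF : ∀ p ∈ F, ∀ i, derivative^[i] p ≠ 0 → derivative^[i] p ∈ F := by
    intro p hp i hi
    obtain ⟨q, hq, hp⟩ := Finset.mem_biUnion.1 hp
    obtain ⟨j, -, rfl⟩ := Finset.mem_image.1 hp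
    rw [← Function.iterate_add_apply] at hi ⊢
    refine Finset.mem_biUnion.2 ⟨q, hq, Finset.mem_image.2 ⟨i + j, ?_, rfl⟩⟩
    rw [Finset.mem_range]
    by_contra hlt
    exact hi (iterate_derivative_eq_zero (by omega))
  have hPF : ∀ f ∈ Φ, P f ∈ F := fun f hf => Finset.mem_biUnion.2
    ⟨P f, Finset.mem_image_of_mem _ (by simpa using hf), Finset.mem_image.2 ⟨0, by simp, rfl⟩⟩
  have hsat : ∀ c x y y', (x, y) ∈ stratum F c → (x, y') ∈ stratum F c → (x, y) ∈ S →
      (x, y') ∈ S := by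
    intro c x y y' h h' hS
    refine hΦS _ _ (fun f hf => ?_) hS
    rw [hPP f (hP f hf), hPP f (hP f hf)]
    exact sign_eq_of_mem_stratum h h' (hPF f hf)
  have hstr : ∀ c, HasSAPieces (S ∩ stratum F c) := by
    intro c
    have hB : SA {x | ∃ y, (x, y) ∈ S ∩ stratum F c} := (hS.inter (SA.stratum F c)).exists_real
    obtain ⟨𝒞, hf, h𝒞, hU⟩ := ih _ hB
    refine ⟨(fun C => S ∩ stratum F c ∩ {z | z.1 ∈ C}) '' 𝒞, hf.image _, ?_, ?_⟩
    · rintro _ ⟨C, hC, rfl⟩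
      refine ⟨(hS.inter (SA.stratum F c)).inter ((h𝒞 C hC).1.preimage PolMap.id.fst), ?_⟩
      have hCB : ∀ x ∈ C, ∃ y, (x, y) ∈ S ∩ stratum F c := fun x hx => by
        have : x ∈ ⋃₀ 𝒞 := ⟨C, hC, hx⟩
        rwa [hU] at this
      have hfst : Prod.fst '' (S ∩ stratum F c ∩ {z : V × ℝ | z.1 ∈ C}) = C := by
        ext x
        constructor
        · rintro ⟨z, hz, rfl⟩
          exact hz.2
        · intro hx
          obtain ⟨y, hy⟩ := hCB x hx
          exact ⟨(x, y), ⟨hy, hx⟩, rfl⟩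
      apply isPreconnected_of_open_projection
      · rw [hfst]
        exact (h𝒞 C hC).2
      · intro x
        by_cases hx : x ∈ C
        · have : {y | (x, y) ∈ S ∩ stratum F c ∩ {z : V × ℝ | z.1 ∈ C}} =
              {y | (x, y) ∈ stratum F c} := by
            ext y
            obtain ⟨y', hy'⟩ := hCB x hx
            exact ⟨fun h => h.1.2, fun h => ⟨⟨hsat c x y' y hy'.2 h hy'.1, h⟩, hx⟩⟩
          rw [this]
          exact isPreconnected_fiber_stratum F c x
        · have : {y | (x, y) ∈ S ∩ stratum F c ∩ {z : V × ℝ | z.1 ∈ C}} = ∅ := by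
            ext y
            simpa using fun _ _ => hx
          rw [this]
          exact isPreconnected_empty
      · rintro ⟨x₀, y₀⟩ hz W hW hzW
        rw [hfst]
        obtain ⟨ε, hε, hball⟩ := Metric.isOpen_iff.1 hW _ hzW
        filter_upwards [eventually_exists_mem_stratum hF hε hz.1.2, Metric.ball_mem_nhds x₀ hε]
          with x hx hxε hxC
        obtain ⟨y', hy'⟩ := hCB x hxC
        obtain ⟨y, hy, hyF⟩ := hx hy'.2.1
        refine ⟨y, ⟨⟨hsat c x y' y hy'.2 hyF hy'.1, hyF⟩, hxC⟩, hball ?_⟩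
        rw [Metric.mem_ball, Prod.dist_eq]
        exact max_lt hxε hy
    · ext ⟨x, y⟩
      constructor
      · rintro ⟨_, ⟨C, hC, rfl⟩, h⟩
        exact h.1
      · intro h
        have : x ∈ ⋃₀ 𝒞 := by rw [hU]; exact ⟨y, h⟩
        obtain ⟨C, hC, hx⟩ := this
        exact ⟨_, ⟨C, hC, rfl⟩, h, hx⟩
  set N := ∑ p ∈ F, p.natDegree
  have hcover : S = ⋃ c : Fin (N + 1) × Fin (N + 1) × Fin (N + 1),
      S ∩ stratum F (c.1, c.2.1, c.2.2) := by
    ext z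
    rw [Set.mem_iUnion]
    constructor
    · intro hz
      have h0 := card_fiberRoots_le F z.1
      have h1 : rankLT F z ≤ _ := Finset.card_filter_le _ _
      have h2 : rankLE F z ≤ _ := Finset.card_filter_le _ _
      exact ⟨(⟨(fiberRoots F z.1).card, by omega⟩, ⟨rankLT F z, by omega⟩, ⟨rankLE F z, by omega⟩),
        hz, rfl, rfl, rfl⟩
    · rintro ⟨c, hc⟩
      exact hc.1
  rw [hcover]
  exact HasSAPieces.iUnion fun c => hstr _

lemma HasSAPieces.of_linearEquiv {V W : Type*} [NormedAddCommGroup V] [NormedSpace ℝ V]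
    [NormedAddCommGroup W] [NormedSpace ℝ W] [FiniteDimensional ℝ V] [FiniteDimensional ℝ W]
    (e : V ≃ₗ[ℝ] W) {S : Set W} (h : HasSAPieces (e ⁻¹' S)) : HasSAPieces S := by
  obtain ⟨𝒞, hf, h𝒞, hU⟩ := h
  refine ⟨(fun C => e '' C) '' 𝒞, hf.image _, ?_, ?_⟩
  · rintro _ ⟨C, hC, rfl⟩
    exact ⟨(h𝒞 C hC).1.image (PolMap.linear e.toLinearMap), (h𝒞 C hC).2.image _
      (LinearMap.continuous_of_finiteDimensional e.toLinearMap).continuousOn⟩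
  · rw [← Set.image_sUnion, hU, Set.image_preimage_eq _ e.surjective]

/-- A semialgebraic set is a finite union of preconnected semialgebraic sets. -/
theorem SA.hasSAPieces : ∀ {n : ℕ} {S : Set (Fin n → ℝ)}, SA S → HasSAPieces S := by
  intro n
  induction n with
  | zero =>
    intro S hS
    exact ⟨{S}, Set.finite_singleton S, by
      simpa using ⟨hS, Set.subsingleton_of_subsingleton.isPreconnected⟩, Set.sUnion_singleton S⟩
  | succ n ih =>
    intro S hS
    let e : ((Fin n → ℝ) × ℝ) ≃ₗ[ℝ] (Fin (n + 1) → ℝ) :=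
      (LinearEquiv.prodComm ℝ _ _).trans (Fin.consLinearEquiv ℝ (fun _ => ℝ))
    exact HasSAPieces.of_linearEquiv e
      (HasSAPieces.prod_real (fun _ h => ih h) (hS.preimage (PolMap.linear e.toLinearMap)))

end Semialgebraic

section NashGroups

open Topology

/-- Local analyticity of a map on a subset of a normed space. -/
def LA {E F : Type*} [NormedAddCommGroup E] [NormedSpace ℝ E] [NormedAddCommGroup F]
    [NormedSpace ℝ F] (S : Set E) (f : E → F) : Prop :=
  ∀ x ∈ S, ∃ g, AnalyticAt ℝ g x ∧ g =ᶠ[𝓝[S] x] f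

/-- The graph of a map on a subset of a vector space is semialgebraic. -/
def SAGraph {V W : Type*} [AddCommGroup V] [Module ℝ V] [AddCommGroup W] [Module ℝ W]
    (S : Set V) (f : V → W) : Prop := SA {p : V × W | p.1 ∈ S ∧ p.2 = f p.1}

section LocallyAnalytic

variable {E F E' : Type*} [NormedAddCommGroup E] [NormedSpace ℝ E] [NormedAddCommGroup F]
  [NormedSpace ℝ F] [NormedAddCommGroup E'] [NormedSpace ℝ E']

lemma LA.continuousOn {S : Set E} {f : E → F} (h : LA S f) : ContinuousOn f S := by
  intro x hx
  obtain ⟨g, hg, hgf⟩ := h x hx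
  exact (hg.continuousAt.continuousWithinAt (s := S)).congr_of_eventuallyEq hgf.symm
    (hgf.self_of_nhdsWithin hx).symm

lemma AnalyticOnNhd.la {S : Set E} {f : E → F} (h : AnalyticOnNhd ℝ f S) : LA S f :=
  fun x hx => ⟨f, h x hx, Filter.EventuallyEq.rfl⟩

lemma LA.congr {S : Set E} {f f' : E → F} (h : LA S f) (hf : ∀ x ∈ S, f x = f' x) : LA S f' :=
  fun x hx =>
  let ⟨g, hg, hgf⟩ := h x hx
  ⟨g, hg, hgf.trans (Filter.eventually_of_mem self_mem_nhdsWithin hf)⟩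

lemma LA.comp {S : Set E} {T : Set F} {f : F → E'} {g : E → F} (hf : LA T f) (hg : LA S g)
    (hST : Set.MapsTo g S T) : LA S (fun x => f (g x)) := by
  intro x hx
  obtain ⟨g', hg', hgg⟩ := hg x hx
  obtain ⟨f', hf', hff⟩ := hf (g x) (hST hx)
  have hx' : g' x = g x := hgg.self_of_nhdsWithin hx
  refine ⟨fun y => f' (g' y), AnalyticAt.comp (by rwa [hx']) hg', ?_⟩
  have h1 : Filter.Tendsto g (𝓝[S] x) (𝓝[T] (g x)) :=
    tendsto_nhdsWithin_of_tendsto_nhds_of_eventually_within _ (hg.continuousOn x hx)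
      (Filter.eventually_of_mem self_mem_nhdsWithin hST)
  filter_upwards [hgg, h1.eventually hff] with y hy hy'
  rw [hy, hy']

lemma LA.prodMk {S : Set E} {f : E → F} {g : E → E'} (hf : LA S f) (hg : LA S g) :
    LA S (fun x => (f x, g x)) := by
  intro x hx
  obtain ⟨f', hf', hff⟩ := hf x hx
  obtain ⟨g', hg', hgg⟩ := hg x hx
  refine ⟨fun y => (f' y, g' y), hf'.prod hg', ?_⟩
  filter_upwards [hff, hgg] with y h1 h2
  rw [h1, h2]

end LocallyAnalytic

lemma locAnalyticOn_iff_la {n m : ℕ} {S : Set (Fin n → ℝ)} {f : (Fin n → ℝ) → (Fin m → ℝ)} :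
    LocAnalyticOn S f ↔ LA S f := by
  constructor
  · intro h x hx
    obtain ⟨U, hU, hxU, g, hg, hgf⟩ := h x hx
    exact ⟨g, hg x hxU, Filter.eventually_of_mem
      (Filter.inter_mem (mem_nhdsWithin_of_mem_nhds (hU.mem_nhds hxU)) self_mem_nhdsWithin) hgf⟩
  · intro h x hx
    obtain ⟨g, hg, hgf⟩ := h x hx
    obtain ⟨U, hU, hxU, hUg⟩ := mem_nhdsWithin.1 hgf
    obtain ⟨V, hV, hVo, hxV⟩ := eventually_nhds_iff.1 hg.eventually_analyticAt
    exact ⟨U ∩ V, hU.inter hVo, ⟨hxU, hxV⟩, g, fun y hy => hV y hy.2,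
      fun y hy => hUg ⟨hy.1.1, hy.2⟩⟩

section Halves

variable {n m : ℕ}

@[simp] lemma frontHalf_append (x : Fin n → ℝ) (y : Fin m → ℝ) :
    frontHalf (Fin.append x y) = x := by
  ext i
  simp [frontHalf]

@[simp] lemma backHalf_append (x : Fin n → ℝ) (y : Fin m → ℝ) :
    backHalf (Fin.append x y) = y := by
  ext i
  simp [backHalf]

@[simp] lemma append_frontHalf_backHalf (z : Fin (n + m) → ℝ) :
    Fin.append (frontHalf z) (backHalf z) = z := Fin.append_castAdd_natAdd

lemma append_eq_iff {x : Fin n → ℝ} {y : Fin m → ℝ} {z : Fin (n + m) → ℝ} :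
    z = Fin.append x y ↔ frontHalf z = x ∧ backHalf z = y := by
  constructor
  · rintro rfl
    simp
  · rintro ⟨rfl, rfl⟩
    simp

lemma PolMap.frontHalf : PolMap (frontHalf : (Fin (n + m) → ℝ) → _) :=
  PolMap.pi fun i => PolMap.id.apply (Fin.castAdd m i)

lemma PolMap.backHalf : PolMap (backHalf : (Fin (n + m) → ℝ) → _) :=
  PolMap.pi fun i => PolMap.id.apply (Fin.natAdd n i)

lemma PolMap.append : PolMap (fun p : (Fin n → ℝ) × (Fin m → ℝ) => Fin.append p.1 p.2) := by
  refine PolMap.pi fun i => Fin.addCases (fun j => ?_) (fun j => ?_) i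
  · simpa using PolMap.id.fst.apply j
  · simpa using PolMap.id.snd.apply j

/-- Splitting coordinates, as a continuous linear equivalence. -/
noncomputable def appendCLE (n m : ℕ) : ((Fin n → ℝ) × (Fin m → ℝ)) ≃L[ℝ] (Fin (n + m) → ℝ) :=
  LinearEquiv.toContinuousLinearEquiv
    { toFun := fun p => Fin.append p.1 p.2
      invFun := fun z => (frontHalf z, backHalf z)
      map_add' := fun p q => by
        ext i
        refine Fin.addCases (fun j => ?_) (fun j => ?_) i <;> simp
      map_smul' := fun c p => by
        ext i
        refine Fin.addCases (fun j => ?_) (fun j => ?_) i <;> simp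
      left_inv := fun p => by simp
      right_inv := fun z => by simp }

lemma appendCLE_apply (p : (Fin n → ℝ) × (Fin m → ℝ)) :
    appendCLE n m p = Fin.append p.1 p.2 := rfl

lemma appendCLE_symm_apply (z : Fin (n + m) → ℝ) :
    (appendCLE n m).symm z = (frontHalf z, backHalf z) := rfl

lemma isSemialgebraic_nashGraph_iff {S : Set (Fin n → ℝ)} {f : (Fin n → ℝ) → (Fin m → ℝ)} :
    IsSemialgebraic (NashGraph S f) ↔ SAGraph S f := by
  rw [isSemialgebraic_iff_sa]
  have h : ∀ x y, Fin.append x y ∈ NashGraph S f ↔ x ∈ S ∧ y = f x := by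
    intro x y
    constructor
    · rintro ⟨x', hx', h⟩
      obtain ⟨h1, h2⟩ := append_eq_iff.1 h
      simp only [frontHalf_append, backHalf_append] at h1 h2
      exact ⟨h1 ▸ hx', h1 ▸ h2⟩
    · rintro ⟨h, rfl⟩
      exact ⟨x, h, rfl⟩
  constructor
  · intro hS
    have := hS.preimage PolMap.append
    simp only [h] at this
    exact this
  · intro hS
    have := hS.preimage (PolMap.frontHalf.prodMk (PolMap.backHalf (n := n) (m := m)))
    convert this using 1
    ext z
    conv_lhs => rw [← append_frontHalf_backHalf z, h]
    rfl

end Halves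

lemma isNashMapOn_iff {n m : ℕ} {S : Set (Fin n → ℝ)} {f : (Fin n → ℝ) → (Fin m → ℝ)} :
    IsNashMapOn S f ↔ LA S f ∧ SAGraph S f := by
  rw [IsNashMapOn, locAnalyticOn_iff_la, isSemialgebraic_nashGraph_iff]

lemma SA.singleton {V : Type*} [AddCommGroup V] [Module ℝ V] [FiniteDimensional ℝ V] (x : V) :
    SA {x} := SA.eq PolMap.id (PolMap.const x)

lemma Set.Finite.sa {V : Type*} [AddCommGroup V] [Module ℝ V] [FiniteDimensional ℝ V] {S : Set V}
    (hS : S.Finite) : SA S := by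
  have := SA.exists_mem_finset hS.toFinset (P := fun i x => x = i) fun i _ => SA.singleton i
  simpa using this

lemma Set.Finite.isNashMapOn {n m : ℕ} {S : Set (Fin n → ℝ)} (hS : S.Finite)
    (f : (Fin n → ℝ) → (Fin m → ℝ)) : IsNashMapOn S f := by
  refine isNashMapOn_iff.2 ⟨fun x hx => ⟨fun _ => f x, analyticAt_const, ?_⟩, Set.Finite.sa ?_⟩
  · have : ∀ᶠ y in 𝓝 x, y ∉ S \ {x} := (hS.subset Set.sdiff_subset).isClosed.isOpen_compl.mem_nhds
      fun h => h.2 rfl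
    filter_upwards [mem_nhdsWithin_of_mem_nhds this, self_mem_nhdsWithin] with y h1 h2
    have : y = x := by
      by_contra hne
      exact h1 ⟨h2, hne⟩
    rw [this]
  · refine (hS.image fun x => (x, f x)).subset ?_
    rintro ⟨x, y⟩ ⟨hx, hy⟩
    exact ⟨x, hx, Prod.ext rfl hy.symm⟩

lemma Set.Finite.isAnalyticSubmanifold {n : ℕ} {S : Set (Fin n → ℝ)} (hS : S.Finite) :
    IsAnalyticSubmanifold 0 S := by
  intro x hx
  have hU : IsOpen (S \ {x})ᶜ := (hS.subset Set.sdiff_subset).isClosed.isOpen_compl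
  refine ⟨(S \ {x})ᶜ, (fun y => y + x) ⁻¹' (S \ {x})ᶜ, fun y => y - x, fun y => y + x, hU,
    hU.preimage (by fun_prop), fun h => h.2 rfl, ?_, ?_, ?_, fun y hy => hy, ?_, ?_, ?_⟩
  · exact fun y _ => analyticAt_id.sub analyticAt_const
  · exact fun y _ => analyticAt_id.add analyticAt_const
  · intro y hy
    change y - x + x ∈ (S \ {x})ᶜ
    rwa [sub_add_cancel]
  · simp
  · simp
  · ext y
    constructor
    · rintro ⟨z, ⟨h1, h2⟩, rfl⟩
      have : z = x := by
        by_contra hne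
        exact h1 ⟨h2, hne⟩
      subst this
      simp
    · rintro ⟨h1, h2⟩
      have : y = 0 := funext fun i => h2 i (Nat.zero_le _)
      subst this
      exact ⟨x, ⟨fun h => h.2 rfl, hx⟩, by simp⟩

/-- A finite group as an affine Nash group of dimension zero. -/
noncomputable def finiteNashGroup (E : Type*) [Group E] [Finite E] (ι : E → (Fin 1 → ℝ))
    (hι : Function.Injective ι) : NashGroup where
  n := 1
  dim := 0
  carrier := Set.range ι
  semialg := (Set.finite_range ι).sa.isSemialgebraic
  submanifold := (Set.finite_range ι).isAnalyticSubmanifold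
  one := ι 1
  mul x y := ι (Function.invFun ι x * Function.invFun ι y)
  inv x := ι (Function.invFun ι x)⁻¹
  one_mem := ⟨_, rfl⟩
  mul_mem _ _ _ _ := ⟨_, rfl⟩
  inv_mem _ _ := ⟨_, rfl⟩
  mul_assoc _ _ _ _ _ _ := by simp [Function.leftInverse_invFun hι _, mul_assoc]
  one_mul := by
    rintro _ ⟨x, rfl⟩
    simp [Function.leftInverse_invFun hι _]
  mul_one := by
    rintro _ ⟨x, rfl⟩
    simp [Function.leftInverse_invFun hι _]
  inv_mul_cancel := by
    rintro _ ⟨x, rfl⟩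
    simp [Function.leftInverse_invFun hι _]
  mul_nash := by
    refine Set.Finite.isNashMapOn ?_ _
    refine (((Set.finite_range ι).prod (Set.finite_range ι)).image (appendCLE 1 1)).subset ?_
    rintro z ⟨h1, h2⟩
    exact ⟨(frontHalf z, backHalf z), ⟨h1, h2⟩, append_frontHalf_backHalf z⟩
  inv_nash := (Set.finite_range ι).isNashMapOn _

lemma finiteNashGroup_almostLinear (E : Type*) [Group E] [Finite E] (ι : E → (Fin 1 → ℝ))
    (hι : Function.Injective ι) : (finiteNashGroup E ι hι).AlmostLinear := by
  refine ⟨0, fun _ => 1, (Set.finite_range ι).isNashMapOn _, fun _ _ => isUnit_one,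
    fun _ _ _ _ => by simp, ?_⟩
  exact (Set.finite_range ι).subset fun x hx => hx.1

namespace NashGroup

variable (G : NashGroup)

lemma la_mul : LA (G.carrier ×ˢ G.carrier) (fun p => G.mul p.1 p.2) := by
  have h := (isNashMapOn_iff.1 G.mul_nash).1
  have h' : LA (G.carrier ×ˢ G.carrier) (appendCLE G.n G.n) :=
    AnalyticOnNhd.la fun x _ => (appendCLE G.n G.n).analyticAt x
  refine (h.comp h' ?_).congr ?_
  · rintro ⟨x, y⟩ ⟨hx, hy⟩
    change frontHalf (Fin.append x y) ∈ _ ∧ backHalf (Fin.append x y) ∈ _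
    simpa using ⟨hx, hy⟩
  · rintro ⟨x, y⟩ -
    simp [appendCLE_apply]

lemma la_inv : LA G.carrier G.inv := (isNashMapOn_iff.1 G.inv_nash).1

lemma sa_carrier : SA G.carrier := G.semialg.sa

lemma saGraph_mul : SAGraph (G.carrier ×ˢ G.carrier) (fun p => G.mul p.1 p.2) := by
  have h := (isNashMapOn_iff.1 G.mul_nash).2.preimage
    (g := fun p : ((Fin G.n → ℝ) × (Fin G.n → ℝ)) × (Fin G.n → ℝ) =>
      (Fin.append p.1.1 p.1.2, p.2))
    ((PolMap.append.comp PolMap.id.fst).prodMk PolMap.id.snd)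
  simpa [SAGraph] using h

lemma saGraph_inv : SAGraph G.carrier G.inv := (isNashMapOn_iff.1 G.inv_nash).2

/-- The underlying abstract group of an affine Nash group. -/
instance : Group G.carrier where
  one := ⟨G.one, G.one_mem⟩
  mul x y := ⟨G.mul x y, G.mul_mem _ x.2 _ y.2⟩
  inv x := ⟨G.inv x, G.inv_mem _ x.2⟩
  mul_assoc x y z := Subtype.ext (G.mul_assoc _ x.2 _ y.2 _ z.2)
  one_mul x := Subtype.ext (G.one_mul _ x.2)
  mul_one x := Subtype.ext (G.mul_one _ x.2)
  inv_mul_cancel x := Subtype.ext (G.inv_mul_cancel _ x.2)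

variable {G}

lemma coe_one : (↑(1 : G.carrier) : Fin G.n → ℝ) = G.one := rfl

instance : IsTopologicalGroup G.carrier where
  continuous_mul := by
    refine Continuous.subtype_mk (f := fun p : G.carrier × G.carrier => G.mul p.1 p.2) ?_ _
    exact G.la_mul.continuousOn.comp_continuous
      (f := fun p : G.carrier × G.carrier => ((p.1 : Fin G.n → ℝ), (p.2 : Fin G.n → ℝ)))
      (by fun_prop) fun p => ⟨p.1.2, p.2.2⟩
  continuous_inv := Continuous.subtype_mk
    (G.la_inv.continuousOn.comp_continuous continuous_subtype_val fun p => p.2) _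

instance connectedComponentOfOne_normal {Γ : Type*} [TopologicalSpace Γ] [Group Γ]
    [IsTopologicalGroup Γ] : (Subgroup.connectedComponentOfOne Γ).Normal where
  conj_mem x hx g := by
    have h : Continuous fun y : Γ => g * y * g⁻¹ := by fun_prop
    have := h.image_connectedComponent_subset 1 ⟨x, hx, rfl⟩
    rwa [_root_.mul_one, mul_inv_cancel] at this

/-- The component group of an affine Nash group. -/
abbrev ComponentGroup (G : NashGroup) : Type :=
  G.carrier ⧸ Subgroup.connectedComponentOfOne G.carrier

lemma mem_connectedComponentIn_iff (x : G.carrier) :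
    (x : Fin G.n → ℝ) ∈ connectedComponentIn G.carrier G.one ↔ (x : G.ComponentGroup) = 1 := by
  rw [connectedComponentIn_eq_image G.one_mem, QuotientGroup.eq_one_iff]
  exact Subtype.val_injective.mem_set_image

lemma mk_eq_mk_of_isPreconnected {C : Set (Fin G.n → ℝ)} (hC : IsPreconnected C)
    (hCG : C ⊆ G.carrier) {x y : G.carrier} (hx : (x : Fin G.n → ℝ) ∈ C)
    (hy : (y : Fin G.n → ℝ) ∈ C) : (x : G.ComponentGroup) = y := by
  have h1 : IsPreconnected (Subtype.val ⁻¹' C : Set G.carrier) := by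
    refine IsInducing.subtypeVal.isPreconnected_image.1 ?_
    rwa [Subtype.image_preimage_coe, Set.inter_eq_self_of_subset_right hCG]
  have h2 := h1.image (fun z => x⁻¹ * z) (by fun_prop)
  have h3 := h2.subset_connectedComponent (x := 1) ⟨x, hx, by simp⟩ ⟨y, hy, rfl⟩
  exact QuotientGroup.eq.2 h3

lemma exists_pieces (G : NashGroup) : ∃ 𝒞 : Set (Set (Fin G.n → ℝ)), 𝒞.Finite ∧
    (∀ C ∈ 𝒞, SA C) ∧ (∀ x : G.carrier, ∃ C ∈ 𝒞, (x : Fin G.n → ℝ) ∈ C) ∧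
    ∀ C ∈ 𝒞, C ⊆ G.carrier ∧ ∀ x y : G.carrier, (x : Fin G.n → ℝ) ∈ C →
      (y : Fin G.n → ℝ) ∈ C → (x : G.ComponentGroup) = y := by
  obtain ⟨𝒞, hf, h𝒞, hU⟩ := G.sa_carrier.hasSAPieces
  have hsub : ∀ C ∈ 𝒞, C ⊆ G.carrier := fun C hC => hU ▸ Set.subset_sUnion_of_mem hC
  refine ⟨𝒞, hf, fun C hC => (h𝒞 C hC).1, fun x => ?_, fun C hC => ⟨hsub C hC, fun x y hx hy =>
    mk_eq_mk_of_isPreconnected (h𝒞 C hC).2 (hsub C hC) hx hy⟩⟩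
  exact Set.mem_sUnion.1 (hU.symm ▸ x.2 : (x : Fin G.n → ℝ) ∈ ⋃₀ 𝒞)

instance : Finite G.ComponentGroup := by
  obtain ⟨𝒞, hf, -, hcov, hco⟩ := G.exists_pieces
  choose f hf𝒞 hfx using hcov
  have : Finite 𝒞 := hf
  refine Finite.of_injective (β := 𝒞) (fun e => ⟨f e.out, hf𝒞 _⟩) fun e e' h => ?_
  simp only [Subtype.mk.injEq] at h
  have := (hco _ (hf𝒞 e.out)).2 e.out e'.out (hfx _) (h ▸ hfx _)
  simpa using this

lemma sa_component (e : G.ComponentGroup) :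
    SA {x | ∃ h : x ∈ G.carrier, ((⟨x, h⟩ : G.carrier) : G.ComponentGroup) = e} := by
  obtain ⟨𝒞, hf, hSA, hcov, hco⟩ := G.exists_pieces
  have hf' := hf.subset (Set.sep_subset 𝒞
    fun C => ∀ x : G.carrier, (x : Fin G.n → ℝ) ∈ C → (x : G.ComponentGroup) = e)
  have := SA.exists_mem_finset hf'.toFinset (P := fun C x => x ∈ C)
    fun C hC => hSA C (by simp at hC; exact hC.1)
  convert this using 1
  ext x
  simp only [Set.mem_ofPred_eq, Set.Finite.mem_toFinset]
  constructor
  · rintro ⟨h, hx⟩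
    obtain ⟨C, hC, hxC⟩ := hcov ⟨x, h⟩
    exact ⟨C, ⟨hC, fun y hy => ((hco C hC).2 y _ hy hxC).trans hx⟩, hxC⟩
  · rintro ⟨C, ⟨hC, h⟩, hxC⟩
    exact ⟨(hco C hC).1 hxC, h _ hxC⟩

lemma eventually_mk_eq (x : G.carrier) : ∀ᶠ y : G.carrier in 𝓝 x, (y : G.ComponentGroup) = x := by
  have hfi : (Subgroup.connectedComponentOfOne G.carrier).FiniteIndex :=
    Subgroup.finiteIndex_of_finite_quotient
  have ho : IsOpen (Subgroup.connectedComponentOfOne G.carrier : Set G.carrier) :=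
    Subgroup.isOpen_of_isClosed_of_finiteIndex _ isClosed_connectedComponent
  have hc : Continuous fun y : G.carrier => x⁻¹ * y := by fun_prop
  filter_upwards [(ho.preimage hc).mem_nhds (x := x) (by simp)] with y hy
  exact (QuotientGroup.eq.2 hy).symm

open Classical in
theorem hasAlmostLinearQuotientBy_connectedComponentIn (G : NashGroup) :
    IsNashSubgroup G (connectedComponentIn G.carrier G.one) ∧
    IsNormalIn G G.carrier (connectedComponentIn G.carrier G.one) ∧
    HasAlmostLinearQuotientBy G (connectedComponentIn G.carrier G.one) := by
  have hsub := connectedComponentIn_subset G.carrier G.one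
  have hmem := fun (x : G.carrier) => mem_connectedComponentIn_iff x
  refine ⟨⟨hsub, mem_connectedComponentIn G.one_mem, ?_, ?_, ?_⟩, ?_, ?_⟩
  · intro x hx y hy
    have hx' := (hmem ⟨x, hsub hx⟩).1 hx
    have hy' := (hmem ⟨y, hsub hy⟩).1 hy
    refine (hmem (⟨x, hsub hx⟩ * ⟨y, hsub hy⟩)).2 ?_
    rw [QuotientGroup.mk_mul, hx', hy', _root_.one_mul]
  · intro x hx
    have hx' := (hmem ⟨x, hsub hx⟩).1 hx
    refine (hmem (⟨x, hsub hx⟩⁻¹)).2 ?_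
    rw [QuotientGroup.mk_inv, hx', inv_one]
  · refine SA.isSemialgebraic ?_
    convert sa_component (G := G) 1 using 1
    ext x
    exact ⟨fun hx => ⟨hsub hx, (hmem ⟨x, hsub hx⟩).1 hx⟩, fun ⟨h, hx⟩ => (hmem ⟨x, h⟩).2 hx⟩
  · intro g hg x hx
    have hx' := (hmem ⟨x, hsub hx⟩).1 hx
    refine (hmem (⟨g, hg⟩ * ⟨x, hsub hx⟩ * ⟨g, hg⟩⁻¹)).2 ?_
    rw [QuotientGroup.mk_mul, QuotientGroup.mk_mul, hx', _root_.mul_one, QuotientGroup.mk_inv,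
      mul_inv_cancel]
  · obtain ⟨k, ⟨ε⟩⟩ := Finite.exists_equiv_fin G.ComponentGroup
    let ι : G.ComponentGroup → (Fin 1 → ℝ) := fun e _ => ε e
    have hι : Function.Injective ι := fun e e' h => by
      have := congr_fun h 0
      simp only [ι, Nat.cast_inj] at this
      exact ε.injective (Fin.ext this)
    let π : (Fin G.n → ℝ) → (Fin 1 → ℝ) := fun x =>
      if h : x ∈ G.carrier then ι ((⟨x, h⟩ : G.carrier) : G.ComponentGroup) else 0
    have hπ : ∀ x : G.carrier, π x = ι (x : G.ComponentGroup) := fun x => dif_pos x.2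
    refine ⟨finiteNashGroup G.ComponentGroup ι hι, π, ⟨?_, ?_, ?_⟩, ?_, ?_,
      finiteNashGroup_almostLinear _ ι hι⟩
    · exact fun x hx => ⟨_, (hπ ⟨x, hx⟩).symm⟩
    · intro x hx y hy
      change π (⟨x, hx⟩ * ⟨y, hy⟩ : G.carrier) =
        ι (Function.invFun ι (π (⟨x, hx⟩ : G.carrier)) * Function.invFun ι (π (⟨y, hy⟩ : G.carrier)))
      rw [hπ, hπ, hπ, Function.leftInverse_invFun hι, Function.leftInverse_invFun hι,
        QuotientGroup.mk_mul]
    · refine isNashMapOn_iff.2 ⟨fun x hx => ⟨fun _ => π x, analyticAt_const, ?_⟩, ?_⟩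
      · have := eventually_mk_eq (⟨x, hx⟩ : G.carrier)
        rw [nhdsWithin_eq_map_subtype_coe hx]
        refine Filter.eventually_map.2 ?_
        filter_upwards [this] with y hy
        rw [hπ y, hy]
        exact hπ ⟨x, hx⟩
      · have := SA.exists_finite (V := (Fin G.n → ℝ) × (Fin 1 → ℝ)) fun e : G.ComponentGroup =>
          ((sa_component e).preimage PolMap.id.fst).and
            (SA.eq PolMap.id.snd (PolMap.const (ι e)))
        change SA {p : (Fin G.n → ℝ) × (Fin 1 → ℝ) | p.1 ∈ G.carrier ∧ p.2 = π p.1}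
        convert this using 1
        ext ⟨x, y⟩
        simp only [Set.mem_ofPred_eq]
        constructor
        · rintro ⟨h, h'⟩
          exact ⟨_, ⟨h, rfl⟩, h'.trans (hπ ⟨x, h⟩)⟩
        · rintro ⟨e, ⟨h, rfl⟩, h'⟩
          exact ⟨h, h'.trans (hπ ⟨x, h⟩).symm⟩
    · ext y
      constructor
      · rintro ⟨x, hx, rfl⟩
        exact ⟨_, (hπ ⟨x, hx⟩).symm⟩
      · rintro ⟨e, rfl⟩
        obtain ⟨x, rfl⟩ := QuotientGroup.mk_surjective e
        exact ⟨x, x.2, hπ x⟩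
    · ext x
      constructor
      · rintro ⟨hx, h⟩
        exact (hmem ⟨x, hx⟩).2 (hι ((hπ ⟨x, hx⟩).symm.trans h))
      · intro hx
        refine ⟨hsub hx, (hπ ⟨x, hsub hx⟩).trans ?_⟩
        rw [(hmem ⟨x, hsub hx⟩).1 hx]
        rfl

end NashGroup

lemma SA.exists_isOpen_inter_closure_subset {V : Type*} [NormedAddCommGroup V] [NormedSpace ℝ V]
    [FiniteDimensional ℝ V] {S : Set V} (hS : SA S) (hne : S.Nonempty) :
    ∃ U, IsOpen U ∧ (U ∩ S).Nonempty ∧ U ∩ closure S ⊆ S := by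
  obtain ⟨Φ, hΦ, hpol, hsign⟩ := hS
  have hfin : ∀ x, {f ∈ Φ | f x ≠ 0}.Finite := fun x => hΦ.subset (Set.sep_subset _ _)
  obtain ⟨x, hx, hmax⟩ : ∃ x ∈ S, ∀ y ∈ S, {f ∈ Φ | f x ≠ 0} ⊆ {f ∈ Φ | f y ≠ 0} →
      {f ∈ Φ | f y ≠ 0} ⊆ {f ∈ Φ | f x ≠ 0} := by
    have hbdd : ((fun x => {f ∈ Φ | f x ≠ 0}.ncard) '' S).Finite := by
      refine (Set.finite_Iic Φ.ncard).subset ?_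
      rintro _ ⟨x, -, rfl⟩
      exact Set.ncard_le_ncard (Set.sep_subset _ _) hΦ
    obtain ⟨x, hx, h⟩ := Set.exists_max_image _ (fun k => k) hbdd (hne.image _)
    obtain ⟨x, hxS, rfl⟩ := hx
    refine ⟨x, hxS, fun y hy hsub => ?_⟩
    exact (Set.eq_of_subset_of_ncard_le hsub (h _ ⟨y, hy, rfl⟩) (hfin y)).ge
  have hcont : ∀ f ∈ Φ, Continuous f := fun f hf => Pol.continuous (hpol f hf)
  have hopen : ∀ f ∈ Φ, IsOpen {y | f x ≠ 0 → SignType.sign (f y) = SignType.sign (f x)} := by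
    intro f hf
    rcases lt_trichotomy (f x) 0 with h | h | h
    · convert isOpen_lt (hcont f hf) (continuous_const (y := (0 : ℝ))) using 1
      ext y
      simp [h.ne, sign_neg h, sign_eq_neg_one_iff]
    · simp [h]
    · convert isOpen_lt (continuous_const (y := (0 : ℝ))) (hcont f hf) using 1
      ext y
      simp [h.ne', sign_pos h, sign_eq_one_iff]
  refine ⟨⋂ f ∈ Φ, {y | f x ≠ 0 → SignType.sign (f y) = SignType.sign (f x)},
    hΦ.isOpen_biInter hopen, ⟨x, by simp, hx⟩, ?_⟩
  rintro y ⟨hyU, hyS⟩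
  simp only [Set.mem_iInter, Set.mem_ofPred_eq] at hyU
  refine hsign x y (fun f hf => ?_) hx
  by_cases h0 : f x = 0
  · have hzero : y ∈ closure {z | f z = 0} := by
      refine closure_mono ?_ ((hΦ.isOpen_biInter hopen).inter_closure
        ⟨by simpa only [Set.mem_iInter, Set.mem_ofPred_eq] using hyU, hyS⟩)
      rintro z ⟨hzU, hzS⟩
      simp only [Set.mem_iInter, Set.mem_ofPred_eq] at hzU
      by_contra hz
      refine (hmax z hzS (fun g hg => ⟨hg.1, fun hgz => ?_⟩) ⟨hf, hz⟩).2 h0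
      have := hzU g hg.1 hg.2
      rw [hgz, sign_zero, eq_comm, sign_eq_zero_iff] at this
      exact hg.2 this
    rw [(isClosed_eq (hcont f hf) continuous_const).closure_eq] at hzero
    rw [h0, hzero]
  · exact (hyU f hf h0).symm

lemma Subgroup.isClosed_of_isOpen_inter_closure_subset {Γ : Type*} [TopologicalSpace Γ] [Group Γ]
    [IsTopologicalGroup Γ] (H : Subgroup Γ) {U : Set Γ} (hU : IsOpen U)
    (hne : (U ∩ H).Nonempty) (hsub : U ∩ _root_.closure (H : Set Γ) ⊆ H) : IsClosed (H : Set Γ) := by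
  refine isClosed_of_closure_subset fun u hu => ?_
  obtain ⟨x, hxU, hxH⟩ := hne
  have hc : Continuous fun z : Γ => u * z⁻¹ * x := by fun_prop
  obtain ⟨z, hzU, hzH⟩ := mem_closure_iff.1 hu _ (hU.preimage hc) (by simpa using hxU)
  have h1 : u * z⁻¹ * x ∈ H.topologicalClosure := H.topologicalClosure.mul_mem
    (H.topologicalClosure.mul_mem hu (H.le_topologicalClosure (H.inv_mem hzH)))
    (H.le_topologicalClosure hxH)
  have h2 : u * z⁻¹ * x ∈ H := hsub ⟨hzU, h1⟩
  have h3 := H.mul_mem (H.mul_mem h2 (H.inv_mem hxH)) hzH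
  simpa [_root_.mul_assoc] using h3

section UnitGroup

variable {𝔸 : Type*} [NormedRing 𝔸] [NormedAlgebra ℝ 𝔸] [CompleteSpace 𝔸]

omit [CompleteSpace 𝔸] in
theorem Subgroup.isClosed_of_sa [FiniteDimensional ℝ 𝔸] (Γ : Subgroup 𝔸ˣ)
    (hΓ : SA (Units.val '' (Γ : Set 𝔸ˣ))) : IsClosed (Γ : Set 𝔸ˣ) := by
  obtain ⟨U, hU, ⟨_, hxU, x, hx, rfl⟩, hsub⟩ :=
    hΓ.exists_isOpen_inter_closure_subset ⟨_, 1, Γ.one_mem, rfl⟩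
  refine Γ.isClosed_of_isOpen_inter_closure_subset (hU.preimage Units.continuous_val)
    ⟨x, hxU, hx⟩ ?_
  rintro u ⟨huU, hu⟩
  obtain ⟨v, hv, hvu⟩ := hsub ⟨huU, image_closure_subset_closure_image Units.continuous_val
    ⟨u, hu, rfl⟩⟩
  rwa [Units.ext hvu] at hv

lemma NormedSpace.exp_add_of_commute_real {x y : 𝔸} (h : Commute x y) :
    exp (x + y) = exp x * exp y :=
  let _ : NormedAlgebra ℚ 𝔸 := .restrictScalars ℚ ℝ 𝔸
  exp_add_of_commute h

/-- The exponential with values in the group of units. -/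
noncomputable def expUnit (x : 𝔸) : 𝔸ˣ where
  val := NormedSpace.exp x
  inv := NormedSpace.exp (-x)
  val_inv := by
    rw [← NormedSpace.exp_add_of_commute_real (Commute.refl x).neg_right, add_neg_cancel,
      NormedSpace.exp_zero]
  inv_val := by
    rw [← NormedSpace.exp_add_of_commute_real (Commute.refl x).neg_left, neg_add_cancel,
      NormedSpace.exp_zero]

lemma expUnit_add {x y : 𝔸} (h : Commute x y) : expUnit (x + y) = expUnit x * expUnit y :=
  Units.ext (NormedSpace.exp_add_of_commute_real h)

lemma expUnit_neg (x : 𝔸) : expUnit (-x) = (expUnit x)⁻¹ := Units.ext rfl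

lemma expUnit_zero : expUnit (0 : 𝔸) = 1 := Units.ext NormedSpace.exp_zero

lemma continuous_expUnit : Continuous (expUnit : 𝔸 → 𝔸ˣ) :=
  Units.isOpenEmbedding_val.isInducing.continuous_iff.2
    (continuous_iff_continuousAt.2 fun x => (NormedSpace.exp_analytic (𝕂 := ℝ) x).continuousAt)

lemma expUnit_zsmul_mem {Γ : Subgroup 𝔸ˣ} {x : 𝔸} (hx : expUnit x ∈ Γ) (m : ℤ) :
    expUnit ((m : ℝ) • x) ∈ Γ := by
  have hn : ∀ n : ℕ, expUnit ((n : ℝ) • x) ∈ Γ := by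
    intro n
    induction n with
    | zero => simp [expUnit_zero]
    | succ n ih =>
      push_cast
      rw [add_smul, one_smul, expUnit_add ((Commute.refl x).smul_left _)]
      exact Γ.mul_mem ih hx
  obtain ⟨n, rfl | rfl⟩ := m.eq_nat_or_neg
  · exact_mod_cast hn n
  · push_cast
    rw [neg_smul, expUnit_neg]
    exact Γ.inv_mem (hn n)

lemma expUnit_smul_mem_of_tendsto {Γ : Subgroup 𝔸ˣ} (hΓ : IsClosed (Γ : Set 𝔸ˣ)) {ι : Type*}
    {l : Filter ι} [l.NeBot] {X : ι → 𝔸} {τ : ι → ℝ} {Y : 𝔸} (hX : Filter.Tendsto X l (𝓝 0))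
    (hmem : ∀ᶠ i in l, expUnit (X i) ∈ Γ) (hY : Filter.Tendsto (fun i => τ i • X i) l (𝓝 Y))
    (t : ℝ) : expUnit (t • Y) ∈ Γ := by
  have h1 : Filter.Tendsto (fun i => Int.fract (t * τ i) • X i) l (𝓝 0) := by
    refine squeeze_zero_norm (fun i => ?_) (tendsto_zero_iff_norm_tendsto_zero.1 hX)
    rw [norm_smul, Real.norm_of_nonneg (Int.fract_nonneg _)]
    exact mul_le_of_le_one_left (norm_nonneg _) (Int.fract_lt_one _).le
  have h2 : Filter.Tendsto (fun i => ((⌊t * τ i⌋ : ℤ) : ℝ) • X i) l (𝓝 (t • Y)) := by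
    have := (hY.const_smul t).sub h1
    rw [sub_zero] at this
    refine this.congr fun i => ?_
    rw [smul_smul, ← sub_smul, Int.self_sub_fract]
  refine hΓ.mem_of_tendsto (((continuous_expUnit (𝔸 := 𝔸)).tendsto _).comp h2) ?_
  filter_upwards [hmem] with i hi
  exact expUnit_zsmul_mem hi _

lemma hasDerivAt_exp_smul_zero (X : 𝔸) :
    HasDerivAt (fun s : ℝ => NormedSpace.exp (s • X)) X 0 := by
  have h1 : HasDerivAt (fun s : ℝ => s • X) X 0 := by
    simpa using (hasDerivAt_id (0 : ℝ)).smul_const X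
  have h2 : HasFDerivAt (NormedSpace.exp : 𝔸 → 𝔸) (1 : 𝔸 →L[ℝ] 𝔸) ((0 : ℝ) • X) := by
    rw [zero_smul]
    exact hasFDerivAt_exp_zero
  have h3 := h2.comp_hasDerivAt (0 : ℝ) h1
  exact h3

/-- The Lie algebra of a closed subgroup of the unit group of a Banach algebra. -/
noncomputable def lieSubspace (Γ : Subgroup 𝔸ˣ) (hΓ : IsClosed (Γ : Set 𝔸ˣ)) : Submodule ℝ 𝔸 where
  carrier := {X | ∀ t : ℝ, expUnit (t • X) ∈ Γ}
  zero_mem' t := by simp [expUnit_zero]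
  smul_mem' c X hX t := by
    rw [smul_smul]
    exact hX _
  add_mem' {X Y} hX hY := by
    have he : HasStrictFDerivAt (NormedSpace.exp : 𝔸 → 𝔸)
        ((ContinuousLinearEquiv.refl ℝ 𝔸 : 𝔸 ≃L[ℝ] 𝔸) : 𝔸 →L[ℝ] 𝔸) 0 := hasStrictFDerivAt_exp_zero
    let f : ℝ → 𝔸 := fun s => NormedSpace.exp (s • X) * NormedSpace.exp (s • Y)
    let g := he.localInverse NormedSpace.exp _ 0
    have hf0 : f 0 = NormedSpace.exp 0 := by simp [f]
    have hf : HasDerivAt f (X + Y) 0 := by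
      have := (hasDerivAt_exp_smul_zero X).mul (hasDerivAt_exp_smul_zero Y)
      simp only [zero_smul, NormedSpace.exp_zero, mul_one, one_mul] at this
      exact this
    have hg0 : g (f 0) = 0 := by
      rw [hf0]
      exact he.localInverse_apply_image
    have hgf : HasDerivAt (fun s => g (f s)) (X + Y) 0 := by
      have h1 : HasFDerivAt (𝕜 := ℝ) g
          ((ContinuousLinearEquiv.refl ℝ 𝔸).symm : 𝔸 →L[ℝ] 𝔸) (f 0) := by
        rw [hf0]
        exact he.to_localInverse.hasFDerivAt
      exact h1.comp_hasDerivAt (0 : ℝ) hf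
    have hlim : Filter.Tendsto (fun s => g (f s)) (𝓝[≠] 0) (𝓝 0) := by
      have := hgf.continuousAt.tendsto
      simp only [hg0] at this
      exact this.mono_left nhdsWithin_le_nhds
    have hslope : Filter.Tendsto (fun s : ℝ => s⁻¹ • g (f s)) (𝓝[≠] 0) (𝓝 (X + Y)) := by
      refine (hasDerivAt_iff_tendsto_slope.1 hgf).congr fun s => ?_
      simp [slope, hg0]
    refine expUnit_smul_mem_of_tendsto hΓ hlim ?_ hslope
    have hri : ∀ᶠ s in 𝓝 (0 : ℝ), NormedSpace.exp (g (f s)) = f s := by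
      have := he.eventually_right_inverse
      rw [← hf0] at this
      exact hf.continuousAt.eventually this
    filter_upwards [hri.filter_mono nhdsWithin_le_nhds] with s hs
    have : expUnit (g (f s)) = expUnit (s • X) * expUnit (s • Y) := Units.ext hs
    rw [this]
    exact Γ.mul_mem (hX s) (hY s)

end UnitGroup

/-- Near `x` the set `S` is carried onto `L` by an analytic change of coordinates. -/
def FlatAt {E F : Type*} [NormedAddCommGroup E] [NormedSpace ℝ E] [NormedAddCommGroup F]
    [NormedSpace ℝ F] (S : Set E) (L : Set F) (x : E) : Prop :=
  ∃ (U : Set E) (V : Set F) (φ : E → F) (ψ : F → E),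
    IsOpen U ∧ IsOpen V ∧ x ∈ U ∧ AnalyticOnNhd ℝ φ U ∧ AnalyticOnNhd ℝ ψ V ∧
    (∀ y ∈ U, φ y ∈ V) ∧ (∀ y ∈ V, ψ y ∈ U) ∧
    (∀ y ∈ U, ψ (φ y) = y) ∧ (∀ y ∈ V, φ (ψ y) = y) ∧ φ '' (U ∩ S) = V ∩ L

lemma FlatAt.map {E E' F F' : Type*} [NormedAddCommGroup E] [NormedSpace ℝ E]
    [NormedAddCommGroup F] [NormedSpace ℝ F] [NormedAddCommGroup E'] [NormedSpace ℝ E']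
    [NormedAddCommGroup F'] [NormedSpace ℝ F'] {S : Set E} {L : Set F} {x : E}
    (h : FlatAt S L x) (θ : E ≃L[ℝ] E') (η : F ≃L[ℝ] F') :
    FlatAt (θ '' S) (η '' L) (θ x) := by
  obtain ⟨U, V, φ, ψ, hU, hV, hx, hφ, hψ, h1, h2, h3, h4, h5⟩ := h
  refine ⟨θ.symm ⁻¹' U, η.symm ⁻¹' V, fun y => η (φ (θ.symm y)), fun y => θ (ψ (η.symm y)),
    hU.preimage θ.symm.continuous, hV.preimage η.symm.continuous, by simpa using hx, ?_, ?_,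
    ?_, ?_, ?_, ?_, ?_⟩
  · exact fun y hy => (η.analyticAt _).comp ((hφ _ hy).comp (θ.symm.analyticAt y))
  · exact fun y hy => (θ.analyticAt _).comp ((hψ _ hy).comp (η.symm.analyticAt y))
  · exact fun y hy => by simpa using h1 _ hy
  · exact fun y hy => by simpa using h2 _ hy
  · exact fun y hy => by simpa using congrArg θ (h3 _ hy)
  · exact fun y hy => by simpa using congrArg η (h4 _ hy)
  · have : θ.symm ⁻¹' U ∩ θ '' S = θ '' (U ∩ S) := by
      rw [Set.image_inter θ.injective, ← θ.image_eq_preimage_symm]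
    rw [this, Set.image_image]
    simp only [θ.symm_apply_apply]
    rw [← Set.image_image η φ, h5, Set.image_inter η.injective, ← η.image_eq_preimage_symm]

section ClosedSubgroup

variable {𝔸 : Type*} [NormedRing 𝔸] [NormedAlgebra ℝ 𝔸] [CompleteSpace 𝔸]

omit [CompleteSpace 𝔸] in
lemma exists_projection [FiniteDimensional ℝ 𝔸] (L : Submodule ℝ 𝔸) :
    ∃ p : 𝔸 →L[ℝ] 𝔸, (∀ x, p x ∈ L) ∧ ∀ x ∈ L, p x = x := by
  obtain ⟨q, hq⟩ := L.subtype.exists_leftInverse_of_injective (Submodule.ker_subtype L)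
  refine ⟨LinearMap.toContinuousLinearMap (L.subtype.comp q), fun x => (q x).2, fun x hx => ?_⟩
  have := LinearMap.congr_fun hq ⟨x, hx⟩
  simpa using congrArg Subtype.val this

/-- The product of the exponentials of the components of a vector in a splitting. -/
noncomputable def splitExp (p : 𝔸 →L[ℝ] 𝔸) (Z : 𝔸) : 𝔸 :=
  NormedSpace.exp (p Z) * NormedSpace.exp (Z - p Z)

omit [CompleteSpace 𝔸] in
lemma splitExp_zero (p : 𝔸 →L[ℝ] 𝔸) : splitExp p 0 = 1 := by simp [splitExp]

lemma analyticAt_splitExp (p : 𝔸 →L[ℝ] 𝔸) (Z : 𝔸) : AnalyticAt ℝ (splitExp p) Z := by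
  refine AnalyticAt.mul ?_ ?_
  · exact (NormedSpace.exp_analytic (𝕂 := ℝ) (p Z)).comp (p.analyticAt Z)
  · exact (NormedSpace.exp_analytic (𝕂 := ℝ) (Z - p Z)).comp
      (f := fun Z => Z - p Z) (analyticAt_id.sub (p.analyticAt Z))

lemma hasStrictFDerivAt_splitExp (p : 𝔸 →L[ℝ] 𝔸) :
    HasStrictFDerivAt (splitExp p) ((ContinuousLinearEquiv.refl ℝ 𝔸 : 𝔸 ≃L[ℝ] 𝔸) : 𝔸 →L[ℝ] 𝔸)
      0 := by
  have he : HasStrictFDerivAt (NormedSpace.exp : 𝔸 → 𝔸) (1 : 𝔸 →L[ℝ] 𝔸) 0 :=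
    hasStrictFDerivAt_exp_zero
  have h1 : HasStrictFDerivAt (fun Z => NormedSpace.exp (p Z)) ((1 : 𝔸 →L[ℝ] 𝔸).comp p) 0 :=
    HasStrictFDerivAt.comp (g := NormedSpace.exp) 0 (by rwa [map_zero]) p.hasStrictFDerivAt
  have h2 : HasStrictFDerivAt (fun Z => NormedSpace.exp (Z - p Z))
      ((1 : 𝔸 →L[ℝ] 𝔸).comp (ContinuousLinearMap.id ℝ 𝔸 - p)) 0 :=
    HasStrictFDerivAt.comp (g := NormedSpace.exp) (f := fun Z => Z - p Z) 0
      (by rwa [map_zero, sub_zero]) ((hasStrictFDerivAt_id 0).sub p.hasStrictFDerivAt)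
  refine (h1.mul' h2).congr_fderiv ?_
  ext Z
  simp

lemma eventually_splitExp_mem_iff [FiniteDimensional ℝ 𝔸] (Γ : Subgroup 𝔸ˣ)
    (hΓ : IsClosed (Γ : Set 𝔸ˣ)) {p : 𝔸 →L[ℝ] 𝔸} (hp : ∀ x, p x ∈ lieSubspace Γ hΓ)
    (hp' : ∀ x ∈ lieSubspace Γ hΓ, p x = x) :
    ∀ᶠ Z in 𝓝 0, splitExp p Z ∈ Units.val '' (Γ : Set 𝔸ˣ) ↔ Z ∈ lieSubspace Γ hΓ := by
  have hexp : ∀ X ∈ lieSubspace Γ hΓ, expUnit X ∈ Γ := fun X hX => by simpa using hX 1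
  have hval : ∀ Z, splitExp p Z = (expUnit (p Z) * expUnit (Z - p Z) : 𝔸ˣ) := fun Z => rfl
  have hmem : ∀ Z, splitExp p Z ∈ Units.val '' (Γ : Set 𝔸ˣ) ↔ expUnit (Z - p Z) ∈ Γ := by
    intro Z
    rw [hval, Units.val_injective.mem_set_image]
    exact Γ.mul_mem_cancel_left (hexp _ (hp Z))
  simp only [hmem]
  by_contra hnot
  have hfr : ∃ᶠ Z in 𝓝 (0 : 𝔸), expUnit (Z - p Z) ∈ Γ ∧ Z - p Z ≠ 0 := by
    refine (Filter.not_eventually.1 hnot).mono fun Z hZ => ?_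
    have h0 : Z ∈ lieSubspace Γ hΓ ↔ Z - p Z = 0 :=
      ⟨fun h => by rw [hp' Z h, sub_self], fun h => by rw [sub_eq_zero.1 h]; exact hp Z⟩
    rw [h0] at hZ
    by_cases h : Z - p Z = 0
    · simp [h, expUnit_zero, Γ.one_mem] at hZ
    · tauto
  have hne : (𝓝 (0 : 𝔸) ⊓ Filter.principal {Z | expUnit (Z - p Z) ∈ Γ ∧ Z - p Z ≠ 0}).NeBot :=
    Filter.frequently_mem_iff_neBot.1 hfr
  let u := Ultrafilter.of (𝓝 (0 : 𝔸) ⊓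
    Filter.principal {Z | expUnit (Z - p Z) ∈ Γ ∧ Z - p Z ≠ 0})
  have hu := Ultrafilter.of_le (𝓝 (0 : 𝔸) ⊓
    Filter.principal {Z | expUnit (Z - p Z) ∈ Γ ∧ Z - p Z ≠ 0})
  have hu0 : (u : Filter 𝔸) ≤ 𝓝 0 := hu.trans inf_le_left
  have huP : ∀ᶠ Z in (u : Filter 𝔸), expUnit (Z - p Z) ∈ Γ ∧ Z - p Z ≠ 0 :=
    Filter.le_principal_iff.1 (hu.trans inf_le_right)
  obtain ⟨y, hy, hlim⟩ := (isCompact_sphere (0 : 𝔸) 1).ultrafilter_le_nhds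
    (u.map fun Z => ‖Z - p Z‖⁻¹ • (Z - p Z)) (by
      refine Filter.le_principal_iff.2 (huP.mono fun Z hZ => ?_)
      simp [norm_smul, inv_mul_cancel₀ (norm_ne_zero_iff.2 hZ.2)])
  have hlim' : Filter.Tendsto (fun Z => ‖Z - p Z‖⁻¹ • (Z - p Z)) u (𝓝 y) := hlim
  have hX : Filter.Tendsto (fun Z => Z - p Z) u (𝓝 0) := by
    have : Filter.Tendsto (fun Z => Z - p Z) (𝓝 0) (𝓝 ((0 : 𝔸) - p 0)) :=
      (continuous_id.sub p.continuous).tendsto 0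
    rw [map_zero, sub_zero] at this
    exact this.mono_left hu0
  have hyL : y ∈ lieSubspace Γ hΓ := fun t =>
    expUnit_smul_mem_of_tendsto hΓ hX (huP.mono fun Z hZ => hZ.1) hlim' t
  have hpy : p y = 0 := by
    have h1 := (p.continuous.tendsto y).comp hlim'
    have h2 : (p ∘ fun Z => ‖Z - p Z‖⁻¹ • (Z - p Z)) = fun _ => 0 := by
      funext Z
      simp [hp' _ (hp Z)]
    rw [h2] at h1
    exact tendsto_nhds_unique h1 tendsto_const_nhds
  rw [hp' y hyL] at hpy
  simp [hpy] at hy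

theorem flatAt_one_of_isClosed [FiniteDimensional ℝ 𝔸] (Γ : Subgroup 𝔸ˣ)
    (hΓ : IsClosed (Γ : Set 𝔸ˣ)) :
    FlatAt (Units.val '' (Γ : Set 𝔸ˣ)) (lieSubspace Γ hΓ : Set 𝔸) 1 := by
  obtain ⟨p, hp, hp'⟩ := exists_projection (lieSubspace Γ hΓ)
  have hd := hasStrictFDerivAt_splitExp p
  let e := hd.toOpenPartialHomeomorph (splitExp p)
  have he0 : (0 : 𝔸) ∈ e.source := hd.mem_toOpenPartialHomeomorph_source
  have hcoe : (e : 𝔸 → 𝔸) = splitExp p := rfl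
  have he1 : e 0 = 1 := splitExp_zero p
  have hsymm : AnalyticAt ℝ e.symm 1 := by
    rw [← he1]
    exact e.analyticAt_symm' he0 (analyticAt_splitExp p 0) hd.hasFDerivAt.fderiv
  have h1t : (1 : 𝔸) ∈ e.target := he1 ▸ e.map_source he0
  have hs1 : e.symm 1 = 0 := by rw [← he1, e.left_inv he0]
  have hev := eventually_splitExp_mem_iff Γ hΓ hp hp'
  have hev' : ∀ᶠ y in 𝓝 (1 : 𝔸), (splitExp p (e.symm y) ∈ Units.val '' (Γ : Set 𝔸ˣ) ↔
      e.symm y ∈ lieSubspace Γ hΓ) := by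
    refine hsymm.continuousAt.tendsto.eventually (p := fun Z =>
      splitExp p Z ∈ Units.val '' (Γ : Set 𝔸ˣ) ↔ Z ∈ lieSubspace Γ hΓ) ?_
    rwa [hs1]
  obtain ⟨U, hU, hUo, h1U⟩ := eventually_nhds_iff.1
    (hev'.and (hsymm.eventually_analyticAt.and (e.open_target.mem_nhds h1t)))
  have hUt : U ⊆ e.target := fun y hy => (hU y hy).2.2
  refine ⟨U, e.source ∩ e ⁻¹' U, e.symm, e, hUo, e.isOpen_inter_preimage hUo, h1U,
    fun y hy => (hU y hy).2.1, fun y _ => analyticAt_splitExp p y, ?_, fun y hy => hy.2,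
    fun y hy => e.right_inv (hUt hy), fun y hy => e.left_inv hy.1, ?_⟩
  · exact fun y hy => ⟨e.map_target (hUt hy), by simpa [e.right_inv (hUt hy)] using hy⟩
  · ext Z
    constructor
    · rintro ⟨y, ⟨hy, hyS⟩, rfl⟩
      refine ⟨⟨e.map_target (hUt hy), by simpa [e.right_inv (hUt hy)] using hy⟩, ?_⟩
      refine (hU y hy).1.1 ?_
      rwa [← hcoe, e.right_inv (hUt hy)]
    · rintro ⟨⟨hZ, hZU⟩, hZL⟩
      refine ⟨e Z, ⟨hZU, ?_⟩, e.left_inv hZ⟩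
      have := (hU _ hZU).1
      rw [e.left_inv hZ] at this
      exact this.2 hZL

/-- Left multiplication by a unit. -/
noncomputable def unitMulCLE (u : 𝔸ˣ) : 𝔸 ≃L[ℝ] 𝔸 :=
  ContinuousLinearEquiv.equivOfInverse (ContinuousLinearMap.mul ℝ 𝔸 u)
    (ContinuousLinearMap.mul ℝ 𝔸 (↑u⁻¹ : 𝔸)) (fun x => by simp) (fun x => by simp)

theorem flatAt_of_isClosed [FiniteDimensional ℝ 𝔸] (Γ : Subgroup 𝔸ˣ)
    (hΓ : IsClosed (Γ : Set 𝔸ˣ)) {u : 𝔸ˣ} (hu : u ∈ Γ) :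
    FlatAt (Units.val '' (Γ : Set 𝔸ˣ)) (lieSubspace Γ hΓ : Set 𝔸) (u : 𝔸) := by
  have h := (flatAt_one_of_isClosed Γ hΓ).map (unitMulCLE u) (ContinuousLinearEquiv.refl ℝ 𝔸)
  have happ : ∀ x, unitMulCLE u x = u * x := fun x => rfl
  rw [happ, mul_one] at h
  convert h using 1
  · ext x
    constructor
    · rintro ⟨v, hv, rfl⟩
      exact ⟨_, ⟨u⁻¹ * v, Γ.mul_mem (Γ.inv_mem hu) hv, rfl⟩, by simp [happ]⟩
    · rintro ⟨_, ⟨v, hv, rfl⟩, rfl⟩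
      exact ⟨u * v, Γ.mul_mem hu hv, rfl⟩
  · simp

end ClosedSubgroup

lemma exists_flatteningCLE {E : Type*} [NormedAddCommGroup E] [NormedSpace ℝ E]
    [FiniteDimensional ℝ E] (L : Submodule ℝ E) {N : ℕ} (hN : Module.finrank ℝ E = N) :
    ∃ (d : ℕ) (η : E ≃L[ℝ] (Fin N → ℝ)),
      η '' L = {y | ∀ i : Fin N, d ≤ (i : ℕ) → y i = 0} := by
  obtain ⟨M, hLM⟩ := L.exists_isCompl
  have hsum := Submodule.finrank_add_eq_of_isCompl hLM
  rw [hN] at hsum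
  subst hsum
  let ε : E ≃ₗ[ℝ] (Fin (Module.finrank ℝ L + Module.finrank ℝ M) → ℝ) :=
    (Submodule.prodEquivOfIsCompl L M hLM).symm ≪≫ₗ
      ((Module.finBasis ℝ L).equivFun.prodCongr (Module.finBasis ℝ M).equivFun) ≪≫ₗ
      (appendCLE _ _).toLinearEquiv
  have hε : ∀ x : L × M, ε (x.1 + x.2) = Fin.append ((Module.finBasis ℝ L).equivFun x.1)
      ((Module.finBasis ℝ M).equivFun x.2) := by
    intro x
    have : (Submodule.prodEquivOfIsCompl L M hLM).symm (x.1 + x.2) = x := by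
      rw [LinearEquiv.symm_apply_eq]
      simp
    simp only [ε, LinearEquiv.trans_apply, this]
    rfl
  refine ⟨Module.finrank ℝ L, ε.toContinuousLinearEquiv, ?_⟩
  ext y
  constructor
  · rintro ⟨x, hx, rfl⟩ i hi
    have := hε (⟨x, hx⟩, 0)
    simp only [ZeroMemClass.coe_zero, add_zero, map_zero] at this
    change ε x i = 0
    rw [this]
    induction i using Fin.addCases with
    | left j => exact absurd j.2 (not_lt.2 (by simpa using hi))
    | right j => simp
  · intro hy
    refine ⟨(Module.finBasis ℝ L).equivFun.symm (frontHalf y), Subtype.prop _, ?_⟩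
    have := hε ((Module.finBasis ℝ L).equivFun.symm (frontHalf y), 0)
    simp only [ZeroMemClass.coe_zero, add_zero, map_zero, LinearEquiv.apply_symm_apply] at this
    refine this.trans ?_
    rw [eq_comm, append_eq_iff]
    exact ⟨rfl, funext fun j => hy _ (by simp)⟩

theorem exists_isAnalyticSubmanifold_image {𝔸 : Type*} [NormedRing 𝔸] [NormedAlgebra ℝ 𝔸]
    [FiniteDimensional ℝ 𝔸] [CompleteSpace 𝔸] {N : ℕ} (Λ : 𝔸 ≃L[ℝ] (Fin N → ℝ))
    (Γ : Subgroup 𝔸ˣ) (hΓ : SA (Units.val '' (Γ : Set 𝔸ˣ))) :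
    ∃ d, IsAnalyticSubmanifold d (Λ '' (Units.val '' (Γ : Set 𝔸ˣ))) := by
  have hcl := Γ.isClosed_of_sa hΓ
  have hN : Module.finrank ℝ 𝔸 = N := by simpa using Λ.toLinearEquiv.finrank_eq
  obtain ⟨d, η, hη⟩ := exists_flatteningCLE (lieSubspace Γ hcl) hN
  refine ⟨d, ?_⟩
  rintro _ ⟨_, ⟨u, hu, rfl⟩, rfl⟩
  have := (flatAt_of_isClosed Γ hcl hu).map Λ η
  rw [hη] at this
  exact this

/-- An analytic local retraction onto an analytic submanifold, factored through a coordinate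
space. -/
lemma IsAnalyticSubmanifold.exists_retraction {n d : ℕ} {S : Set (Fin n → ℝ)}
    (hS : IsAnalyticSubmanifold d S) {x : Fin n → ℝ} (hx : x ∈ S) :
    ∃ q r : (Fin n → ℝ) → (Fin n → ℝ), AnalyticAt ℝ q x ∧
      (∀ᶠ y in 𝓝 (q x), r y ∈ S ∧ AnalyticAt ℝ r y) ∧ ∀ᶠ z in 𝓝[S] x, r (q z) = z := by
  obtain ⟨U, V, φ, ψ, hU, hV, hxU, hφ, hψ, h1, h2, h3, h4, h5⟩ := hS x hx
  let P : (Fin n → ℝ) →L[ℝ] (Fin n → ℝ) := ContinuousLinearMap.pi fun i =>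
    if (i : ℕ) < d then ContinuousLinearMap.proj i else 0
  have hP : ∀ y i, P y i = if (i : ℕ) < d then y i else 0 := by
    intro y i
    by_cases h : (i : ℕ) < d <;> simp [P, h]
  have hPL : ∀ y, P y ∈ {y : Fin n → ℝ | ∀ i : Fin n, d ≤ (i : ℕ) → y i = 0} := by
    intro y i hi
    rw [hP, if_neg (not_lt.2 hi)]
  have hPid : ∀ y ∈ {y : Fin n → ℝ | ∀ i : Fin n, d ≤ (i : ℕ) → y i = 0}, P y = y := by
    intro y hy
    ext i
    rw [hP]
    split_ifs with h
    · rfl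
    · exact (hy i (not_lt.1 h)).symm
  have hφL : ∀ z ∈ U, z ∈ S → P (φ z) = φ z := fun z hz hzS =>
    hPid _ (h5 ▸ ⟨z, ⟨hz, hzS⟩, rfl⟩ : φ z ∈ V ∩ _).2
  refine ⟨φ, fun y => ψ (P y), hφ x hxU, ?_, ?_⟩
  · have : ∀ᶠ y in 𝓝 (φ x), P y ∈ V := by
      refine P.continuous.continuousAt.eventually_mem (hV.mem_nhds ?_)
      rw [hφL x hxU hx]
      exact h1 x hxU
    filter_upwards [this] with y hy
    refine ⟨?_, (hψ _ hy).comp (P.analyticAt y)⟩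
    obtain ⟨z, ⟨hzU, hzS⟩, hz⟩ : P y ∈ φ '' (U ∩ S) := h5 ▸ ⟨hy, hPL y⟩
    rw [← hz, h3 z hzU]
    exact hzS
  · filter_upwards [mem_nhdsWithin_of_mem_nhds (hU.mem_nhds hxU), self_mem_nhdsWithin] with z hz hzS
    rw [hφL z hz hzS, h3 z hz]

/-- The derivative within an analytic submanifold is unique along its tangent space, which is
the range of a projection. -/
lemma IsAnalyticSubmanifold.exists_tangentProjection {n d : ℕ} {S : Set (Fin n → ℝ)}
    (hS : IsAnalyticSubmanifold d S) {x : Fin n → ℝ} (hx : x ∈ S) :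
    ∃ T : (Fin n → ℝ) →L[ℝ] (Fin n → ℝ), HasFDerivWithinAt (fun y => y) T S x ∧
      ∀ (f : (Fin n → ℝ) → (Fin n → ℝ)) (A A' : (Fin n → ℝ) →L[ℝ] (Fin n → ℝ)),
        HasFDerivWithinAt f A S x → HasFDerivWithinAt f A' S x → A.comp T = A'.comp T := by
  obtain ⟨q, r, hq, hr, hrq⟩ := hS.exists_retraction hx
  have hrx : r (q x) = x := hrq.self_of_nhdsWithin hx
  have hq' := hq.differentiableAt.hasFDerivAt
  have hr' := hr.self_of_nhds.2.differentiableAt.hasFDerivAt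
  refine ⟨(fderiv ℝ r (q x)).comp (fderiv ℝ q x), ?_, ?_⟩
  · exact (hr'.comp x hq').hasFDerivWithinAt.congr_of_eventuallyEq
      (hrq.mono fun z hz => hz.symm) hrx.symm
  · intro f A A' hA hA'
    have key : ∀ B : (Fin n → ℝ) →L[ℝ] (Fin n → ℝ), HasFDerivWithinAt f B S x →
        HasFDerivAt (fun y => f (r y)) (B.comp (fderiv ℝ r (q x))) (q x) := by
      intro B hB
      rw [← hrx] at hB
      have := hB.comp_of_tendsto (g := f) (f := r) (q x) (hr'.hasFDerivWithinAt (s := Set.univ))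
        (tendsto_nhdsWithin_iff.2 ⟨by
          rw [nhdsWithin_univ]
          exact hr'.continuousAt, by
          rw [nhdsWithin_univ]
          exact hr.mono fun y hy => hy.1⟩)
      exact hasFDerivWithinAt_univ.1 this
    rw [← ContinuousLinearMap.comp_assoc, (key A hA).unique (key A' hA'),
      ContinuousLinearMap.comp_assoc]

lemma IsAnalyticSubmanifold.eventually_eq_of_hasFDerivWithinAt_zero {n d : ℕ}
    {S : Set (Fin n → ℝ)} (hS : IsAnalyticSubmanifold d S) {x : Fin n → ℝ} (hx : x ∈ S)
    {f : (Fin n → ℝ) → (Fin n → ℝ)}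
    (hf : ∀ y ∈ S, HasFDerivWithinAt f (0 : (Fin n → ℝ) →L[ℝ] (Fin n → ℝ)) S y) :
    ∀ᶠ y in 𝓝[S] x, f y = f x := by
  obtain ⟨q, r, hq, hr, hrq⟩ := hS.exists_retraction hx
  obtain ⟨ε, hε, hball⟩ := Metric.eventually_nhds_iff_ball.1 hr
  have hderiv : ∀ y ∈ Metric.ball (q x) ε,
      HasFDerivAt (fun y => f (r y)) (0 : (Fin n → ℝ) →L[ℝ] (Fin n → ℝ)) y := by
    intro y hy
    have hr' := (hball y hy).2.differentiableAt.hasFDerivAt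
    have hev : ∀ᶠ z in 𝓝 y, r z ∈ S :=
      Filter.eventually_of_mem (Metric.isOpen_ball.mem_nhds hy) fun z hz => (hball z hz).1
    have := (hf _ (hball y hy).1).comp_of_tendsto (g := f) (f := r) y
      (hr'.hasFDerivWithinAt (s := Set.univ))
      (tendsto_nhdsWithin_iff.2 ⟨by
        rw [nhdsWithin_univ]
        exact hr'.continuousAt, by rwa [nhdsWithin_univ]⟩)
    rw [ContinuousLinearMap.zero_comp] at this
    exact hasFDerivWithinAt_univ.1 this
  have hconst : ∀ y ∈ Metric.ball (q x) ε, f (r y) = f (r (q x)) := by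
    intro y hy
    exact Metric.isOpen_ball.is_const_of_fderiv_eq_zero (𝕜 := ℝ) (f := fun y => f (r y))
      (convex_ball _ _).isPreconnected
      (fun z hz => (hderiv z hz).differentiableAt.differentiableWithinAt)
      (fun z hz => (hderiv z hz).fderiv) hy (Metric.mem_ball_self hε)
  have hqball : ∀ᶠ z in 𝓝[S] x, q z ∈ Metric.ball (q x) ε :=
    (hq.continuousAt.eventually_mem (Metric.ball_mem_nhds _ hε)).filter_mono nhdsWithin_le_nhds
  filter_upwards [hrq, hqball] with z hz hzb
  have := hconst _ hzb
  rwa [hz, hrq.self_of_nhdsWithin hx] at this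

section SAGraph

variable {U V W : Type*} [AddCommGroup U] [Module ℝ U] [AddCommGroup V] [Module ℝ V]
  [AddCommGroup W] [Module ℝ W]

lemma SAGraph.comp [FiniteDimensional ℝ V] {S : Set U} {T : Set V} {f : V → W} {g : U → V}
    (hf : SAGraph T f) (hg : SAGraph S g) (h : Set.MapsTo g S T) :
    SAGraph S (fun x => f (g x)) := by
  have := SA.exists (V := U × W) (W := V)
    (P := fun p v => (p.1 ∈ S ∧ v = g p.1) ∧ (v ∈ T ∧ p.2 = f v))
    ((hg.preimage (g := fun z : (U × W) × V => (z.1.1, z.2))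
      (PolMap.id.fst.fst.prodMk PolMap.id.snd)).and
    (hf.preimage (g := fun z : (U × W) × V => (z.2, z.1.2))
      (PolMap.id.snd.prodMk PolMap.id.fst.snd)))
  unfold SAGraph
  convert this using 1
  ext ⟨x, w⟩
  simp only [Set.mem_ofPred_eq]
  constructor
  · rintro ⟨hx, hw⟩
    exact ⟨g x, ⟨hx, rfl⟩, h hx, hw⟩
  · rintro ⟨_, ⟨hx, rfl⟩, -, hw⟩
    exact ⟨hx, hw⟩

lemma SAGraph.prodMk {S : Set U} {f : U → V} {g : U → W} (hf : SAGraph S f) (hg : SAGraph S g) :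
    SAGraph S (fun x => (f x, g x)) := by
  have := (hf.preimage (g := fun z : U × (V × W) => (z.1, z.2.1))
      (PolMap.id.fst.prodMk PolMap.id.snd.fst)).and
    (hg.preimage (g := fun z : U × (V × W) => (z.1, z.2.2))
      (PolMap.id.fst.prodMk PolMap.id.snd.snd))
  unfold SAGraph
  convert this using 1
  ext ⟨x, v, w⟩
  simp only [Set.mem_ofPred_eq, Prod.mk.injEq]
  tauto

lemma PolMap.saGraph [FiniteDimensional ℝ V] {S : Set U} (hS : SA S) {f : U → V} (hf : PolMap f) :
    SAGraph S f :=
  (hS.preimage PolMap.id.fst).and (SA.eq PolMap.id.snd (hf.comp PolMap.id.fst))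

lemma SAGraph.image [FiniteDimensional ℝ U] {S : Set U} {f : U → V} (hf : SAGraph S f) :
    SA (f '' S) := by
  have := SA.exists (V := V) (W := U) (P := fun v x => x ∈ S ∧ v = f x)
    (hf.preimage (g := fun z : V × U => (z.2, z.1)) (PolMap.id.snd.prodMk PolMap.id.fst))
  convert this using 1
  ext v
  simp only [Set.mem_image, Set.mem_ofPred_eq, eq_comm]

lemma SAGraph.preimage_singleton {S : Set U} {f : U → V} (hf : SAGraph S f) (v : V) :
    SA {x ∈ S | f x = v} := by
  have := hf.preimage (g := fun x => (x, v)) (PolMap.id.prodMk (PolMap.const v))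
  simpa only [Set.mem_ofPred_eq, eq_comm (a := v)] using this

end SAGraph

lemma SA.norm_le {V : Type*} [AddCommGroup V] [Module ℝ V] {n : ℕ} {f : V → (Fin n → ℝ)}
    (hf : PolMap f) {r : V → ℝ} (hr : r ∈ Pol V) : SA {x | ‖f x‖ ≤ r x} := by
  have := (SA.le (Pol.const (V := V) 0) hr).and (SA.forall_finite fun i : Fin n =>
    (SA.le (hf.apply i) hr).and (SA.le (Subalgebra.neg_mem _ hr) (hf.apply i)))
  convert this using 1
  ext x
  simp only [Set.mem_ofPred_eq]
  constructor
  · intro h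
    have h0 := (norm_nonneg _).trans h
    refine ⟨h0, fun i => ?_⟩
    have := abs_le.1 ((pi_norm_le_iff_of_nonneg h0).1 h i)
    exact ⟨this.2, this.1⟩
  · rintro ⟨h0, h⟩
    exact (pi_norm_le_iff_of_nonneg h0).2 fun i => abs_le.2 ⟨(h i).2, (h i).1⟩

namespace NashGroup

variable (G : NashGroup)

/-- Conjugation in an affine Nash group. -/
def conj (g x : Fin G.n → ℝ) : Fin G.n → ℝ := G.mul (G.mul g x) (G.inv g)

variable {G}

lemma conj_mem {g x : Fin G.n → ℝ} (hg : g ∈ G.carrier) (hx : x ∈ G.carrier) :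
    G.conj g x ∈ G.carrier :=
  G.mul_mem _ (G.mul_mem _ hg _ hx) _ (G.inv_mem _ hg)

lemma mapsTo_conj {g : Fin G.n → ℝ} (hg : g ∈ G.carrier) :
    Set.MapsTo (G.conj g) G.carrier G.carrier := fun _ hx => conj_mem hg hx

lemma coe_conj (g x : G.carrier) : (↑(g * x * g⁻¹) : Fin G.n → ℝ) = G.conj g x := rfl

lemma conj_one {g : Fin G.n → ℝ} (hg : g ∈ G.carrier) : G.conj g G.one = G.one := by
  have := coe_conj ⟨g, hg⟩ 1
  simpa [coe_one] using this.symm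

lemma one_conj {x : Fin G.n → ℝ} (hx : x ∈ G.carrier) : G.conj G.one x = x := by
  have := coe_conj 1 ⟨x, hx⟩
  simpa [coe_one] using this.symm

lemma conj_mul_left {g h x : Fin G.n → ℝ} (hg : g ∈ G.carrier) (hh : h ∈ G.carrier)
    (hx : x ∈ G.carrier) : G.conj (G.mul g h) x = G.conj g (G.conj h x) := by
  have : ∀ g h x : G.carrier, g * h * x * (g * h)⁻¹ = g * (h * x * h⁻¹) * g⁻¹ := by
    intro g h x
    group
  exact congrArg Subtype.val (this ⟨g, hg⟩ ⟨h, hh⟩ ⟨x, hx⟩)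

variable (G)

lemma la_conj : LA (G.carrier ×ˢ G.carrier) (fun p => G.conj p.1 p.2) := by
  have hf : LA (G.carrier ×ˢ G.carrier) (Prod.fst : (Fin G.n → ℝ) × (Fin G.n → ℝ) → _) :=
    AnalyticOnNhd.la fun _ _ => analyticAt_fst
  have := G.la_mul.comp (G.la_mul.prodMk (G.la_inv.comp hf fun p hp => hp.1))
    fun p hp => ⟨G.mul_mem _ hp.1 _ hp.2, G.inv_mem _ hp.1⟩
  exact this

lemma saGraph_conj : SAGraph (G.carrier ×ˢ G.carrier) (fun p => G.conj p.1 p.2) := by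
  have hS : SA (G.carrier ×ˢ G.carrier) :=
    (G.sa_carrier.preimage PolMap.id.fst).and (G.sa_carrier.preimage PolMap.id.snd)
  have := G.saGraph_mul.comp (G.saGraph_mul.prodMk
    (G.saGraph_inv.comp (PolMap.saGraph hS PolMap.id.fst) fun p hp => hp.1))
    fun p hp => ⟨G.mul_mem _ hp.1 _ hp.2, G.inv_mem _ hp.1⟩
  exact this

/-- A projection onto the tangent space at the identity. -/
noncomputable def tangentProj : (Fin G.n → ℝ) →L[ℝ] (Fin G.n → ℝ) :=
  (G.submanifold.exists_tangentProjection G.one_mem).choose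

lemma hasFDerivWithinAt_tangentProj :
    HasFDerivWithinAt (fun y => y) G.tangentProj G.carrier G.one :=
  (G.submanifold.exists_tangentProjection G.one_mem).choose_spec.1

variable {G}

lemma mul_tangentProj_eq {f : (Fin G.n → ℝ) → (Fin G.n → ℝ)}
    {A A' : (Fin G.n → ℝ) →L[ℝ] (Fin G.n → ℝ)} (h : HasFDerivWithinAt f A G.carrier G.one)
    (h' : HasFDerivWithinAt f A' G.carrier G.one) : A * G.tangentProj = A' * G.tangentProj :=
  (G.submanifold.exists_tangentProjection G.one_mem).choose_spec.2 f A A' h h'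

lemma tangentProj_mul_self : G.tangentProj * G.tangentProj = G.tangentProj :=
  mul_tangentProj_eq G.hasFDerivWithinAt_tangentProj (hasFDerivWithinAt_id _ _)

lemma hasFDerivWithinAt_mul_tangentProj {f : (Fin G.n → ℝ) → (Fin G.n → ℝ)}
    {A : (Fin G.n → ℝ) →L[ℝ] (Fin G.n → ℝ)} (h : HasFDerivWithinAt f A G.carrier G.one) :
    HasFDerivWithinAt f (A * G.tangentProj) G.carrier G.one :=
  HasFDerivWithinAt.comp (f := fun y => y) (t := G.carrier) G.one h
    G.hasFDerivWithinAt_tangentProj fun _ hx => hx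

variable (G) in
/-- The differential of conjugation at the identity, extended by zero along the kernel of the
tangent projection. -/
noncomputable def ad (g : Fin G.n → ℝ) : (Fin G.n → ℝ) →L[ℝ] (Fin G.n → ℝ) :=
  fderivWithin ℝ (G.conj g) G.carrier G.one * G.tangentProj

lemma ad_eq {g : Fin G.n → ℝ} {A : (Fin G.n → ℝ) →L[ℝ] (Fin G.n → ℝ)}
    (h : HasFDerivWithinAt (G.conj g) A G.carrier G.one) : G.ad g = A * G.tangentProj :=
  mul_tangentProj_eq h.differentiableWithinAt.hasFDerivWithinAt h

lemma exists_analytic_conj {g : Fin G.n → ℝ} (hg : g ∈ G.carrier) :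
    ∃ K : (Fin G.n → ℝ) × (Fin G.n → ℝ) → (Fin G.n → ℝ), AnalyticAt ℝ K (g, G.one) ∧
      ∀ᶠ h in 𝓝[G.carrier] g, HasFDerivWithinAt (G.conj h)
        ((fderiv ℝ K (h, G.one)).comp (ContinuousLinearMap.inr ℝ _ _)) G.carrier G.one := by
  obtain ⟨K, hK, hKc⟩ := G.la_conj (g, G.one) ⟨hg, G.one_mem⟩
  refine ⟨K, hK, ?_⟩
  rw [nhdsWithin_prod_eq] at hKc
  have h1 := hKc.curry
  have h2 : ∀ᶠ h in 𝓝[G.carrier] g, AnalyticAt ℝ K (h, G.one) := by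
    have : Filter.Tendsto (fun h : Fin G.n → ℝ => (h, G.one)) (𝓝 g) (𝓝 (g, G.one)) :=
      (by fun_prop : Continuous fun h : Fin G.n → ℝ => (h, G.one)).tendsto g
    exact (this.eventually hK.eventually_analyticAt).filter_mono nhdsWithin_le_nhds
  filter_upwards [h1, h2] with h hev hKh
  have hd : HasFDerivAt (fun x => K (h, x))
      ((fderiv ℝ K (h, G.one)).comp (ContinuousLinearMap.inr ℝ _ _)) G.one :=
    hKh.differentiableAt.hasFDerivAt.comp G.one (hasFDerivAt_prodMk_right h G.one)
  exact hd.hasFDerivWithinAt.congr_of_eventuallyEq (hev.mono fun x hx => hx.symm)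
    (hev.self_of_nhdsWithin G.one_mem).symm

lemma hasFDerivWithinAt_conj {g : Fin G.n → ℝ} (hg : g ∈ G.carrier) :
    HasFDerivWithinAt (G.conj g) (G.ad g) G.carrier G.one := by
  obtain ⟨K, -, h⟩ := exists_analytic_conj hg
  have := h.self_of_nhdsWithin hg
  rw [ad_eq this]
  exact hasFDerivWithinAt_mul_tangentProj this

lemma ad_mul_tangentProj (g : Fin G.n → ℝ) : G.ad g * G.tangentProj = G.ad g := by
  rw [ad, _root_.mul_assoc, tangentProj_mul_self]

lemma hasFDerivWithinAt_comp_conj {g : Fin G.n → ℝ} (hg : g ∈ G.carrier)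
    {f : (Fin G.n → ℝ) → (Fin G.n → ℝ)} {A : (Fin G.n → ℝ) →L[ℝ] (Fin G.n → ℝ)}
    (h : HasFDerivWithinAt f A G.carrier G.one) :
    HasFDerivWithinAt (fun x => f (G.conj g x)) (A * G.ad g) G.carrier G.one := by
  rw [← conj_one hg] at h
  have h' := hasFDerivWithinAt_conj hg
  exact HasFDerivWithinAt.comp (t := G.carrier) G.one h h' (mapsTo_conj hg)

lemma tangentProj_mul_ad {g : Fin G.n → ℝ} (hg : g ∈ G.carrier) :
    G.tangentProj * G.ad g = G.ad g := by
  have := ad_eq (hasFDerivWithinAt_comp_conj hg G.hasFDerivWithinAt_tangentProj)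
  rw [_root_.mul_assoc, ad_mul_tangentProj] at this
  exact this.symm

lemma ad_mul {g h : Fin G.n → ℝ} (hg : g ∈ G.carrier) (hh : h ∈ G.carrier) :
    G.ad (G.mul g h) = G.ad g * G.ad h := by
  have := (hasFDerivWithinAt_comp_conj hh (hasFDerivWithinAt_conj hg)).congr
    (fun x hx => conj_mul_left hg hh hx) (conj_mul_left hg hh G.one_mem)
  rw [ad_eq this, _root_.mul_assoc, ad_mul_tangentProj]

lemma ad_one : G.ad G.one = G.tangentProj := by
  have := G.hasFDerivWithinAt_tangentProj.congr (fun x hx => one_conj hx) (one_conj G.one_mem)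
  rw [ad_eq this, tangentProj_mul_self]

variable (G) in
/-- The adjoint representation, extended to the ambient space by the identity on the kernel of the
tangent projection. -/
noncomputable def adjointRep (g : Fin G.n → ℝ) : (Fin G.n → ℝ) →L[ℝ] (Fin G.n → ℝ) :=
  G.ad g + (1 - G.tangentProj)

lemma adjointRep_mul {g h : Fin G.n → ℝ} (hg : g ∈ G.carrier) (hh : h ∈ G.carrier) :
    G.adjointRep (G.mul g h) = G.adjointRep g * G.adjointRep h := by
  simp only [adjointRep, ad_mul hg hh, _root_.mul_add, _root_.add_mul, mul_sub, sub_mul,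
    _root_.mul_one, _root_.one_mul, ad_mul_tangentProj, tangentProj_mul_ad hh, tangentProj_mul_self]
  abel

lemma adjointRep_one : G.adjointRep G.one = 1 := by
  rw [adjointRep, ad_one, add_sub_cancel]

lemma la_adjointRep : LA G.carrier G.adjointRep := by
  intro g hg
  obtain ⟨K, hK, h⟩ := exists_analytic_conj hg
  refine ⟨fun h => (fderiv ℝ K (h, G.one)).comp
    ((ContinuousLinearMap.inr ℝ _ _).comp G.tangentProj) + (1 - G.tangentProj), ?_, ?_⟩
  · have h1 : AnalyticAt ℝ (fun h => fderiv ℝ K (h, G.one)) g :=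
      AnalyticAt.comp (g := fderiv ℝ K) (f := fun h => (h, G.one)) hK.fderiv
        (analyticAt_id.prod analyticAt_const)
    have h2 := (((ContinuousLinearMap.compL ℝ (Fin G.n → ℝ) ((Fin G.n → ℝ) × (Fin G.n → ℝ))
      (Fin G.n → ℝ)).flip ((ContinuousLinearMap.inr ℝ _ _).comp G.tangentProj)).analyticAt
        (fderiv ℝ K (g, G.one)))
    exact (AnalyticAt.comp (f := fun h => fderiv ℝ K (h, G.one)) h2 h1).add analyticAt_const
  · filter_upwards [h] with g' hg'
    rw [adjointRep, ad_eq hg']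
    rfl

lemma hasFDerivWithinAt_conj_iff {g : Fin G.n → ℝ} (hg : g ∈ G.carrier)
    (B : (Fin G.n → ℝ) →L[ℝ] (Fin G.n → ℝ)) :
    HasFDerivWithinAt (G.conj g) B G.carrier G.one ↔
    ∀ ε : ℝ, 0 < ε → ∃ δ : ℝ, 0 < δ ∧ ∀ w : (Fin G.n → ℝ) × (Fin G.n → ℝ) × ℝ,
      ((g, w.1) ∈ G.carrier ×ˢ G.carrier ∧ w.2.1 = G.conj g w.1) →
      (‖w.1 - G.one‖ ≤ w.2.2 ∧ w.2.2 < δ) → ‖w.2.1 - G.one - B (w.1 - G.one)‖ ≤ ε * w.2.2 := by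
  rw [hasFDerivWithinAt_iff_isLittleO, Asymptotics.isLittleO_iff, conj_one hg]
  refine forall₂_congr fun ε hε => ?_
  rw [Metric.nhdsWithin_basis_ball.eventually_iff]
  refine exists_congr fun δ => and_congr_right fun hδ => ?_
  constructor
  · rintro h ⟨x, y, r⟩ ⟨⟨-, hx⟩, hy⟩ ⟨h1, h2⟩
    simp only at hx hy h1 h2 ⊢
    subst hy
    exact (h ⟨by rw [mem_ball_iff_norm]; exact h1.trans_lt h2, hx⟩).trans (by gcongr)
  · rintro h x ⟨hx, hxG⟩
    exact h (x, G.conj g x, ‖x - G.one‖) ⟨⟨hg, hxG⟩, rfl⟩ ⟨le_rfl, by rwa [← mem_ball_iff_norm]⟩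

lemma ad_eq_iff {g : Fin G.n → ℝ} (hg : g ∈ G.carrier)
    (B : (Fin G.n → ℝ) →L[ℝ] (Fin G.n → ℝ)) :
    B = G.ad g ↔ B * G.tangentProj = B ∧ HasFDerivWithinAt (G.conj g) B G.carrier G.one := by
  constructor
  · rintro rfl
    exact ⟨ad_mul_tangentProj g, hasFDerivWithinAt_conj hg⟩
  · rintro ⟨h1, h2⟩
    rw [ad_eq h2, h1]

lemma saGraph_adjointRep : SAGraph G.carrier G.adjointRep := by
  let E := Fin G.n → ℝ
  let 𝔸 := E →L[ℝ] E
  have hB : PolMap (fun z : (((E × 𝔸) × ℝ) × ℝ) × (E × E × ℝ) => z.1.1.1.2 (z.2.1 - G.one)) :=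
    PolMap.bilin (ContinuousLinearMap.coeLM ℝ : 𝔸 →ₗ[ℝ] E →ₗ[ℝ] E) PolMap.id.fst.fst.fst.snd
      (PolMap.id.snd.fst.sub (PolMap.const G.one))
  have hpol : PolMap (fun z : (((E × 𝔸) × ℝ) × ℝ) × (E × E × ℝ) =>
      z.2.2.1 - G.one - z.1.1.1.2 (z.2.1 - G.one)) :=
    (PolMap.id.snd.snd.fst.sub (PolMap.const _)).sub hB
  have hr : (fun z : (((E × 𝔸) × ℝ) × ℝ) × (E × E × ℝ) => z.2.2.2) ∈
      Pol ((((E × 𝔸) × ℝ) × ℝ) × (E × E × ℝ)) := PolMap.real.1 PolMap.id.snd.snd.snd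
  have hε : (fun z : (((E × 𝔸) × ℝ) × ℝ) × (E × E × ℝ) => z.1.1.2) ∈
      Pol ((((E × 𝔸) × ℝ) × ℝ) × (E × E × ℝ)) := PolMap.real.1 PolMap.id.fst.fst.snd
  have hδ : (fun z : (((E × 𝔸) × ℝ) × ℝ) × (E × E × ℝ) => z.1.2) ∈
      Pol ((((E × 𝔸) × ℝ) × ℝ) × (E × E × ℝ)) := PolMap.real.1 PolMap.id.fst.snd
  have h1 := (G.saGraph_conj.preimage (g := fun z : (((E × 𝔸) × ℝ) × ℝ) × (E × E × ℝ) =>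
    ((z.1.1.1.1, z.2.1), z.2.2.1))
    ((PolMap.id.fst.fst.fst.fst.prodMk PolMap.id.snd.fst).prodMk PolMap.id.snd.snd.fst)).imp
    (((SA.norm_le (PolMap.id.snd.fst.sub (PolMap.const G.one)) hr).and (SA.lt hr hδ)).imp
      (SA.norm_le hpol (Subalgebra.mul_mem _ hε hr)))
  have h2 := (SA.pos (V := ((E × 𝔸) × ℝ) × ℝ) (PolMap.real.1 PolMap.id.snd)).and
    (SA.forall (V := ((E × 𝔸) × ℝ) × ℝ) (W := E × E × ℝ) (P := fun z w =>
      ((z.1.1.1, w.1) ∈ G.carrier ×ˢ G.carrier ∧ w.2.1 = G.conj z.1.1.1 w.1) →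
      (‖w.1 - G.one‖ ≤ w.2.2 ∧ w.2.2 < z.2) →
        ‖w.2.1 - G.one - z.1.1.2 (w.1 - G.one)‖ ≤ z.1.2 * w.2.2) h1)
  have h3 := SA.forall (V := E × 𝔸) (W := ℝ) (P := fun z ε => 0 < ε → ∃ δ : ℝ, 0 < δ ∧
    ∀ w : E × E × ℝ,
      ((z.1, w.1) ∈ G.carrier ×ˢ G.carrier ∧ w.2.1 = G.conj z.1 w.1) →
      (‖w.1 - G.one‖ ≤ w.2.2 ∧ w.2.2 < δ) → ‖w.2.1 - G.one - z.2 (w.1 - G.one)‖ ≤ ε * w.2.2)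
    ((SA.pos (PolMap.real.1 PolMap.id.snd)).imp (SA.exists (V := (E × 𝔸) × ℝ) (W := ℝ)
      (P := fun z δ => 0 < δ ∧ ∀ w : E × E × ℝ,
      ((z.1.1, w.1) ∈ G.carrier ×ˢ G.carrier ∧ w.2.1 = G.conj z.1.1 w.1) →
      (‖w.1 - G.one‖ ≤ w.2.2 ∧ w.2.2 < δ) →
        ‖w.2.1 - G.one - z.1.2 (w.1 - G.one)‖ ≤ z.2 * w.2.2) h2))
  have h4 := (G.sa_carrier.preimage (g := fun z : E × 𝔸 => z.1) PolMap.id.fst).and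
    ((SA.eq ((PolMap.linear (LinearMap.mulRight ℝ (G.tangentProj : 𝔸))).comp PolMap.id.snd)
      PolMap.id.snd).and h3)
  have h5 := h4.preimage (g := fun z : E × 𝔸 => (z.1, z.2 - (1 - G.tangentProj)))
    (PolMap.id.fst.prodMk (PolMap.id.snd.sub (PolMap.const _)))
  unfold SAGraph
  convert h5 using 1
  ext ⟨g, B⟩
  simp only [Set.mem_ofPred_eq, LinearMap.mulRight_apply]
  refine and_congr_right fun hg => ?_
  rw [← hasFDerivWithinAt_conj_iff hg, ← ad_eq_iff hg, sub_eq_iff_eq_add]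
  rfl

lemma adjointRep_eq_one_iff {g : Fin G.n → ℝ} : G.adjointRep g = 1 ↔ G.ad g = G.tangentProj := by
  rw [adjointRep]
  constructor
  · intro h
    have := congrArg (fun z => z - (1 - G.tangentProj)) h
    simpa using this
  · intro h
    rw [h, add_sub_cancel]

lemma hasFDerivWithinAt_commutator {g : Fin G.n → ℝ} (hg : g ∈ G.carrier)
    (h : G.adjointRep g = 1) :
    HasFDerivWithinAt (fun x => G.mul (G.conj g x) (G.inv x))
      (0 : (Fin G.n → ℝ) →L[ℝ] (Fin G.n → ℝ)) G.carrier G.one := by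
  rw [adjointRep_eq_one_iff] at h
  have hc := hasFDerivWithinAt_conj hg
  rw [h] at hc
  have hf : LA (G.carrier ×ˢ G.carrier) (fun p => G.mul p.1 (G.inv p.2)) := by
    have h1 : LA (G.carrier ×ˢ G.carrier) (Prod.fst : (Fin G.n → ℝ) × (Fin G.n → ℝ) → _) :=
      AnalyticOnNhd.la fun _ _ => analyticAt_fst
    have h2 : LA (G.carrier ×ˢ G.carrier) (Prod.snd : (Fin G.n → ℝ) × (Fin G.n → ℝ) → _) :=
      AnalyticOnNhd.la fun _ _ => analyticAt_snd
    exact G.la_mul.comp (h1.prodMk (G.la_inv.comp h2 fun p hp => hp.2))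
      fun p hp => ⟨hp.1, G.inv_mem _ hp.2⟩
  obtain ⟨K, hK, hKf⟩ := hf (G.one, G.one) ⟨G.one_mem, G.one_mem⟩
  have hd : HasFDerivWithinAt (fun p : (Fin G.n → ℝ) × (Fin G.n → ℝ) => G.mul p.1 (G.inv p.2))
      (fderiv ℝ K (G.one, G.one)) (G.carrier ×ˢ G.carrier) (G.one, G.one) :=
    hK.differentiableAt.hasFDerivAt.hasFDerivWithinAt.congr_of_eventuallyEq hKf.symm
      (hKf.self_of_nhdsWithin ⟨G.one_mem, G.one_mem⟩).symm
  have key : ∀ f : (Fin G.n → ℝ) → (Fin G.n → ℝ), Set.MapsTo f G.carrier G.carrier →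
      f G.one = G.one → HasFDerivWithinAt f G.tangentProj G.carrier G.one →
      HasFDerivWithinAt (fun x => G.mul (f x) (G.inv x))
        ((fderiv ℝ K (G.one, G.one)).comp (G.tangentProj.prod G.tangentProj)) G.carrier
        G.one := by
    intro f hfm hf1 hf
    have h1 := hf.prodMk G.hasFDerivWithinAt_tangentProj
    have hd' : HasFDerivWithinAt
        (fun p : (Fin G.n → ℝ) × (Fin G.n → ℝ) => G.mul p.1 (G.inv p.2))
        (fderiv ℝ K (G.one, G.one)) (G.carrier ×ˢ G.carrier) (f G.one, G.one) := by
      rwa [hf1]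
    exact HasFDerivWithinAt.comp (f := fun x => (f x, x)) (t := G.carrier ×ˢ G.carrier) G.one
      hd' h1 fun x hx => ⟨hfm hx, hx⟩
  have h1 := hasFDerivWithinAt_mul_tangentProj (key _ (mapsTo_conj hg) (conj_one hg) hc)
  have h2 := key (fun x => x) (fun _ hx => hx) rfl G.hasFDerivWithinAt_tangentProj
  have hcancel : ∀ x ∈ G.carrier, G.mul x (G.inv x) = G.one := fun x hx =>
    congrArg Subtype.val (mul_inv_cancel (⟨x, hx⟩ : G.carrier))
  have h3 := (hasFDerivWithinAt_const G.one G.one G.carrier (𝕜 := ℝ)).congr hcancel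
    (hcancel _ G.one_mem)
  rwa [mul_tangentProj_eq h2 h3, zero_mul] at h1

lemma hasFDerivWithinAt_commutator_zero {g : Fin G.n → ℝ} (hg : g ∈ G.carrier)
    (h : G.adjointRep g = 1) {x : Fin G.n → ℝ} (hx : x ∈ G.carrier) :
    HasFDerivWithinAt (fun y => G.mul (G.conj g y) (G.inv y))
      (0 : (Fin G.n → ℝ) →L[ℝ] (Fin G.n → ℝ)) G.carrier x := by
  have hid : ∀ g x y : G.carrier, g * y * g⁻¹ * y⁻¹ =
      (g * x * g⁻¹) * (g * (x⁻¹ * y) * g⁻¹ * (x⁻¹ * y)⁻¹) * x⁻¹ := by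
    intro g x y
    group
  have hone : G.mul (G.inv x) x = G.one := G.inv_mul_cancel x hx
  have hone' : G.mul (G.conj g G.one) (G.inv G.one) = G.one := by
    rw [conj_one hg]
    exact congrArg Subtype.val (mul_inv_cancel (1 : G.carrier))
  obtain ⟨L, hL, hLx⟩ : ∃ L, AnalyticAt ℝ L x ∧
      L =ᶠ[𝓝[G.carrier] x] fun y => G.mul (G.inv x) y :=
    (G.la_mul.comp ((AnalyticOnNhd.la (f := fun _ : Fin G.n → ℝ => G.inv x)
      fun _ _ => analyticAt_const).prodMk (AnalyticOnNhd.la fun _ _ => analyticAt_id))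
      fun y hy => ⟨G.inv_mem _ hx, hy⟩) x hx
  have hLd : HasFDerivWithinAt (fun y => G.mul (G.inv x) y) (fderiv ℝ L x) G.carrier x :=
    hL.differentiableAt.hasFDerivAt.hasFDerivWithinAt.congr_of_eventuallyEq hLx.symm
      (hLx.self_of_nhdsWithin hx).symm
  have hRla : LA G.carrier (fun y => G.mul (G.mul (G.conj g x) y) (G.inv x)) := by
    have hc : ∀ c, LA G.carrier (fun _ : Fin G.n → ℝ => (c : Fin G.n → ℝ)) := fun c =>
      AnalyticOnNhd.la fun _ _ => analyticAt_const
    exact G.la_mul.comp ((G.la_mul.comp ((hc (G.conj g x)).prodMk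
      (AnalyticOnNhd.la fun _ _ => analyticAt_id)) fun y hy => ⟨conj_mem hg hx, hy⟩).prodMk
      (hc (G.inv x))) fun y hy => ⟨G.mul_mem _ (conj_mem hg hx) _ hy, G.inv_mem _ hx⟩
  obtain ⟨R, hR, hRx⟩ := hRla G.one G.one_mem
  have hRd : HasFDerivWithinAt (fun y => G.mul (G.mul (G.conj g x) y) (G.inv x))
      (fderiv ℝ R G.one) G.carrier G.one :=
    hR.differentiableAt.hasFDerivAt.hasFDerivWithinAt.congr_of_eventuallyEq hRx.symm
      (hRx.self_of_nhdsWithin G.one_mem).symm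
  have h1 := hasFDerivWithinAt_commutator hg h
  have hmaps : Set.MapsTo (fun y => G.mul (G.conj g y) (G.inv y)) G.carrier G.carrier :=
    fun y hy => G.mul_mem _ (conj_mem hg hy) _ (G.inv_mem _ hy)
  rw [← hone'] at hRd
  have h2 := HasFDerivWithinAt.comp (f := fun y => G.mul (G.conj g y) (G.inv y))
    (t := G.carrier) G.one hRd h1 hmaps
  rw [ContinuousLinearMap.comp_zero] at h2
  rw [← hone] at h2
  have h3 := HasFDerivWithinAt.comp (f := fun y => G.mul (G.inv x) y) (t := G.carrier) x
    (by rwa [hone] at h2 ⊢) hLd fun y hy => G.mul_mem _ (G.inv_mem _ hx) _ hy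
  rw [ContinuousLinearMap.zero_comp] at h3
  exact h3.congr (fun y hy => congrArg Subtype.val (hid ⟨g, hg⟩ ⟨x, hx⟩ ⟨y, hy⟩))
    (congrArg Subtype.val (hid ⟨g, hg⟩ ⟨x, hx⟩ ⟨x, hx⟩))

/-- The kernel of the adjoint representation centralizes the identity component. -/
theorem mul_comm_of_adjointRep_eq_one {g : Fin G.n → ℝ} (hg : g ∈ G.carrier)
    (h : G.adjointRep g = 1) {x : Fin G.n → ℝ}
    (hx : x ∈ connectedComponentIn G.carrier G.one) : G.mul g x = G.mul x g := by
  have hxG : x ∈ G.carrier := connectedComponentIn_subset _ _ hx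
  let f : G.carrier → (Fin G.n → ℝ) := fun y => G.mul (G.conj g y) (G.inv y)
  have hf : IsLocallyConstant f := by
    rw [IsLocallyConstant.iff_eventually_eq]
    intro y
    have := G.submanifold.eventually_eq_of_hasFDerivWithinAt_zero y.2
      fun z hz => hasFDerivWithinAt_commutator_zero hg h hz
    rw [nhdsWithin_eq_map_subtype_coe y.2] at this
    exact Filter.eventually_map.1 this
  rw [connectedComponentIn_eq_image G.one_mem] at hx
  obtain ⟨x, hx, rfl⟩ := hx
  have h1 : f x = f ⟨G.one, G.one_mem⟩ :=
    hf.apply_eq_of_isPreconnected isPreconnected_connectedComponent hx mem_connectedComponent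
  have h2 : (⟨g, hg⟩ * x * ⟨g, hg⟩⁻¹ * x⁻¹ : G.carrier) = 1 := by
    refine Subtype.ext (h1.trans ?_)
    change (↑((⟨g, hg⟩ : G.carrier) * 1 * ⟨g, hg⟩⁻¹ * 1⁻¹) : Fin G.n → ℝ) = (1 : G.carrier)
    congr 1
    group
  have h3 : (⟨g, hg⟩ * x : G.carrier) = x * ⟨g, hg⟩ := by
    rw [← commutatorElement_def, commutatorElement_eq_one_iff_mul_comm] at h2
    exact h2
  exact congrArg Subtype.val h3

end NashGroup

section UnitGroup

variable {𝔸 : Type*} [NormedRing 𝔸] [NormedAlgebra ℝ 𝔸] [FiniteDimensional ℝ 𝔸] [CompleteSpace 𝔸]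
  {N : ℕ} (Λ : 𝔸 ≃L[ℝ] (Fin N → ℝ)) (Γ : Subgroup 𝔸ˣ)

/-- A semialgebraic group of units of a finite-dimensional algebra as an affine Nash group. -/
noncomputable def unitNashGroup (hΓ : SA (Units.val '' (Γ : Set 𝔸ˣ))) : NashGroup where
  n := N
  dim := (exists_isAnalyticSubmanifold_image Λ Γ hΓ).choose
  carrier := Λ '' (Units.val '' (Γ : Set 𝔸ˣ))
  semialg := (hΓ.image (PolMap.linear Λ.toLinearEquiv.toLinearMap)).isSemialgebraic
  submanifold := (exists_isAnalyticSubmanifold_image Λ Γ hΓ).choose_spec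
  one := Λ 1
  mul x y := Λ (Λ.symm x * Λ.symm y)
  inv x := Λ (Ring.inverse (Λ.symm x))
  one_mem := ⟨1, ⟨1, Γ.one_mem, rfl⟩, rfl⟩
  mul_mem := by
    rintro _ ⟨_, ⟨u, hu, rfl⟩, rfl⟩ _ ⟨_, ⟨v, hv, rfl⟩, rfl⟩
    exact ⟨_, ⟨u * v, Γ.mul_mem hu hv, rfl⟩, by simp⟩
  inv_mem := by
    rintro _ ⟨_, ⟨u, hu, rfl⟩, rfl⟩
    exact ⟨_, ⟨u⁻¹, Γ.inv_mem hu, rfl⟩, by simp⟩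
  mul_assoc _ _ _ _ _ _ := by simp [mul_assoc]
  one_mul _ _ := by simp
  mul_one _ _ := by simp
  inv_mul_cancel := by
    rintro _ ⟨_, ⟨u, hu, rfl⟩, rfl⟩
    simp
  mul_nash := by
    have hC := hΓ.image (PolMap.linear Λ.toLinearEquiv.toLinearMap)
    refine isNashMapOn_iff.2 ⟨AnalyticOnNhd.la fun z _ => ?_, ?_⟩
    · have h1 : AnalyticAt ℝ (fun z : Fin (N + N) → ℝ => Λ.symm (frontHalf z)) z :=
        (((Λ.symm : (Fin N → ℝ) →L[ℝ] 𝔸).comp ((ContinuousLinearMap.fst ℝ (Fin N → ℝ) (Fin N → ℝ)).comp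
          ((appendCLE N N).symm : (Fin (N + N) → ℝ) →L[ℝ] _))).analyticAt z).congr
          (Filter.Eventually.of_forall fun z => by simp [appendCLE_symm_apply])
      have h2 : AnalyticAt ℝ (fun z : Fin (N + N) → ℝ => Λ.symm (backHalf z)) z :=
        (((Λ.symm : (Fin N → ℝ) →L[ℝ] 𝔸).comp ((ContinuousLinearMap.snd ℝ (Fin N → ℝ) (Fin N → ℝ)).comp
          ((appendCLE N N).symm : (Fin (N + N) → ℝ) →L[ℝ] _))).analyticAt z).congr
          (Filter.Eventually.of_forall fun z => by simp [appendCLE_symm_apply])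
      exact (Λ.analyticAt _).comp (h1.mul h2)
    · refine PolMap.saGraph ((hC.preimage PolMap.frontHalf).and (hC.preimage PolMap.backHalf)) ?_
      exact (PolMap.linear Λ.toLinearEquiv.toLinearMap).comp (PolMap.bilin (LinearMap.mul ℝ 𝔸)
        ((PolMap.linear Λ.symm.toLinearEquiv.toLinearMap).comp PolMap.frontHalf)
        ((PolMap.linear Λ.symm.toLinearEquiv.toLinearMap).comp PolMap.backHalf))
  inv_nash := by
    have hC := hΓ.image (PolMap.linear Λ.toLinearEquiv.toLinearMap)
    refine isNashMapOn_iff.2 ⟨AnalyticOnNhd.la ?_, ?_⟩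
    · rintro _ ⟨_, ⟨u, hu, rfl⟩, rfl⟩
      have h1 : AnalyticAt ℝ Ring.inverse (Λ.symm (Λ u)) := by
        rw [Λ.symm_apply_apply]
        exact analyticAt_inverse u
      exact (Λ.analyticAt _).comp (h1.comp (Λ.symm.analyticAt _))
    · have h1 : PolMap (fun p : (Fin N → ℝ) × (Fin N → ℝ) => Λ.symm p.2 * Λ.symm p.1) :=
        PolMap.bilin (LinearMap.mul ℝ 𝔸)
          ((PolMap.linear Λ.symm.toLinearEquiv.toLinearMap).comp PolMap.id.snd)
          ((PolMap.linear Λ.symm.toLinearEquiv.toLinearMap).comp PolMap.id.fst)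
      have h2 := (hC.preimage (g := fun p : (Fin N → ℝ) × (Fin N → ℝ) => p.1) PolMap.id.fst).and
        (SA.eq h1 (PolMap.const 1))
      unfold SAGraph
      convert h2 using 1
      ext ⟨x, y⟩
      refine and_congr_right ?_
      rintro ⟨_, ⟨u, hu, rfl⟩, rfl⟩
      simp only [Λ.symm_apply_apply, Ring.inverse_unit]
      rw [Units.mul_eq_one_iff_eq_inv, ContinuousLinearEquiv.symm_apply_eq]

end UnitGroup

/-- Flattening of square matrices as a linear equivalence. -/
def matFlattenLinearEquiv (m : ℕ) : Matrix (Fin m) (Fin m) ℝ ≃ₗ[ℝ] (Fin (m * m) → ℝ) where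
  toFun := matFlatten
  invFun v i j := v (finProdFinEquiv (i, j))
  map_add' _ _ := rfl
  map_smul' _ _ := rfl
  left_inv A := by
    ext i j
    simp [matFlatten]
  right_inv v := by
    ext k
    exact congrArg v (finProdFinEquiv.apply_symm_apply k)

/-- Flattening of linear endomorphisms of a coordinate space. -/
noncomputable def endFlatten (n : ℕ) :
    ((Fin n → ℝ) →L[ℝ] (Fin n → ℝ)) ≃L[ℝ] (Fin (n * n) → ℝ) :=
  (LinearMap.toContinuousLinearMap.symm ≪≫ₗ LinearMap.toMatrix' ≪≫ₗ
    matFlattenLinearEquiv n).toContinuousLinearEquiv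

lemma unitNashGroup_almostLinear {n : ℕ} (Γ : Subgroup ((Fin n → ℝ) →L[ℝ] (Fin n → ℝ))ˣ)
    (hΓ : SA (Units.val '' (Γ : Set ((Fin n → ℝ) →L[ℝ] (Fin n → ℝ))ˣ))) :
    (unitNashGroup (endFlatten n) Γ hΓ).AlmostLinear := by
  let Q := unitNashGroup (endFlatten n) Γ hΓ
  let f : (Fin (n * n) → ℝ) → Matrix (Fin n) (Fin n) ℝ := fun x =>
    LinearMap.toMatrix' ((endFlatten n).symm x : (Fin n → ℝ) →ₗ[ℝ] (Fin n → ℝ))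
  have hf : ∀ A, f (endFlatten n A) = LinearMap.toMatrix' (A : (Fin n → ℝ) →ₗ[ℝ] (Fin n → ℝ)) := by
    intro A
    simp only [f, ContinuousLinearEquiv.symm_apply_apply]
  have hflat : ∀ x, matFlatten (f x) = x := by
    intro x
    exact (endFlatten n).apply_symm_apply x
  refine ⟨n, f, ?_, ?_, ?_, ?_⟩
  · change IsNashMapOn Q.carrier (fun x : Fin (n * n) → ℝ => matFlatten (f x))
    simp only [hflat]
    exact isNashMapOn_iff.2 ⟨AnalyticOnNhd.la fun _ _ => analyticAt_id,
      PolMap.saGraph Q.sa_carrier PolMap.id⟩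
  · rintro _ ⟨_, ⟨u, hu, rfl⟩, rfl⟩
    rw [hf]
    refine IsUnit.of_mul_eq_one (LinearMap.toMatrix'
      ((u⁻¹ : ((Fin n → ℝ) →L[ℝ] (Fin n → ℝ))ˣ) : (Fin n → ℝ) →ₗ[ℝ] (Fin n → ℝ))) ?_
    rw [← LinearMap.toMatrix'_mul, ← LinearMap.toMatrix'_one, ← ContinuousLinearMap.toLinearMap_mul,
      u.mul_inv]
    rfl
  · intro x hx y hy
    change f (endFlatten n ((endFlatten n).symm x * (endFlatten n).symm y)) = _
    rw [hf]
    exact LinearMap.toMatrix'_mul _ _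
  · refine (Set.finite_singleton (endFlatten n 1)).subset ?_
    rintro x ⟨-, hx⟩
    rw [Set.mem_singleton_iff, ← hflat x, hx, ← hflat (endFlatten n 1), hf]
    congr 1
    exact LinearMap.toMatrix'_one.symm

namespace NashGroup

variable (G : NashGroup)

/-- The adjoint representation as a homomorphism of abstract groups. -/
noncomputable def adjointHom : G.carrier →* ((Fin G.n → ℝ) →L[ℝ] (Fin G.n → ℝ))ˣ :=
  MonoidHom.toHomUnits
    { toFun := fun g => G.adjointRep g
      map_one' := adjointRep_one
      map_mul' := fun g h => adjointRep_mul g.2 h.2 }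

lemma val_image_range_adjointHom :
    Units.val '' (G.adjointHom.range : Set ((Fin G.n → ℝ) →L[ℝ] (Fin G.n → ℝ))ˣ) =
      G.adjointRep '' G.carrier := by
  ext A
  constructor
  · rintro ⟨_, ⟨g, rfl⟩, rfl⟩
    exact ⟨g, g.2, rfl⟩
  · rintro ⟨g, hg, rfl⟩
    exact ⟨_, ⟨⟨g, hg⟩, rfl⟩, rfl⟩

theorem hasAlmostLinearQuotientBy_ker_adjointRep :
    IsNashSubgroup G {x ∈ G.carrier | G.adjointRep x = 1} ∧
    IsNormalIn G G.carrier {x ∈ G.carrier | G.adjointRep x = 1} ∧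
    HasAlmostLinearQuotientBy G {x ∈ G.carrier | G.adjointRep x = 1} := by
  have hinv : ∀ x ∈ G.carrier, G.adjointRep x * G.adjointRep (G.inv x) = 1 := by
    intro x hx
    rw [← adjointRep_mul hx (G.inv_mem _ hx), ← adjointRep_one]
    exact congrArg G.adjointRep (congrArg Subtype.val (mul_inv_cancel (⟨x, hx⟩ : G.carrier)))
  have hΓ : SA (Units.val ''
      (G.adjointHom.range : Set ((Fin G.n → ℝ) →L[ℝ] (Fin G.n → ℝ))ˣ)) := by
    rw [val_image_range_adjointHom]
    exact saGraph_adjointRep.image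
  refine ⟨⟨Set.sep_subset _ _, ⟨G.one_mem, adjointRep_one⟩, ?_, ?_,
    (saGraph_adjointRep.preimage_singleton 1).isSemialgebraic⟩, ?_, ?_⟩
  · rintro x ⟨hx, hx1⟩ y ⟨hy, hy1⟩
    exact ⟨G.mul_mem _ hx _ hy, by rw [adjointRep_mul hx hy, hx1, hy1, _root_.one_mul]⟩
  · rintro x ⟨hx, hx1⟩
    refine ⟨G.inv_mem _ hx, ?_⟩
    have := hinv x hx
    rwa [hx1, _root_.one_mul] at this
  · rintro g hg x ⟨hx, hx1⟩
    refine ⟨conj_mem hg hx, ?_⟩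
    rw [adjointRep_mul (G.mul_mem _ hg _ hx) (G.inv_mem _ hg), adjointRep_mul hg hx, hx1,
      _root_.mul_one, hinv g hg]
  · refine ⟨unitNashGroup (endFlatten G.n) G.adjointHom.range hΓ,
      fun x => endFlatten G.n (G.adjointRep x), ⟨?_, ?_, ?_⟩, ?_, ?_,
      unitNashGroup_almostLinear _ hΓ⟩
    · intro x hx
      exact ⟨_, ⟨_, ⟨⟨x, hx⟩, rfl⟩, rfl⟩, rfl⟩
    · intro x hx y hy
      change _ = endFlatten G.n ((endFlatten G.n).symm (endFlatten G.n (G.adjointRep x)) *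
        (endFlatten G.n).symm (endFlatten G.n (G.adjointRep y)))
      simp only [ContinuousLinearEquiv.symm_apply_apply, adjointRep_mul hx hy]
    · refine isNashMapOn_iff.2 ⟨?_, ?_⟩
      · exact LA.comp (T := Set.univ) (AnalyticOnNhd.la fun A _ => (endFlatten G.n).analyticAt A)
          la_adjointRep fun _ _ => trivial
      · exact SAGraph.comp (T := Set.univ) (PolMap.saGraph SA.univ
          (PolMap.linear (endFlatten G.n).toLinearEquiv.toLinearMap)) saGraph_adjointRep
          fun _ _ => trivial
    · change _ = endFlatten G.n '' _
      rw [val_image_range_adjointHom, Set.image_image]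
      rfl
    · ext x
      refine and_congr_right fun _ => ?_
      exact (endFlatten G.n).injective.eq_iff

end NashGroup

end NashGroups

/-- The smallest normal Nash subgroup `H` of an affine Nash group `G` with an
almost linear quotient lies in the center of the identity connected component
`G⁰` of `G`; in particular, `H` is commutative. -/
theorem smallest_normal_with_almost_linear_quotient_central (G : NashGroup)
    (H : Set (Fin G.n → ℝ))
    (hsub : IsNashSubgroup G H) (hnorm : IsNormalIn G G.carrier H)
    (hquot : HasAlmostLinearQuotientBy G H)
    (hsmall : ∀ K : Set (Fin G.n → ℝ), IsNashSubgroup G K → IsNormalIn G G.carrier K →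
      HasAlmostLinearQuotientBy G K → H ⊆ K) :
    (∀ h ∈ H, h ∈ connectedComponentIn G.carrier G.one ∧
      ∀ g ∈ connectedComponentIn G.carrier G.one, G.mul h g = G.mul g h) ∧
    (∀ x ∈ H, ∀ y ∈ H, G.mul x y = G.mul y x) := by
  obtain ⟨h1, h2, h3⟩ := G.hasAlmostLinearQuotientBy_connectedComponentIn
  obtain ⟨h4, h5, h6⟩ := G.hasAlmostLinearQuotientBy_ker_adjointRep
  have hcomp := hsmall _ h1 h2 h3
  have hker := hsmall _ h4 h5 h6
  have hcomm : ∀ h ∈ H, ∀ g ∈ connectedComponentIn G.carrier G.one, G.mul h g = G.mul g h :=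
    fun h hh g hg => NashGroup.mul_comm_of_adjointRep_eq_one (hker hh).1 (hker hh).2 hg
  exact ⟨fun h hh => ⟨hcomp hh, hcomm h hh⟩, fun x hx y hy => hcomm x hx y (hcomp hy)⟩
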